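/- arXiv:math/0609529 — 2 statements merged into one kernel-verified Lean document; each statement's English description precedes it below -/
import Mathlib

section
/- Let K_x ⊂ ℝ^n and K_yz ⊂ ℝ^{m+p} be compact, and assume K = K_x × K_yz ⊂ ℝ^{n+m+p} has nonempty interior. If f ∈ ℝ[X,Y] + ℝ[Y,Z] and f(x,y,z) > 0 for all (x,y,z) ∈ K, then f ∈ Σ²_xy + P(g) + P(h), i.e. f = κ + σ + ψ for some sum of squares κ ∈ Σ²_xy, some σ ∈ P(g) and some ψ ∈ P(h). -/
open MvPolynomial

/-- A polynomial is a sum of squares. -/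
def IsSOS {ι : Type*} (q : MvPolynomial ι ℝ) : Prop :=
  ∃ (k : ℕ) (s : Fin k → MvPolynomial ι ℝ), q = ∑ i, (s i) ^ 2

/-- Membership in the preordering generated by a finite family `g`:
`σ = Σ_{J ⊆ I} σ_J ∏_{j ∈ J} g_j` with each `σ_J` a sum of squares. -/
def InPreordering {ι κ : Type*} [Fintype κ] [DecidableEq κ]
    (g : κ → MvPolynomial ι ℝ) (σ : MvPolynomial ι ℝ) : Prop :=
  ∃ c : Finset κ → MvPolynomial ι ℝ,
    (∀ J, IsSOS (c J)) ∧ σ = ∑ J : Finset κ, c J * ∏ j ∈ J, g j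

/-- Membership in the quadratic module generated by a finite family `g`:
`σ = σ₀ + Σ_j σ_j g_j` with `σ₀` and each `σ_j` sums of squares. -/
def InQuadraticModule {ι κ : Type*} [Fintype κ]
    (g : κ → MvPolynomial ι ℝ) (σ : MvPolynomial ι ℝ) : Prop :=
  ∃ (c₀ : MvPolynomial ι ℝ) (c : κ → MvPolynomial ι ℝ),
    IsSOS c₀ ∧ (∀ j, IsSOS (c j)) ∧ σ = c₀ + ∑ j, c j * g j

section
open Polynomial
set_option linter.unusedSectionVars false

/-- Intermediate value property for polynomials over an ordered field. -/
def PolyIVT (K : Type) [Field K] [LinearOrder K] : Prop :=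
  ∀ (p : Polynomial K) (u v : K), u < v → p.eval u * p.eval v < 0 →
    ∃ w, u < w ∧ w < v ∧ p.eval w = 0

section
variable {K : Type} [Field K] [LinearOrder K] [IsStrictOrderedRing K]

theorem PolyIVT.mul_pos (hK : PolyIVT K) (p : Polynomial K) {u v : K} (huv : u < v)
    (hu : p.eval u ≠ 0) (hv : p.eval v ≠ 0) (h : ∀ w, u < w → w < v → p.eval w ≠ 0) :
    0 < p.eval u * p.eval v := by
  rcases lt_trichotomy (p.eval u * p.eval v) 0 with h1 | h1 | h1
  · obtain ⟨w, h2, h3, h4⟩ := hK p u v huv h1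
    exact absurd h4 (h w h2 h3)
  · exact absurd h1 (mul_ne_zero hu hv)
  · exact h1

theorem PolyIVT.sign_eq (hK : PolyIVT K) (p : Polynomial K) {u v : K} (huv : u < v)
    (hu : p.eval u ≠ 0) (hv : p.eval v ≠ 0) (h : ∀ w, u < w → w < v → p.eval w ≠ 0) :
    SignType.sign (p.eval u) = SignType.sign (p.eval v) := by
  have := hK.mul_pos p huv hu hv h
  rcases pos_and_pos_or_neg_and_neg_of_mul_pos this with ⟨h1, h2⟩ | ⟨h1, h2⟩
  · rw [sign_pos h1, sign_pos h2]
  · rw [sign_neg h1, sign_neg h2]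

theorem rolle_aux (hK : PolyIVT K) (p : Polynomial K) (hp : p ≠ 0) {a b : K} (hab : a < b)
    (ha : p.eval a = 0) (hb : p.eval b = 0) (hno : ∀ w, a < w → w < b → p.eval w ≠ 0) :
    ∃ w, a < w ∧ w < b ∧ p.derivative.eval w = 0 := by
  obtain ⟨q, hq, hqa⟩ := Polynomial.exists_eq_pow_rootMultiplicity_mul_and_not_dvd p hp a
  set m := p.rootMultiplicity a
  have hq0 : q ≠ 0 := by rintro rfl; simp at hqa
  obtain ⟨r, hr, hrb⟩ := Polynomial.exists_eq_pow_rootMultiplicity_mul_and_not_dvd q hq0 b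
  set k := q.rootMultiplicity b
  have hm : m ≠ 0 := by
    have : 0 < m := (Polynomial.rootMultiplicity_pos hp).2 ha
    omega
  have hqb : q.eval b = 0 := by
    rw [hq] at hb
    simpa [sub_eq_zero, hab.ne', hm] using hb
  have hk : k ≠ 0 := by
    have : 0 < k := (Polynomial.rootMultiplicity_pos hq0).2 hqb
    omega
  have hra : r.eval a ≠ 0 := by
    intro h
    apply hqa
    rw [Polynomial.dvd_iff_isRoot, Polynomial.IsRoot, hr]
    simp [h]
  have hrb' : r.eval b ≠ 0 := by
    intro h
    apply hrb
    rw [Polynomial.dvd_iff_isRoot]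
    exact h
  have hrno : ∀ w, a < w → w < b → r.eval w ≠ 0 := by
    intro w h1 h2 h3
    apply hno w h1 h2
    rw [hq, hr]
    simp [h3]
  have hpos := hK.mul_pos r hab hra hrb' hrno
  obtain ⟨m', hm'⟩ : ∃ m', m = m' + 1 := ⟨m - 1, by omega⟩
  obtain ⟨k', hk'⟩ : ∃ k', k = k' + 1 := ⟨k - 1, by omega⟩
  rw [hk'] at hr
  rw [hm', hr] at hq
  let h : Polynomial K := Polynomial.C (m' + 1 : K) * (Polynomial.X - Polynomial.C b) * r + Polynomial.C (k' + 1 : K) * (Polynomial.X - Polynomial.C a) * r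
    + (Polynomial.X - Polynomial.C a) * (Polynomial.X - Polynomial.C b) * r.derivative
  have hder : p.derivative = (Polynomial.X - Polynomial.C a) ^ m' * (Polynomial.X - Polynomial.C b) ^ k' * h := by
    rw [hq]
    simp only [derivative_mul, derivative_X_sub_C_pow, h, Nat.add_sub_cancel]
    push_cast
    simp only [map_add, map_natCast, map_one]
    ring
  obtain ⟨w, h1, h2, h3⟩ := hK h a b hab (by
    have ea : h.eval a = (m' + 1) * (a - b) * r.eval a := by simp [h]
    have eb : h.eval b = (k' + 1) * (b - a) * r.eval b := by simp [h]
    rw [ea, eb]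
    have h1 : (0 : K) < (m' + 1) * (k' + 1) := by positivity
    have h2 : 0 < (b - a) ^ 2 := pow_pos (sub_pos.2 hab) 2
    have := _root_.mul_pos (_root_.mul_pos h1 h2) hpos
    linarith)
  exact ⟨w, h1, h2, by rw [hder]; simp [h3]⟩

theorem rolle (hK : PolyIVT K) (p : Polynomial K) (hp : p ≠ 0) {a b : K} (hab : a < b)
    (ha : p.eval a = 0) (hb : p.eval b = 0) :
    ∃ w, a < w ∧ w < b ∧ p.derivative.eval w = 0 := by
  classical
  obtain ⟨c, hc, hmin⟩ := Finset.exists_min_image (p.roots.toFinset.filter (fun x => a < x)) id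
    ⟨b, by simp [hp, hb, hab]⟩
  simp only [Finset.mem_filter, Multiset.mem_toFinset, mem_roots hp, IsRoot, id] at hc hmin
  obtain ⟨w, h1, h2, h3⟩ := rolle_aux hK p hp hc.2 ha hc.1 (by
    intro w h1 h2 h3
    exact absurd (hmin w ⟨h3, h1⟩) (not_le.2 h2))
  exact ⟨w, h1, h2.trans_le (hmin b ⟨hb, hab⟩), h3⟩

theorem root_bound {F : Type} [Field F] (i : F →+* K) (p : Polynomial F) (x : K)
    (hp : p ≠ 0) (hx : (p.map i).eval x = 0) :
    |x| < i (1 + ∑ k ∈ Finset.range p.natDegree, (1 + (p.coeff k / p.leadingCoeff) ^ 2)) := by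
  set d := p.natDegree with hd
  have hd0 : d ≠ 0 := by
    intro h0
    obtain ⟨c, rfl⟩ := Polynomial.natDegree_eq_zero.1 h0
    simp at hx
    simp [hx] at hp
  by_contra hcon
  rw [not_lt] at hcon
  set c : ℕ → K := fun k => i (p.coeff k / p.leadingCoeff) with hc
  have hlc : i p.leadingCoeff ≠ 0 := by simpa using hp
  have e1 : i (1 + ∑ k ∈ Finset.range d, (1 + (p.coeff k / p.leadingCoeff) ^ 2)) =
      1 + ∑ k ∈ Finset.range d, (1 + c k ^ 2) := by simp [hc]
  rw [e1] at hcon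
  have h0 : ∀ k, |c k| ≤ 1 + c k ^ 2 := fun k => by
    rcases abs_cases (c k) with ⟨h, _⟩ | ⟨h, _⟩ <;> rw [h] <;> nlinarith [sq_nonneg (c k - 1), sq_nonneg (c k + 1)]
  have hsum : ∑ k ∈ Finset.range d, |c k| ≤ ∑ k ∈ Finset.range d, (1 + c k ^ 2) :=
    Finset.sum_le_sum fun k _ => h0 k
  have hsum0 : 0 ≤ ∑ k ∈ Finset.range d, |c k| := Finset.sum_nonneg fun k _ => abs_nonneg _
  have hx1 : 1 ≤ |x| := by linarith
  have e2 : x ^ d = - ∑ k ∈ Finset.range d, c k * x ^ k := by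
    rw [Polynomial.eval_map, Polynomial.eval₂_eq_sum_range, Finset.sum_range_succ, ← hd] at hx
    have : p.coeff d = p.leadingCoeff := rfl
    rw [this] at hx
    have h3 : ∑ k ∈ Finset.range d, c k * x ^ k =
        (∑ k ∈ Finset.range d, i (p.coeff k) * x ^ k) / i p.leadingCoeff := by
      rw [Finset.sum_div]
      refine Finset.sum_congr rfl fun k _ => ?_
      simp only [hc, map_div₀]
      field_simp
    rw [h3]
    field_simp
    linear_combination hx
  have e3 : |x| ^ d ≤ (∑ k ∈ Finset.range d, |c k|) * |x| ^ (d - 1) := by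
    rw [← abs_pow, e2, abs_neg]
    refine (Finset.abs_sum_le_sum_abs _ _).trans ?_
    rw [Finset.sum_mul]
    refine Finset.sum_le_sum fun k hk => ?_
    rw [abs_mul, abs_pow]
    refine mul_le_mul_of_nonneg_left (pow_le_pow_right₀ hx1 ?_) (abs_nonneg _)
    have := Finset.mem_range.1 hk
    omega
  have e4 : |x| ^ d = |x| * |x| ^ (d - 1) := by
    rw [← pow_succ']
    congr 1
    omega
  rw [e4] at e3
  have := le_of_mul_le_mul_right e3 (by positivity)
  linarith

end
end

section
open Polynomial
set_option linter.unusedSectionVars false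

section
variable {K K' : Type} [Field K] [LinearOrder K] [IsStrictOrderedRing K]
  [Field K'] [LinearOrder K'] [IsStrictOrderedRing K']

/-- Two points have the same position relative to the matched points of `Z`. -/
def Compat (Z : Finset (K × K')) (x : K) (x' : K') : Prop :=
  ∀ z ∈ Z, (x < z.1 ↔ x' < z.2) ∧ (z.1 < x ↔ z.2 < x')

/-- The matching `Z` is order preserving. -/
def GoodZ (Z : Finset (K × K')) : Prop := ∀ z ∈ Z, ∀ w ∈ Z, (z.1 < w.1 ↔ z.2 < w.2)

theorem GoodZ.compat {Z : Finset (K × K')} (hZ : GoodZ Z) {z : K × K'} (hz : z ∈ Z) :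
    Compat Z z.1 z.2 := fun w hw => ⟨hZ z hz w hw, hZ w hw z hz⟩

theorem Compat.eq {Z : Finset (K × K')} {x : K} {x' : K'} (h : Compat Z x x')
    {z : K × K'} (hz : z ∈ Z) : x = z.1 ↔ x' = z.2 := by
  have := h z hz
  constructor
  · intro e
    have h1 := this.1.not; have h2 := this.2.not
    simp only [e, lt_irrefl, not_false_eq_true, true_iff, not_lt] at h1 h2
    exact le_antisymm h2 h1
  · intro e
    have h1 := this.1.not; have h2 := this.2.not
    simp only [e, lt_irrefl, not_false_eq_true, iff_true, not_lt] at h1 h2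
    exact le_antisymm h2 h1

theorem exists_nbrs {Z : Finset (K × K')} {x : K} {lo hi : K × K'}
    (hlo : lo ∈ Z) (hhi : hi ∈ Z) (h1 : lo.1 < x) (h2 : x < hi.1) (hx : ∀ z ∈ Z, z.1 ≠ x) :
    ∃ l ∈ Z, ∃ r ∈ Z, l.1 < x ∧ x < r.1 ∧ ∀ z ∈ Z, z.1 ≤ l.1 ∨ r.1 ≤ z.1 := by
  obtain ⟨l, hl, hlm⟩ := Finset.exists_max_image (Z.filter (fun z => z.1 < x)) Prod.fst
    ⟨lo, by simp [hlo, h1]⟩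
  obtain ⟨r, hr, hrm⟩ := Finset.exists_min_image (Z.filter (fun z => x < z.1)) Prod.fst
    ⟨hi, by simp [hhi, h2]⟩
  simp only [Finset.mem_filter] at hl hlm hr hrm
  refine ⟨l, hl.1, r, hr.1, hl.2, hr.2, fun z hz => ?_⟩
  rcases lt_trichotomy z.1 x with h | h | h
  · exact .inl (hlm z ⟨hz, h⟩)
  · exact absurd h (hx z hz)
  · exact .inr (hrm z ⟨hz, h⟩)

theorem GoodZ.gap' {Z : Finset (K × K')} (hZ : GoodZ Z) {l r : K × K'} (hl : l ∈ Z) (hr : r ∈ Z)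
    (h : ∀ z ∈ Z, z.1 ≤ l.1 ∨ r.1 ≤ z.1) : ∀ z ∈ Z, z.2 ≤ l.2 ∨ r.2 ≤ z.2 := by
  intro z hz
  rcases h z hz with h | h
  · left
    have := (hZ l hl z hz).not
    exact not_lt.1 (this.1 (not_lt.2 h))
  · right
    have := (hZ z hz r hr).not
    exact not_lt.1 (this.1 (not_lt.2 h))

theorem GoodZ.compat_gap {Z : Finset (K × K')} (hZ : GoodZ Z) {l r : K × K'} (hl : l ∈ Z)
    (hr : r ∈ Z) (h : ∀ z ∈ Z, z.1 ≤ l.1 ∨ r.1 ≤ z.1) {x : K} {x' : K'} (h1 : l.1 < x)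
    (h2 : x < r.1) (h1' : l.2 < x') (h2' : x' < r.2) : Compat Z x x' := by
  intro z hz
  rcases h z hz with h3 | h3
  · have h4 : z.2 ≤ l.2 := not_lt.1 ((hZ l hl z hz).not.1 (not_lt.2 h3))
    have a1 := h3.trans_lt h1
    have a2 := h4.trans_lt h1'
    simp [a1, a2, a1.not_gt, a2.not_gt]
  · have h4 : r.2 ≤ z.2 := not_lt.1 ((hZ z hz r hr).not.1 (not_lt.2 h3))
    have a1 := h2.trans_le h3
    have a2 := h2'.trans_le h4
    simp [a1, a2, a1.not_gt, a2.not_gt]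

theorem exists_compat {Z : Finset (K × K')} (hZ : GoodZ Z) (x : K) : ∃ x', Compat Z x x' := by
  by_cases hx : ∃ z ∈ Z, z.1 = x
  · obtain ⟨z, hz, rfl⟩ := hx
    exact ⟨z.2, hZ.compat hz⟩
  · push Not at hx
    obtain ⟨x', h1, h2⟩ := Order.exists_between_finsets
      ((Z.filter (fun z => z.1 < x)).image Prod.snd) ((Z.filter (fun z => x < z.1)).image Prod.snd)
      (by
        intro a ha b hb
        simp only [Finset.mem_image, Finset.mem_filter] at ha hb
        obtain ⟨z, ⟨hz, hzx⟩, rfl⟩ := ha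
        obtain ⟨w, ⟨hw, hwx⟩, rfl⟩ := hb
        exact (hZ z hz w hw).1 (hzx.trans hwx))
    refine ⟨x', fun z hz => ?_⟩
    rcases lt_trichotomy z.1 x with h | h | h
    · have := h1 z.2 (Finset.mem_image_of_mem _ (Finset.mem_filter.2 ⟨hz, h⟩))
      simp [h, this, h.not_gt, this.not_gt]
    · exact absurd h (hx z hz)
    · have := h2 z.2 (Finset.mem_image_of_mem _ (Finset.mem_filter.2 ⟨hz, h⟩))
      simp [h, this, h.not_gt, this.not_gt]

variable {F : Type} [Field F]

/-- Every root over `K` of `p` has a partner root over the other field. -/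
theorem exists_partner (hK : PolyIVT K) (hK' : PolyIVT K') (i : F →+* K) (j : F →+* K')
    {Z : Finset (K × K')} (hZ : GoodZ Z) (p : F[X]) (hp : p.derivative ≠ 0)
    (hsgn : ∀ z ∈ Z, SignType.sign ((p.map i).eval z.1) = SignType.sign ((p.map j).eval z.2))
    (hder : ∀ x, (p.derivative.map i).eval x = 0 → ∃ z ∈ Z, z.1 = x)
    {lo hi : K × K'} (hlo : lo ∈ Z) (hhi : hi ∈ Z) {w : K} (h1 : lo.1 < w) (h2 : w < hi.1)
    (hw : (p.map i).eval w = 0) :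
    ∃ w', (p.map j).eval w' = 0 ∧ Compat Z w w' := by
  by_cases hx : ∃ z ∈ Z, z.1 = w
  · obtain ⟨z, hz, rfl⟩ := hx
    have := hsgn z hz
    rw [hw, sign_zero, eq_comm, sign_eq_zero_iff] at this
    exact ⟨z.2, this, hZ.compat hz⟩
  · push Not at hx
    obtain ⟨l, hl, r, hr, hlw, hwr, hgap⟩ := exists_nbrs hlo hhi h1 h2 hx
    have hp0 : p ≠ 0 := by rintro rfl; simp at hp
    have hpi : p.map i ≠ 0 := by simpa using hp0
    have hnoder : ∀ x, l.1 < x → x < r.1 → (p.map i).derivative.eval x ≠ 0 := by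
      intro x a1 a2 a3
      rw [derivative_map] at a3
      obtain ⟨z, hz, rfl⟩ := hder x a3
      rcases hgap z hz with h | h
      · exact absurd a1 (not_lt.2 h)
      · exact absurd a2 (not_lt.2 h)
    have honly : ∀ x, l.1 ≤ x → x ≤ r.1 → (p.map i).eval x = 0 → x = w := by
      intro x a1 a2 a3
      rcases lt_trichotomy x w with h | h | h
      · obtain ⟨y, b1, b2, b3⟩ := rolle hK _ hpi h a3 hw
        exact absurd b3 (hnoder y (a1.trans_lt b1) (b2.trans hwr))
      · exact h
      · obtain ⟨y, b1, b2, b3⟩ := rolle hK _ hpi h hw a3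
        exact absurd b3 (hnoder y (hlw.trans b1) (b2.trans_le a2))
    obtain ⟨q, hq⟩ := (Polynomial.dvd_iff_isRoot (p := p.map i) (a := w)).2 hw
    have hqw : q.eval w ≠ 0 := by
      intro h
      apply hnoder w hlw hwr
      rw [hq]
      simp [h]
    have hqno : ∀ x, l.1 ≤ x → x ≤ r.1 → q.eval x ≠ 0 := by
      intro x a1 a2 a3
      have : x = w := honly x a1 a2 (by rw [hq]; simp [a3])
      rw [this] at a3
      exact hqw a3
    have hlr := hlw.trans hwr
    have hqpos := hK.mul_pos q hlr (hqno _ le_rfl hlr.le) (hqno _ hlr.le le_rfl)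
      (fun x a1 a2 => hqno x a1.le a2.le)
    have hneg : (p.map i).eval l.1 * (p.map i).eval r.1 < 0 := by
      rw [hq]
      simp only [Polynomial.eval_mul, Polynomial.eval_sub, Polynomial.eval_X, Polynomial.eval_C]
      have : 0 < (w - l.1) * (r.1 - w) := _root_.mul_pos (sub_pos.2 hlw) (sub_pos.2 hwr)
      have := _root_.mul_pos this hqpos
      linarith
    have hneg' : (p.map j).eval l.2 * (p.map j).eval r.2 < 0 := by
      rw [← sign_eq_neg_one_iff, sign_mul] at hneg ⊢
      rw [← hsgn l hl, ← hsgn r hr, hneg]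
    obtain ⟨w', b1, b2, b3⟩ := hK' (p.map j) l.2 r.2 ((hZ l hl r hr).1 hlr) hneg'
    exact ⟨w', b3, hZ.compat_gap hl hr hgap hlw hwr b1 b2⟩

/-- The invariant maintained while building the common sign table. -/
structure SInv (i : F →+* K) (j : F →+* K') (B : F) (T U : Finset F[X])
    (Z : Finset (K × K')) : Prop where
  good : GoodZ Z
  hi : (i B, j B) ∈ Z
  lo : (i (-B), j (-B)) ∈ Z
  sgn : ∀ z ∈ Z, ∀ q ∈ T,
    SignType.sign ((q.map i).eval z.1) = SignType.sign ((q.map j).eval z.2)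
  rootK : ∀ p ∈ U, p ≠ 0 → ∀ x, (p.map i).eval x = 0 → ∃ z ∈ Z, z.1 = x
  rootK' : ∀ p ∈ U, p ≠ 0 → ∀ x, (p.map j).eval x = 0 → ∃ z ∈ Z, z.2 = x
  cmp : ∀ x x', Compat Z x x' → ∀ p ∈ U,
    SignType.sign ((p.map i).eval x) = SignType.sign ((p.map j).eval x')

theorem eval_map_mod (i : F →+* K) (q p : F[X]) {x : K} (hx : (p.map i).eval x = 0) :
    (q.map i).eval x = ((q % p).map i).eval x := by
  conv_lhs => rw [← EuclideanDomain.div_add_mod q p]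
  simp [hx]

theorem SInv.step [DecidableEq F[X]] (hK : PolyIVT K) (hK' : PolyIVT K') [CharZero F] {i : F →+* K} {j : F →+* K'}
    (hij : ∀ a, SignType.sign (i a) = SignType.sign (j a)) {B : F} {T U : Finset F[X]}
    {Z : Finset (K × K')} (h : SInv i j B T U Z)
    (hTd : ∀ p ∈ T, p.derivative ∈ T) (hTm : ∀ q ∈ T, ∀ p ∈ T, p ≠ 0 → q % p ∈ T)
    (hB : ∀ p ∈ T, p ≠ 0 → ∀ x, (p.map i).eval x = 0 → i (-B) < x ∧ x < i B)
    (hB' : ∀ p ∈ T, p ≠ 0 → ∀ x, (p.map j).eval x = 0 → j (-B) < x ∧ x < j B)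
    (p : F[X]) (hpT : p ∈ T) (hU : ∀ q ∈ T, q.degree < p.degree → q ∈ U) :
    ∃ Z', SInv i j B T (insert p U) Z' := by
  classical
  by_cases hd : p.natDegree = 0
  · obtain ⟨c, rfl⟩ := Polynomial.natDegree_eq_zero.1 hd
    refine ⟨Z, h.good, h.hi, h.lo, h.sgn, ?_, ?_, ?_⟩
    · intro q hq hq0 x hx
      rcases Finset.mem_insert.1 hq with rfl | hq
      · simp at hx; simp [hx] at hq0
      · exact h.rootK q hq hq0 x hx
    · intro q hq hq0 x hx
      rcases Finset.mem_insert.1 hq with rfl | hq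
      · simp at hx; simp [hx] at hq0
      · exact h.rootK' q hq hq0 x hx
    · intro x x' hx q hq
      rcases Finset.mem_insert.1 hq with rfl | hq
      · simpa using hij c
      · exact h.cmp x x' hx q hq
  have hp0 : p ≠ 0 := by rintro rfl; simp at hd
  have hder0 : p.derivative ≠ 0 := by
    intro h0
    exact hd (Polynomial.natDegree_eq_zero_of_derivative_eq_zero h0)
  have hderU : p.derivative ∈ U := hU _ (hTd p hpT) (degree_derivative_lt hp0)
  have hpi : p.map i ≠ 0 := by simpa using hp0
  have hpj : p.map j ≠ 0 := by simpa using hp0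
  let N : Finset (K × K') := ((p.map i).roots.toFinset ×ˢ (p.map j).roots.toFinset).filter
    (fun w => Compat Z w.1 w.2)
  have hN : ∀ w, w ∈ N ↔ (p.map i).eval w.1 = 0 ∧ (p.map j).eval w.2 = 0 ∧ Compat Z w.1 w.2 := by
    intro w
    simp [N, hp0, and_assoc]
  have hrK : ∀ x, (p.map i).eval x = 0 → ∃ z ∈ Z ∪ N, z.1 = x := by
    intro x hx
    have hb := hB p hpT hp0 x hx
    obtain ⟨w', h1, h2⟩ := exists_partner hK hK' i j h.good p hder0 (fun z hz => h.sgn z hz p hpT)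
      (h.rootK _ hderU hder0) h.lo h.hi hb.1 hb.2 hx
    exact ⟨(x, w'), Finset.mem_union_right _ ((hN _).2 ⟨hx, h1, h2⟩), rfl⟩
  have hrK' : ∀ x, (p.map j).eval x = 0 → ∃ z ∈ Z ∪ N, z.2 = x := by
    intro x hx
    have hb := hB' p hpT hp0 x hx
    let Zs : Finset (K' × K) := Z.image Prod.swap
    have hmem : ∀ z : K × K', z ∈ Z → (z.2, z.1) ∈ Zs := fun z hz =>
      Finset.mem_image.2 ⟨z, hz, rfl⟩
    obtain ⟨w', h1, h2⟩ := exists_partner (Z := Zs) hK' hK j i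
      (by
        intro z hz w hw
        obtain ⟨z0, hz0, rfl⟩ := Finset.mem_image.1 hz
        obtain ⟨w0, hw0, rfl⟩ := Finset.mem_image.1 hw
        exact (h.good z0 hz0 w0 hw0).symm) p hder0
      (by
        intro z hz
        obtain ⟨z0, hz0, rfl⟩ := Finset.mem_image.1 hz
        exact (h.sgn z0 hz0 p hpT).symm)
      (by
        intro y hy
        obtain ⟨z, hz, rfl⟩ := h.rootK' _ hderU hder0 y hy
        exact ⟨_, hmem z hz, rfl⟩) (hmem _ h.lo) (hmem _ h.hi) hb.1 hb.2 hx
    refine ⟨(w', x), Finset.mem_union_right _ ((hN _).2 ⟨h1, hx, ?_⟩), rfl⟩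
    intro z hz
    have := h2 _ (hmem z hz)
    exact ⟨this.1.symm, this.2.symm⟩
  -- order preservation among new pairs
  have hNN : ∀ w ∈ N, ∀ v ∈ N, w.1 < v.1 → w.2 < v.2 := by
    intro w hw v hv hlt
    obtain ⟨a1, a2, a3⟩ := (hN w).1 hw
    obtain ⟨b1, b2, b3⟩ := (hN v).1 hv
    obtain ⟨y, c1, c2, c3⟩ := rolle hK _ hpi hlt a1 b1
    rw [derivative_map] at c3
    obtain ⟨z, hz, rfl⟩ := h.rootK _ hderU hder0 y c3
    exact ((a3 z hz).1.1 c1).trans ((b3 z hz).2.1 c2)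
  have hNN' : ∀ w ∈ N, ∀ v ∈ N, w.2 < v.2 → w.1 < v.1 := by
    intro w hw v hv hlt
    obtain ⟨a1, a2, a3⟩ := (hN w).1 hw
    obtain ⟨b1, b2, b3⟩ := (hN v).1 hv
    obtain ⟨y, c1, c2, c3⟩ := rolle hK' _ hpj hlt a2 b2
    rw [derivative_map] at c3
    obtain ⟨z, hz, rfl⟩ := h.rootK' _ hderU hder0 y c3
    exact ((a3 z hz).1.2 c1).trans ((b3 z hz).2.2 c2)
  have hgood : GoodZ (Z ∪ N) := by
    intro z hz w hw
    rcases Finset.mem_union.1 hz with hz | hz <;> rcases Finset.mem_union.1 hw with hw | hw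
    · exact h.good z hz w hw
    · exact (((hN w).1 hw).2.2 z hz).2
    · exact (((hN z).1 hz).2.2 w hw).1
    · exact ⟨hNN z hz w hw, hNN' z hz w hw⟩
  have hsgn : ∀ z ∈ Z ∪ N, ∀ q ∈ T,
      SignType.sign ((q.map i).eval z.1) = SignType.sign ((q.map j).eval z.2) := by
    intro z hz q hq
    rcases Finset.mem_union.1 hz with hz | hz
    · exact h.sgn z hz q hq
    · obtain ⟨a1, a2, a3⟩ := (hN z).1 hz
      rw [eval_map_mod i q p a1, eval_map_mod j q p a2]
      exact h.cmp _ _ a3 _ (hU _ (hTm q hq p hpT hp0) (EuclideanDomain.mod_lt q hp0))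
  refine ⟨Z ∪ N, hgood, Finset.mem_union_left _ h.hi, Finset.mem_union_left _ h.lo, hsgn, ?_, ?_, ?_⟩
  · intro q hq hq0 x hx
    rcases Finset.mem_insert.1 hq with rfl | hq
    · exact hrK x hx
    · obtain ⟨z, hz, e⟩ := h.rootK q hq hq0 x hx
      exact ⟨z, Finset.mem_union_left _ hz, e⟩
  · intro q hq hq0 x hx
    rcases Finset.mem_insert.1 hq with rfl | hq
    · exact hrK' x hx
    · obtain ⟨z, hz, e⟩ := h.rootK' q hq hq0 x hx
      exact ⟨z, Finset.mem_union_left _ hz, e⟩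
  · intro x x' hx q hq
    rcases Finset.mem_insert.1 hq with rfl | hq
    swap
    · exact h.cmp x x' (fun z hz => hx z (Finset.mem_union_left _ hz)) q hq
    by_cases hxZ : ∃ z ∈ Z ∪ N, z.1 = x
    · obtain ⟨z, hz, rfl⟩ := hxZ
      rw [(hx.eq hz).1 rfl]
      exact hsgn z hz q hpT
    push Not at hxZ
    have hxZ' : ∀ z ∈ Z ∪ N, z.2 ≠ x' := by
      intro z hz e
      exact hxZ z hz ((hx.eq hz).2 e.symm).symm
    have hne : (q.map i).eval x ≠ 0 := fun e => by
      obtain ⟨z, hz, e⟩ := hrK x e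
      exact hxZ z hz e
    have hne' : (q.map j).eval x' ≠ 0 := fun e => by
      obtain ⟨z, hz, e⟩ := hrK' x' e
      exact hxZ' z hz e
    have hhi := Finset.mem_union_left N h.hi
    have hlo := Finset.mem_union_left N h.lo
    rcases lt_or_gt_of_ne (hxZ _ hlo) with h1 | h1
    swap
    · have h1' := (hx _ hlo).1.1 h1
      have s1 := hK.sign_eq (q.map i) h1 hne
        (fun e => lt_irrefl _ (hB q hpT hp0 _ e).1)
        (fun w c1 c2 e => lt_asymm c2 (hB q hpT hp0 _ e).1)
      have s2 := hK'.sign_eq (q.map j) h1' hne'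
        (fun e => lt_irrefl _ (hB' q hpT hp0 _ e).1)
        (fun w c1 c2 e => lt_asymm c2 (hB' q hpT hp0 _ e).1)
      rw [s1, s2]
      exact hsgn _ hlo q hpT
    rcases lt_or_gt_of_ne (hxZ _ hhi) with h2 | h2
    · have h2' := (hx _ hhi).2.1 h2
      have s1 := hK.sign_eq (q.map i) h2 
        (fun e => lt_irrefl _ (hB q hpT hp0 _ e).2) hne
        (fun w c1 c2 e => lt_asymm c1 (hB q hpT hp0 _ e).2)
      have s2 := hK'.sign_eq (q.map j) h2' 
        (fun e => lt_irrefl _ (hB' q hpT hp0 _ e).2) hne'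
        (fun w c1 c2 e => lt_asymm c1 (hB' q hpT hp0 _ e).2)
      rw [← s1, ← s2]
      exact hsgn _ hhi q hpT
    obtain ⟨l, hl, r, hr, hlx, hxr, hgap⟩ := exists_nbrs hlo hhi h1 h2 hxZ
    have hgap' := hgood.gap' hl hr hgap
    have hno : ∀ w, l.1 < w → w < r.1 → (q.map i).eval w ≠ 0 := by
      intro w c1 c2 e
      obtain ⟨z, hz, rfl⟩ := hrK w e
      rcases hgap z hz with g | g
      · exact absurd c1 (not_lt.2 g)
      · exact absurd c2 (not_lt.2 g)
    have hno' : ∀ w, l.2 < w → w < r.2 → (q.map j).eval w ≠ 0 := by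
      intro w c1 c2 e
      obtain ⟨z, hz, rfl⟩ := hrK' w e
      rcases hgap' z hz with g | g
      · exact absurd c1 (not_lt.2 g)
      · exact absurd c2 (not_lt.2 g)
    have hlx' := (hx l hl).2.1 hlx
    have hxr' := (hx r hr).1.1 hxr
    by_cases hl0 : (q.map i).eval l.1 = 0
    · by_cases hr0 : (q.map i).eval r.1 = 0
      · obtain ⟨y, c1, c2, c3⟩ := rolle hK _ hpi (hlx.trans hxr) hl0 hr0
        rw [derivative_map] at c3
        obtain ⟨z, hz, rfl⟩ := h.rootK _ hderU hder0 y c3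
        rcases hgap z (Finset.mem_union_left _ hz) with g | g
        · exact absurd c1 (not_lt.2 g)
        · exact absurd c2 (not_lt.2 g)
      · have hr0' : (q.map j).eval r.2 ≠ 0 := by
          rw [← sign_ne_zero, ← hsgn r hr q hpT, sign_ne_zero]
          exact hr0
        rw [hK.sign_eq (q.map i) hxr hne hr0 (fun w c1 c2 => hno w (hlx.trans c1) c2),
          hK'.sign_eq (q.map j) hxr' hne' hr0' (fun w c1 c2 => hno' w (hlx'.trans c1) c2)]
        exact hsgn r hr q hpT
    · have hl0' : (q.map j).eval l.2 ≠ 0 := by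
        rw [← sign_ne_zero, ← hsgn l hl q hpT, sign_ne_zero]
        exact hl0
      rw [← hK.sign_eq (q.map i) hlx hl0 hne (fun w c1 c2 => hno w c1 (c2.trans hxr)),
        ← hK'.sign_eq (q.map j) hlx' hl0' hne' (fun w c1 c2 => hno' w c1 (c2.trans hxr'))]
      exact hsgn l hl q hpT

/-- Finite sets of polynomials lie in finite sets closed under derivatives and remainders. -/
theorem exists_closed [CharZero F] (S : Finset F[X]) : ∃ T : Finset F[X], S ⊆ T ∧
    (∀ p ∈ T, p.derivative ∈ T) ∧ ∀ q ∈ T, ∀ p ∈ T, p ≠ 0 → q % p ∈ T := by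
  classical
  obtain ⟨M, hM⟩ : ∃ M : ℕ, ∀ p ∈ S, p.natDegree < M :=
    ⟨S.sup natDegree + 1, fun p hp => Nat.lt_succ_of_le (Finset.le_sup (f := natDegree) hp)⟩
  have key : ∀ k ≤ M, ∃ T : Finset F[X], S ⊆ T ∧ (0 : F[X]) ∈ T ∧
      (∀ p ∈ T, M - k ≤ p.natDegree → p.derivative ∈ T) ∧
      ∀ q ∈ T, ∀ p ∈ T, p ≠ 0 → M - k ≤ p.natDegree → q % p ∈ T := by
    intro k
    induction k with
    | zero =>
      intro _
      by_cases hM0 : M = 0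
      · have : S = ∅ := Finset.eq_empty_of_forall_notMem fun p hp => by
          have := hM p hp; omega
        subst this
        exact ⟨{0}, by simp⟩
      refine ⟨insert 0 S, Finset.subset_insert _ _, Finset.mem_insert_self _ _, ?_, ?_⟩
      · intro p hp hd
        rcases Finset.mem_insert.1 hp with rfl | hp
        · simp
        · have := hM p hp; omega
      · intro q hq p hp hp0 hd
        rcases Finset.mem_insert.1 hp with rfl | hp
        · simp at hp0
        · have := hM p hp; omega
    | succ k ih =>
      intro hk
      obtain ⟨T, hST, h0, hTd, hTm⟩ := ih (by omega)
      let D := T.filter (fun p => p.natDegree = M - (k + 1) ∧ p ≠ 0)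
      let T' := T ∪ D.image derivative ∪ (T ×ˢ D).image (fun w => w.1 % w.2)
      have hnew : ∀ p ∈ T', p ∈ T ∨ p = 0 ∨ p.natDegree < M - (k + 1) := by
        intro p hp
        simp only [T', Finset.mem_union, Finset.mem_image, Finset.mem_product, D,
          Finset.mem_filter] at hp
        rcases hp with (hp | ⟨q, ⟨hq, hq2, hq3⟩, rfl⟩) | ⟨w, ⟨hw, hq, hq2, hq3⟩, rfl⟩
        · exact .inl hp
        · right
          by_cases hz : derivative q = 0
          · exact .inl hz
          · right
            rw [← hq2]
            exact natDegree_lt_natDegree hz (degree_derivative_lt hq3)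
        · right
          by_cases hz : w.1 % w.2 = 0
          · exact .inl hz
          · right
            rw [← hq2]
            exact natDegree_lt_natDegree hz (EuclideanDomain.mod_lt w.1 hq3)
      have hTT' : T ⊆ T' := fun p hp => by simp [T', hp]
      refine ⟨T', hST.trans hTT', hTT' h0, ?_, ?_⟩
      · intro p hp hd
        by_cases hz : p = 0
        · subst hz; simpa using hTT' h0
        rcases hnew p hp with hp | hp | hp
        · rcases Nat.lt_or_ge p.natDegree (M - k) with h | h
          · have : p ∈ D := by simp [D, hp, hz]; omega
            simp only [T', Finset.mem_union]
            exact .inl (.inr (Finset.mem_image_of_mem _ this))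
          · exact hTT' (hTd p hp h)
        · exact absurd hp hz
        · omega
      · intro q hq p hp hz hd
        rcases hnew p hp with hp | hp | hp
        · rcases hnew q hq with hq1 | hq1 | hq1
          · rcases Nat.lt_or_ge p.natDegree (M - k) with h | h
            · have : p ∈ D := by simp [D, hp, hz]; omega
              simp only [T', Finset.mem_union]
              exact .inr (Finset.mem_image.2 ⟨(q, p), by simp [hq1, this], rfl⟩)
            · exact hTT' (hTm q hq1 p hp hz h)
          · subst hq1; simpa using hTT' h0
          · have : q % p = q := by
              rw [Polynomial.mod_eq_self_iff hz]
              exact degree_lt_degree (by omega)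
            rw [this]; exact hq
        · exact absurd hp hz
        · omega
  obtain ⟨T, h1, _, h2, h3⟩ := key M le_rfl
  exact ⟨T, h1, fun p hp => h2 p hp (by omega), fun q hq p hp h0 => h3 q hq p hp h0 (by omega)⟩

/-- One-variable transfer between two fields with the intermediate value property. -/
theorem transfer_one (hK : PolyIVT K) (hK' : PolyIVT K') (i : F →+* K) (j : F →+* K')
    (hij : ∀ a, SignType.sign (i a) = SignType.sign (j a)) (S : Finset F[X]) (c : K) :
    ∃ c' : K', ∀ p ∈ S,
      SignType.sign ((p.map i).eval c) = SignType.sign ((p.map j).eval c') := by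
  classical
  haveI : CharZero F := (RingHom.charZero_iff i.injective).2 inferInstance
  obtain ⟨T, hST, hTd, hTm⟩ := exists_closed S
  let b : F[X] → F := fun p =>
    1 + ∑ k ∈ Finset.range p.natDegree, (1 + (p.coeff k / p.leadingCoeff) ^ 2)
  have bnn : ∀ p, 0 ≤ i (b p) := fun p => by
    simp only [b, map_add, map_sum, map_pow, map_one]; positivity
  have bnn' : ∀ p, 0 ≤ j (b p) := fun p => by
    simp only [b, map_add, map_sum, map_pow, map_one]; positivity
  let B : F := 1 + ∑ p ∈ T, b p
  have hB : ∀ p ∈ T, p ≠ 0 → ∀ x, (p.map i).eval x = 0 → i (-B) < x ∧ x < i B := by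
    intro p hp hp0 x hx
    have h1 := root_bound i p x hp0 hx
    have h2 : i (b p) ≤ i B := by
      simp only [B, map_add, map_sum, map_one]
      have := Finset.single_le_sum (f := fun p => i (b p)) (fun p _ => bnn p) hp
      linarith
    rw [map_neg, ← abs_lt]
    exact h1.trans_le h2
  have hB' : ∀ p ∈ T, p ≠ 0 → ∀ x, (p.map j).eval x = 0 → j (-B) < x ∧ x < j B := by
    intro p hp hp0 x hx
    have h1 := root_bound j p x hp0 hx
    have h2 : j (b p) ≤ j B := by
      simp only [B, map_add, map_sum, map_one]
      have := Finset.single_le_sum (f := fun p => j (b p)) (fun p _ => bnn' p) hp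
      linarith
    rw [map_neg, ← abs_lt]
    exact h1.trans_le h2
  have hBi : 0 < i B := by
    simp only [B, map_add, map_sum, map_one]
    have := Finset.sum_nonneg (s := T) (f := fun p => i (b p)) (fun p _ => bnn p)
    linarith
  have hBj : 0 < j B := by
    simp only [B, map_add, map_sum, map_one]
    have := Finset.sum_nonneg (s := T) (f := fun p => j (b p)) (fun p _ => bnn' p)
    linarith
  have hconst : ∀ (a : F) (q : F[X]), SignType.sign ((q.map i).eval (i a)) =
      SignType.sign ((q.map j).eval (j a)) := by
    intro a q
    rw [Polynomial.eval_map, Polynomial.eval_map, eval₂_at_apply, eval₂_at_apply]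
    exact hij _
  have main : ∀ U : Finset F[X], U ⊆ T → (∀ p ∈ U, ∀ q ∈ T, q.degree < p.degree → q ∈ U) →
      ∃ Z, SInv i j B T U Z := by
    intro U
    induction U using Finset.induction_on_max_value (fun p : F[X] => p.degree) with
    | empty =>
      intro _ _
      refine ⟨{(i B, j B), (i (-B), j (-B))}, ?_, by simp, by simp, ?_, by simp, by simp, by simp⟩
      · have e1 : -i B < i B := by linarith
        have e2 : -j B < j B := by linarith
        intro z hz w hw
        simp only [Finset.mem_insert, Finset.mem_singleton] at hz hw
        rcases hz with rfl | rfl <;> rcases hw with rfl | rfl <;>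
          simp only [map_neg, lt_irrefl, e1, e2, e1.not_gt, e2.not_gt]
      · intro z hz q _
        simp only [Finset.mem_insert, Finset.mem_singleton] at hz
        rcases hz with rfl | rfl <;> exact hconst _ _
    | insert p s hps hmax ih =>
      intro hsub hlow
      obtain ⟨Z, hZ⟩ := ih ((Finset.subset_insert _ _).trans hsub) (by
        intro q hq r hr hlt
        rcases Finset.mem_insert.1 (hlow q (Finset.mem_insert_of_mem hq) r hr hlt) with rfl | h
        · exact absurd (hmax q hq) (not_le.2 hlt)
        · exact h)
      refine hZ.step hK hK' hij hTd hTm hB hB' p (hsub (Finset.mem_insert_self _ _)) ?_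
      intro q hq hlt
      rcases Finset.mem_insert.1 (hlow p (Finset.mem_insert_self _ _) q hq hlt) with rfl | h
      · exact absurd hlt (lt_irrefl _)
      · exact h
  obtain ⟨Z, hZ⟩ := main T subset_rfl (fun _ _ q hq _ => hq)
  obtain ⟨c', hc'⟩ := exists_compat hZ.good c
  exact ⟨c', fun p hp => hZ.cmp c c' hc' p (hST hp)⟩

end
end

section
set_option linter.unusedSectionVars false
set_option linter.overlappingInstances false

section
open Filter

variable {α : Type} {φ : Ultrafilter α} {K : Type} [Field K] [LinearOrder K] [IsStrictOrderedRing K]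

theorem germ_sign (f : α → K) (s : SignType) :
    SignType.sign ((Germ.coeRingHom (φ : Filter α) : (α → K) →+* _) f) = s ↔
      ∀ᶠ x in (φ : Filter α), SignType.sign (f x) = s := by
  have key : ∀ (f : α → K) (s : SignType), (∀ᶠ x in (φ : Filter α), SignType.sign (f x) = s) →
      SignType.sign ((Germ.coeRingHom (φ : Filter α) : (α → K) →+* _) f) = s := by
    intro f s h
    rw [Germ.coe_coeRingHom]
    cases s with
    | zero =>
      change SignType.sign _ = 0
      rw [sign_eq_zero_iff]
      exact Germ.coe_eq.2 (h.mono fun x hx => sign_eq_zero_iff.1 hx)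
    | neg =>
      change SignType.sign _ = -1
      rw [sign_eq_neg_one_iff]
      exact Germ.coe_lt.2 (h.mono fun x hx => sign_eq_neg_one_iff.1 hx)
    | pos =>
      change SignType.sign _ = 1
      rw [sign_eq_one_iff]
      exact Germ.coe_lt.2 (h.mono fun x hx => sign_eq_one_iff.1 hx)
  refine ⟨fun h => ?_, key f s⟩
  rcases φ.em (fun x => SignType.sign (f x) = s) with h1 | h1
  · exact h1
  · exfalso
    have h3 : (∀ᶠ x in (φ : Filter α), SignType.sign (f x) = 0) ∨
      (∀ᶠ x in (φ : Filter α), SignType.sign (f x) = 1) ∨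
      (∀ᶠ x in (φ : Filter α), SignType.sign (f x) = -1) := by
      simp only [← Ultrafilter.eventually_or]
      refine Eventually.of_forall fun x => ?_
      rcases SignType.sign (f x) <;> decide
    rcases h3 with h3 | h3 | h3 <;>
    · have := key f _ h3
      rw [h] at this
      obtain ⟨x, hx1, hx2⟩ := (h1.and h3).exists
      exact hx1 (hx2.trans this.symm)

theorem germ_ivt (hK : PolyIVT K) : PolyIVT (Germ (φ : Filter α) K) := by
  intro p u v huv hneg
  let r : (α → K) →+* Germ (φ : Filter α) K := Germ.coeRingHom (φ : Filter α)
  have hr : Function.Surjective r := by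
    intro x
    induction x using Germ.inductionOn with
    | h f => exact ⟨f, rfl⟩
  obtain ⟨P, rfl⟩ := Polynomial.map_surjective r hr p
  obtain ⟨u, rfl⟩ := hr u
  obtain ⟨v, rfl⟩ := hr v
  have ev : ∀ f : α → K, (P.map r).eval (r f) =
      r (fun a => (P.map (Pi.evalRingHom (fun _ => K) a)).eval (f a)) := by
    intro f
    rw [Polynomial.eval_map, Polynomial.eval₂_at_apply]
    congr 1
    funext a
    have : f a = Pi.evalRingHom (fun _ => K) a f := rfl
    rw [Polynomial.eval_map, this, Polynomial.eval₂_at_apply]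
    rfl
  rw [ev, ev, ← map_mul] at hneg
  have h1 : ∀ᶠ x in (φ : Filter α), u x < v x := Germ.coe_lt.1 huv
  have h2 := (germ_sign _ _).1 (sign_eq_neg_one_iff.2 hneg)
  have h3 : ∀ᶠ x in (φ : Filter α), ∃ w, u x < w ∧ w < v x ∧
      (P.map (Pi.evalRingHom (fun _ => K) x)).eval w = 0 := by
    filter_upwards [h1, h2] with x hx1 hx2
    exact hK _ _ _ hx1 (sign_eq_neg_one_iff.1 hx2)
  obtain ⟨w, hw⟩ := Filter.skolem.1 h3
  refine ⟨r w, Germ.coe_lt.2 (hw.mono fun x hx => hx.1), Germ.coe_lt.2 (hw.mono fun x hx => hx.2.1),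
    ?_⟩
  rw [ev]
  exact Germ.coe_eq.2 (hw.mono fun x hx => hx.2.2)

end

section
variable {K K' : Type} [Field K] [LinearOrder K] [IsStrictOrderedRing K]
  [Field K'] [LinearOrder K'] [IsStrictOrderedRing K']

theorem common_field {A : Type} [CommRing A] (a : A →+* K) (b : A →+* K')
    (hab : ∀ x, SignType.sign (a x) = SignType.sign (b x)) :
    ∃ (F : Type) (_ : Field F) (π : A →+* F) (i : F →+* K) (j : F →+* K'),
      i.comp π = a ∧ j.comp π = b ∧ ∀ x, SignType.sign (i x) = SignType.sign (j x) := by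
  have : (RingHom.ker a).IsPrime := RingHom.ker_isPrime a
  let Q := A ⧸ RingHom.ker a
  have hker : ∀ x ∈ RingHom.ker a, b x = 0 := by
    intro x hx
    rw [RingHom.mem_ker] at hx
    rw [← sign_eq_zero_iff, ← hab, hx, sign_zero]
  let a1 : Q →+* K := Ideal.Quotient.lift _ a (fun x hx => hx)
  let b1 : Q →+* K' := Ideal.Quotient.lift _ b hker
  have hab1 : ∀ x, SignType.sign (a1 x) = SignType.sign (b1 x) := by
    intro x
    obtain ⟨x, rfl⟩ := Ideal.Quotient.mk_surjective x
    exact hab x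
  have ha1 : Function.Injective a1 := RingHom.kerLift_injective a
  have hb1 : Function.Injective b1 := by
    rw [injective_iff_map_eq_zero]
    intro x hx
    apply (injective_iff_map_eq_zero a1).1 ha1
    rw [← sign_eq_zero_iff, hab1, hx, sign_zero]
  let i : FractionRing Q →+* K := IsFractionRing.lift ha1
  let j : FractionRing Q →+* K' := IsFractionRing.lift hb1
  have hi : ∀ x, i (algebraMap Q _ x) = a1 x := fun x => IsFractionRing.lift_algebraMap ha1 x
  have hj : ∀ x, j (algebraMap Q _ x) = b1 x := fun x => IsFractionRing.lift_algebraMap hb1 x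
  refine ⟨FractionRing Q, inferInstance, (algebraMap Q _).comp (Ideal.Quotient.mk _), i, j, ?_, ?_, ?_⟩
  · ext x; exact hi _
  · ext x; exact hj _
  · intro x
    obtain ⟨p, q, hq, rfl⟩ := IsFractionRing.div_surjective (A := Q) x
    rw [map_div₀ i, map_div₀ j, hi, hi, hj, hj, div_eq_mul_inv, div_eq_mul_inv, sign_mul, sign_mul,
      hab1 p]
    congr 1
    have h1 : ∀ {L : Type} [Field L] [LinearOrder L] [IsStrictOrderedRing L] (y : L),
        SignType.sign y⁻¹ = SignType.sign y := by
      intro L _ _ _ y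
      rcases lt_trichotomy y 0 with h | h | h
      · rw [sign_neg h, sign_neg (inv_lt_zero.2 h)]
      · simp [h]
      · rw [sign_pos h, sign_pos (inv_pos.2 h)]
    rw [h1, h1, hab1]

end

theorem transfer_many (n : ℕ) : ∀ {F K K' : Type} [Field F] [Field K] [LinearOrder K]
    [IsStrictOrderedRing K] [Field K'] [LinearOrder K'] [IsStrictOrderedRing K']
    (_ : PolyIVT K) (_ : PolyIVT K') (i : F →+* K) (j : F →+* K')
    (_ : ∀ a, SignType.sign (i a) = SignType.sign (j a)) (S : Finset (MvPolynomial (Fin n) F))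
    (c : Fin n → K), ∃ c' : Fin n → K', ∀ p ∈ S,
      SignType.sign (MvPolynomial.eval₂Hom i c p) =
        SignType.sign (MvPolynomial.eval₂Hom j c' p) := by
  induction n with
  | zero =>
    intro F K K' _ _ _ _ _ _ _ hK hK' i j hij S c
    refine ⟨Fin.elim0, fun p _ => ?_⟩
    obtain ⟨a, rfl⟩ := MvPolynomial.C_surjective (Fin 0) p
    simpa using hij a
  | succ n ih =>
    intro F K K' _ _ _ _ _ _ _ hK hK' i j hij S c
    classical
    choose t ht using fun U : Finset (Polynomial F) => transfer_one hK hK' i j hij U (c 0)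
    let φ : Ultrafilter (Finset (Polynomial F)) := Ultrafilter.of Filter.atTop
    let r : (Finset (Polynomial F) → K') →+* Filter.Germ (φ : Filter (Finset (Polynomial F))) K' :=
      Filter.Germ.coeRingHom (φ : Filter (Finset (Polynomial F)))
    let J : F →+* (Finset (Polynomial F) → K') := (Pi.constRingHom _ K').comp j
    let α : Polynomial F →+* K := Polynomial.eval₂RingHom i (c 0)
    let β : Polynomial F →+* Filter.Germ (φ : Filter (Finset (Polynomial F))) K' :=
      Polynomial.eval₂RingHom (r.comp J) (r t)
    have hαβ : ∀ p, SignType.sign (α p) = SignType.sign (β p) := by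
      intro p
      have e : β p = r (fun U => (p.map j).eval (t U)) := by
        simp only [β, Polynomial.coe_eval₂RingHom]
        rw [← Polynomial.hom_eval₂]
        congr 1
        funext U
        change Pi.evalRingHom (fun _ => K') U _ = _
        rw [Polynomial.hom_eval₂, Polynomial.eval_map]
        rfl
      rw [e]
      symm
      rw [germ_sign]
      have : ∀ᶠ U in (Filter.atTop : Filter (Finset (Polynomial F))), p ∈ U := by
        filter_upwards [Filter.eventually_ge_atTop {p}] with U hU
        exact hU (Finset.mem_singleton_self p)
      filter_upwards [Ultrafilter.of_le _ this] with U hU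
      rw [← ht U p hU, Polynomial.eval_map]
      rfl
    obtain ⟨F1, _, π, i1, j1, hi1, hj1, hij1⟩ := common_field α β hαβ
    let θ : MvPolynomial (Fin (n + 1)) F →+* MvPolynomial (Fin n) F1 :=
      MvPolynomial.eval₂Hom ((MvPolynomial.C.comp π).comp Polynomial.C)
        (Fin.cons (MvPolynomial.C (π Polynomial.X)) MvPolynomial.X)
    obtain ⟨c', hc'⟩ := ih hK (germ_ivt hK') i1 j1 hij1 (S.image θ) (Fin.tail c)
    have hr : Function.Surjective r := by
      intro x
      induction x using Filter.Germ.inductionOn with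
      | h f => exact ⟨f, rfl⟩
    choose d hd using fun k => hr (c' k)
    have e1 : ∀ q, MvPolynomial.eval₂Hom i1 (Fin.tail c) (θ q) = MvPolynomial.eval₂Hom i c q := by
      intro q
      change ((MvPolynomial.eval₂Hom i1 (Fin.tail c)).comp θ) q = _
      congr 1
      apply MvPolynomial.ringHom_ext
      · intro a
        have := congrArg (fun f => f (Polynomial.C a)) hi1
        simpa [θ, α] using this
      · intro k
        refine Fin.cases ?_ (fun k => ?_) k
        · have := congrArg (fun f => f Polynomial.X) hi1
          simpa [θ, α] using this
        · simp [θ, Fin.tail]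
    have e2 : ∀ q, MvPolynomial.eval₂Hom j1 c' (θ q) =
        r (fun U => MvPolynomial.eval₂Hom j (Fin.cons (t U) (fun k => d k U)) q) := by
      intro q
      let ρ : MvPolynomial (Fin (n + 1)) F →+* (Finset (Polynomial F) → K') :=
        RingHom.pi (fun U => MvPolynomial.eval₂Hom j (Fin.cons (t U) (fun k => d k U)))
      change ((MvPolynomial.eval₂Hom j1 c').comp θ) q = (r.comp ρ) q
      congr 1
      apply MvPolynomial.ringHom_ext
      · intro a
        have := congrArg (fun f => f (Polynomial.C a)) hj1
        have e : ρ (MvPolynomial.C a) = J a := by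
          funext U
          change MvPolynomial.eval₂Hom j (Fin.cons (t U) (fun k => d k U)) _ = _
          simp [J]
        simp only [RingHom.comp_apply, e]
        simpa [θ, β] using this
      · intro k
        refine Fin.cases ?_ (fun k => ?_) k
        · have := congrArg (fun f => f Polynomial.X) hj1
          have e : ρ (MvPolynomial.X 0) = t := by
            funext U
            change MvPolynomial.eval₂Hom j (Fin.cons (t U) (fun k => d k U)) _ = _
            simp
          simp only [RingHom.comp_apply, e]
          simpa [θ, β] using this
        · have e : ρ (MvPolynomial.X k.succ) = d k := by
            funext U
            change MvPolynomial.eval₂Hom j (Fin.cons (t U) (fun k => d k U)) _ = _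
            simp
          simp only [RingHom.comp_apply, e, hd]
          simp [θ]
    have h3 : ∀ q ∈ S, ∀ᶠ U in (φ : Filter _),
        SignType.sign (MvPolynomial.eval₂Hom j (Fin.cons (t U) (fun k => d k U)) q) =
        SignType.sign (MvPolynomial.eval₂Hom i c q) := by
      intro q hq
      have := hc' (θ q) (Finset.mem_image_of_mem _ hq)
      rw [e1, e2] at this
      exact (germ_sign _ _).1 this.symm
    obtain ⟨U, hU⟩ := ((Filter.eventually_all_finset S).2 h3).exists
    exact ⟨_, fun q hq => (hU q hq).symm⟩
end

section
set_option linter.unusedSectionVars false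

section

theorem ord_ext {A : Type} [CommRing A] (T : Subsemiring A) (hsq : ∀ a, a * a ∈ T)
    (h1 : (-1 : A) ∉ T) : ∃ P : Subsemiring A, T ≤ P ∧ (-1 : A) ∉ P ∧
      ∀ a b, -(a * b) ∈ P → a ∈ P ∨ b ∈ P := by
  obtain ⟨P, hTP, hmax⟩ := zorn_le_nonempty₀ {P : Subsemiring A | T ≤ P ∧ (-1 : A) ∉ P} (by
    intro c hc hchain y hy
    refine ⟨sSup c, ⟨(hc hy).1.trans (le_sSup hy), ?_⟩, fun z hz => le_sSup hz⟩
    rw [Subsemiring.mem_sSup_of_directedOn ⟨y, hy⟩ hchain.directedOn]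
    rintro ⟨s, hs, h⟩
    exact (hc hs).2 h) T ⟨le_rfl, h1⟩
  have hP1 : (-1 : A) ∉ P := hmax.1.2
  have hPsq : ∀ a, a * a ∈ P := fun a => hTP (hsq a)
  -- adjoining an element
  have adj : ∀ a, a ∉ P → ∃ s ∈ P, ∃ t ∈ P, (-1 : A) = s + a * t := by
    intro a ha
    let Q : Subsemiring A :=
      { carrier := {x | ∃ s ∈ P, ∃ t ∈ P, x = s + a * t}
        zero_mem' := ⟨0, P.zero_mem, 0, P.zero_mem, by ring⟩
        one_mem' := ⟨1, P.one_mem, 0, P.zero_mem, by ring⟩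
        add_mem' := by
          rintro _ _ ⟨s, hs, t, ht, rfl⟩ ⟨s', hs', t', ht', rfl⟩
          exact ⟨s + s', P.add_mem hs hs', t + t', P.add_mem ht ht', by ring⟩
        mul_mem' := by
          rintro _ _ ⟨s, hs, t, ht, rfl⟩ ⟨s', hs', t', ht', rfl⟩
          exact ⟨s * s' + (a * a) * (t * t'), P.add_mem (P.mul_mem hs hs')
            (P.mul_mem (hPsq a) (P.mul_mem ht ht')), s * t' + t * s',
            P.add_mem (P.mul_mem hs ht') (P.mul_mem ht hs'), by ring⟩ }
    by_contra hno
    have hQ : Q ∈ {P : Subsemiring A | T ≤ P ∧ (-1 : A) ∉ P} :=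
      ⟨fun x hx => ⟨x, hTP hx, 0, P.zero_mem, by ring⟩, hno⟩
    have : Q ≤ P := hmax.2 hQ (fun x hx => ⟨x, hx, 0, P.zero_mem, by ring⟩)
    exact ha (this ⟨0, P.zero_mem, 1, P.one_mem, by ring⟩)
  refine ⟨P, hTP, hP1, fun a b hab => ?_⟩
  by_contra hcon
  push Not at hcon
  obtain ⟨s, hs, t, ht, e⟩ := adj a hcon.1
  obtain ⟨s', hs', t', ht', e'⟩ := adj b hcon.2
  apply hP1
  have : (-1 : A) = (s + s' + s * s') + (-(a * b)) * (t * t') := by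
    have h2 : a * t = -1 - s := by rw [e]; ring
    have h3 : b * t' = -1 - s' := by rw [e']; ring
    have : (-(a * b)) * (t * t') = -((a * t) * (b * t')) := by ring
    rw [this, h2, h3]; ring
  rw [this]
  exact P.add_mem (P.add_mem (P.add_mem hs hs') (P.mul_mem hs hs')) (P.mul_mem hab (P.mul_mem ht ht'))

theorem field_order {F : Type} [Field F] (Q : Subsemiring F) (hsq : ∀ a, a * a ∈ Q)
    (h1 : (-1 : F) ∉ Q) : ∃ (_ : LinearOrder F) (_ : IsStrictOrderedRing F), ∀ x ∈ Q, 0 ≤ x := by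
  obtain ⟨P, hQP, hP1, hP⟩ := ord_ext Q hsq h1
  let C : RingCone F :=
    { P with
      eq_zero_of_mem_of_neg_mem' := by
        intro a ha hna
        by_contra h0
        apply hP1
        have : (-1 : F) = a * (-a) * (a⁻¹ * a⁻¹) := by field_simp
        rw [this]
        exact P.mul_mem (P.mul_mem ha hna) (hQP (hsq _)) }
  have : HasMemOrNegMem C := ⟨fun a => hP a (-a) (by
    have : -(a * -a) = a * a := by ring
    rw [this]; exact hQP (hsq a))⟩
  classical
  letI : LinearOrder F := LinearOrder.mkOfAddGroupCone C
  have hor : IsOrderedRing F := IsOrderedRing.mkOfCone C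
  have : IsStrictOrderedRing F := IsOrderedRing.toIsStrictOrderedRing F
  refine ⟨inferInstance, this, fun x hx => ?_⟩
  have : x - 0 ∈ C := by
    rw [sub_zero]; exact hQP hx
  exact this

theorem exists_ordered_field {A : Type} [CommRing A] (T : Subsemiring A) (hsq : ∀ a, a * a ∈ T)
    (h1 : (-1 : A) ∉ T) : ∃ (F : Type) (_ : Field F) (_ : LinearOrder F)
      (_ : IsStrictOrderedRing F) (φ : A →+* F), ∀ x ∈ T, 0 ≤ φ x := by
  obtain ⟨P, hTP, hP1, hP⟩ := ord_ext T hsq h1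
  have hPsq : ∀ a, a * a ∈ P := fun a => hTP (hsq a)
  have htot : ∀ a, a ∈ P ∨ -a ∈ P := fun a => hP a (-a) (by
    have : -(a * -a) = a * a := by ring
    rw [this]; exact hPsq a)
  let I : Ideal A :=
    { carrier := {a | a ∈ P ∧ -a ∈ P}
      zero_mem' := ⟨P.zero_mem, by simp⟩
      add_mem' := by
        rintro a b ⟨ha, ha'⟩ ⟨hb, hb'⟩
        refine ⟨P.add_mem ha hb, ?_⟩
        rw [neg_add]; exact P.add_mem ha' hb'
      smul_mem' := by
        rintro c a ⟨ha, ha'⟩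
        rw [Set.mem_setOf_eq, smul_eq_mul]
        rcases htot c with h | h
        · exact ⟨P.mul_mem h ha, by rw [← mul_neg]; exact P.mul_mem h ha'⟩
        · exact ⟨by rw [← neg_mul_neg]; exact P.mul_mem h ha',
            by rw [← neg_mul]; exact P.mul_mem h ha⟩ }
  have hI : ∀ a, a ∈ I ↔ a ∈ P ∧ -a ∈ P := fun a => Iff.rfl
  have hIp : I.IsPrime := by
    refine ⟨fun h => hP1 (((hI 1).1 (h ▸ Submodule.mem_top)).2), ?_⟩
    intro a b hab
    by_contra hcon
    push Not at hcon
    have hab1 := (hI _).1 hab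
    have hab2 : ∀ c d, (c = a ∨ c = -a) → (d = b ∨ d = -b) → c ∈ P ∨ d ∈ P := by
      intro c d hc hd
      apply hP
      rcases hc with rfl | rfl <;> rcases hd with rfl | rfl <;> simp [hab1.1, hab1.2]
    rw [hI, hI] at hcon
    have := hab2 a b (.inl rfl) (.inl rfl)
    have := hab2 a (-b) (.inl rfl) (.inr rfl)
    have := hab2 (-a) b (.inr rfl) (.inl rfl)
    have := hab2 (-a) (-b) (.inr rfl) (.inr rfl)
    tauto
  let F := FractionRing (A ⧸ I)
  let φ : A →+* F := (algebraMap (A ⧸ I) F).comp (Ideal.Quotient.mk I)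
  have hφ0 : ∀ a, φ a = 0 ↔ a ∈ P ∧ -a ∈ P := by
    intro a
    rw [← hI, ← Ideal.Quotient.eq_zero_iff_mem]
    exact (map_eq_zero_iff _ (IsFractionRing.injective (A ⧸ I) F))
  have hdiv : ∀ x : F, ∃ a b, φ b ≠ 0 ∧ x * φ b = φ a := by
    intro x
    obtain ⟨p, q, hq, rfl⟩ := IsFractionRing.div_surjective (A := A ⧸ I) x
    obtain ⟨a, rfl⟩ := Ideal.Quotient.mk_surjective p
    obtain ⟨b, rfl⟩ := Ideal.Quotient.mk_surjective q
    have hb : φ b ≠ 0 := by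
      intro h
      have := (map_eq_zero_iff _ (IsFractionRing.injective (A ⧸ I) F)).1 h
      exact nonZeroDivisors.ne_zero hq this
    exact ⟨a, b, hb, div_mul_cancel₀ _ hb⟩
  let Q : Subsemiring F :=
    { carrier := {x | ∃ a ∈ P, ∃ b, φ b ≠ 0 ∧ x * φ b ^ 2 = φ a}
      zero_mem' := ⟨0, P.zero_mem, 1, by simp, by simp⟩
      one_mem' := ⟨1, P.one_mem, 1, by simp, by simp⟩
      add_mem' := by
        rintro x y ⟨a, ha, b, hb, e⟩ ⟨c, hc, d, hd, e'⟩
        refine ⟨a * (d * d) + c * (b * b), P.add_mem (P.mul_mem ha (hPsq d))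
          (P.mul_mem hc (hPsq b)), b * d, by rw [map_mul]; exact mul_ne_zero hb hd, ?_⟩
        simp only [map_mul, map_add, ← e, ← e']; ring
      mul_mem' := by
        rintro x y ⟨a, ha, b, hb, e⟩ ⟨c, hc, d, hd, e'⟩
        refine ⟨a * c, P.mul_mem ha hc, b * d, by rw [map_mul]; exact mul_ne_zero hb hd, ?_⟩
        simp only [map_mul, ← e, ← e']; ring }
  obtain ⟨lo, so, hpos⟩ := field_order Q (by
      intro x
      obtain ⟨a, b, hb, e⟩ := hdiv x
      refine ⟨a * a, hPsq a, b, hb, ?_⟩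
      rw [map_mul, ← e]; ring) (by
      rintro ⟨a, ha, b, hb, e⟩
      apply hb
      have h0 : φ (a + b * b) = 0 := by rw [map_add, map_mul, ← e]; ring
      have h2 := ((hφ0 _).1 h0).2
      have h3 : φ (b * b) = 0 := by
        refine (hφ0 _).2 ⟨hPsq b, ?_⟩
        have : -(b * b) = -(a + b * b) + a := by ring
        rw [this]; exact P.add_mem h2 ha
      rw [map_mul] at h3
      exact mul_self_eq_zero.1 h3)
  refine ⟨F, inferInstance, lo, so, φ, fun x hx => hpos _ ⟨x, hTP hx, 1, by simp, by simp⟩⟩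

end
end

section
set_option linter.unusedSectionVars false
set_option linter.style.haveILetI false

section

/-- Cones inside a field, defining an ordered subfield. -/
structure RCone {Ω : Type} [Field Ω] (P : Subsemiring Ω) : Prop where
  inv : ∀ a ∈ P, a⁻¹ ∈ P
  neg1 : (-1 : Ω) ∉ P
  tot : ∀ a ∈ P, ∀ b ∈ P, a - b ∈ P ∨ b - a ∈ P

/-- The subfield spanned by a cone. -/
def RCone.sub {Ω : Type} [Field Ω] {P : Subsemiring Ω} (hP : RCone P) : Subfield Ω where
  carrier := {x | x ∈ P ∨ -x ∈ P}
  zero_mem' := .inl P.zero_mem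
  one_mem' := .inl P.one_mem
  add_mem' := by
    rintro a b (ha | ha) (hb | hb)
    · exact .inl (P.add_mem ha hb)
    · rcases hP.tot a ha (-b) hb with h | h
      · left; simpa using h
      · right; rw [neg_add, add_comm]; simpa [sub_eq_add_neg] using h
    · rcases hP.tot b hb (-a) ha with h | h
      · left; rw [add_comm]; simpa using h
      · right; rw [neg_add]; simpa [sub_eq_add_neg] using h
    · right; rw [neg_add]; exact P.add_mem ha hb
  mul_mem' := by
    rintro a b (ha | ha) (hb | hb)
    · exact .inl (P.mul_mem ha hb)
    · right; rw [← mul_neg]; exact P.mul_mem ha hb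
    · right; rw [← neg_mul]; exact P.mul_mem ha hb
    · left; rw [← neg_mul_neg]; exact P.mul_mem ha hb
  neg_mem' := by
    rintro a (ha | ha)
    · right; simpa using ha
    · left; exact ha
  inv_mem' := by
    rintro a (ha | ha)
    · left; exact hP.inv a ha
    · right; rw [← inv_neg]; exact hP.inv _ ha

theorem RCone.mem_sub {Ω : Type} [Field Ω] {P : Subsemiring Ω} (hP : RCone P) (x : Ω) :
    x ∈ hP.sub ↔ x ∈ P ∨ -x ∈ P := Iff.rfl

/-- The degree-wise intermediate value property yields formal reality of `R[X]/(p)`. -/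
theorem adjoin_not_neg_one {R : Type} [Field R] [LinearOrder R] [IsStrictOrderedRing R]
    (p : Polynomial R) (hp : Irreducible p) {u v : R} (hneg : p.eval u * p.eval v < 0)
    (hmin : ∀ q : Polynomial R, q.natDegree < p.natDegree → q.eval u * q.eval v < 0 →
      ∃ w, q.eval w = 0) :
    ∃ Q : Subsemiring (AdjoinRoot p), (∀ a, a * a ∈ Q) ∧ (∀ a, 0 ≤ a → AdjoinRoot.of p a ∈ Q) ∧
      (-1 : AdjoinRoot p) ∉ Q := by
  have hp0 : p ≠ 0 := hp.ne_zero
  have hpd : 0 < p.natDegree := hp.natDegree_pos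
  let M : Submonoid (AdjoinRoot p) :=
    { carrier := {x | ∃ a : R, 0 ≤ a ∧ ∃ e, x = AdjoinRoot.of p a * e ^ 2}
      one_mem' := ⟨1, zero_le_one, 1, by simp⟩
      mul_mem' := by
        rintro _ _ ⟨a, ha, e, rfl⟩ ⟨b, hb, f, rfl⟩
        exact ⟨a * b, mul_nonneg ha hb, e * f, by rw [map_mul]; ring⟩ }
  have key : ∀ x ∈ M.subsemiringClosure, ∃ f : Polynomial R, AdjoinRoot.mk p f = x ∧
      f.natDegree ≤ 2 * (p.natDegree - 1) ∧ ∀ w, 0 ≤ f.eval w := by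
    intro x hx
    rw [Submonoid.subsemiringClosure_mem] at hx
    induction hx using AddSubmonoid.closure_induction with
    | mem x hx =>
      obtain ⟨a, ha, e, rfl⟩ := hx
      obtain ⟨g, rfl⟩ := AdjoinRoot.mk_surjective e
      have hg : AdjoinRoot.mk p g = AdjoinRoot.mk p (g % p) := by
        rw [AdjoinRoot.mk_eq_mk]
        exact ⟨g / p, by rw [eq_comm, ← sub_eq_zero]; linear_combination EuclideanDomain.div_add_mod g p⟩
      refine ⟨Polynomial.C a * (g % p) ^ 2, by simp [hg], ?_, ?_⟩
      · have h1 : (g % p).natDegree ≤ p.natDegree - 1 := by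
          have := Polynomial.natDegree_mod_lt g (q := p) (by omega)
          omega
        calc _ ≤ ((g % p) ^ 2).natDegree := Polynomial.natDegree_C_mul_le _ _
          _ ≤ 2 * (g % p).natDegree := Polynomial.natDegree_pow_le
          _ ≤ _ := by omega
      · intro w
        simp only [Polynomial.eval_mul, Polynomial.eval_C, Polynomial.eval_pow]
        positivity
    | zero => exact ⟨0, by simp⟩
    | add x y _ _ hx hy =>
      obtain ⟨f, rfl, hf, hf'⟩ := hx
      obtain ⟨g, rfl, hg, hg'⟩ := hy
      refine ⟨f + g, by simp, (Polynomial.natDegree_add_le _ _).trans (max_le hf hg), fun w => ?_⟩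
      rw [Polynomial.eval_add]
      exact add_nonneg (hf' w) (hg' w)
  refine ⟨M.subsemiringClosure, fun a => ?_, fun a ha => ?_, fun h => ?_⟩
  · exact AddSubmonoid.subset_closure ⟨1, zero_le_one, a, by simp [sq]⟩
  · exact AddSubmonoid.subset_closure ⟨a, ha, 1, by simp⟩
  · obtain ⟨f, hf, hfd, hfp⟩ := key _ h
    have h0 : AdjoinRoot.mk p (f + 1) = 0 := by rw [map_add, hf]; simp
    obtain ⟨q, hq⟩ := AdjoinRoot.mk_eq_zero.1 h0
    have hev : ∀ w, 0 < p.eval w * q.eval w := by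
      intro w
      rw [← Polynomial.eval_mul, ← hq, Polynomial.eval_add, Polynomial.eval_one]
      have := hfp w
      linarith
    have hq0 : q ≠ 0 := by
      rintro rfl
      simpa using hev u
    have hqd : q.natDegree < p.natDegree := by
      have h1 := Polynomial.natDegree_mul hp0 hq0
      rw [← hq] at h1
      have h2 : (f + 1).natDegree ≤ 2 * (p.natDegree - 1) :=
        (Polynomial.natDegree_add_le _ _).trans (max_le hfd (by simp))
      omega
    have hqn : q.eval u * q.eval v < 0 := by
      have h1 := mul_pos (hev u) (hev v)
      by_contra hcon
      push Not at hcon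
      nlinarith [mul_nonneg (neg_pos.2 hneg).le hcon]
    obtain ⟨w, hw⟩ := hmin q hqd hqn
    have := hev w
    rw [hw] at this
    simp at this

theorem exists_real_closed (F : Type) [Field F] [LinearOrder F] [IsStrictOrderedRing F] :
    ∃ (R : Type) (_ : Field R) (_ : LinearOrder R) (_ : IsStrictOrderedRing R) (φ : F →+* R),
      (∀ x, 0 ≤ x → 0 ≤ φ x) ∧ PolyIVT R := by
  let Ω := AlgebraicClosure F
  let ι : F →+* Ω := algebraMap F Ω
  have hι : Function.Injective ι := ι.injective
  let P0 : Subsemiring Ω := (Subsemiring.nonneg F).map ι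
  have hP0 : RCone P0 := by
    refine ⟨?_, ?_, ?_⟩
    · rintro _ ⟨a, ha, rfl⟩
      exact ⟨a⁻¹, inv_nonneg.2 ha, map_inv₀ ι a⟩
    · rintro ⟨a, ha, e⟩
      have : a = -1 := hι (by rw [e]; simp)
      subst this
      have : (0 : F) ≤ -1 := ha
      linarith
    · rintro _ ⟨a, ha, rfl⟩ _ ⟨b, hb, rfl⟩
      rcases le_total b a with h | h
      · exact .inl ⟨a - b, sub_nonneg.2 h, map_sub ι a b⟩
      · exact .inr ⟨b - a, sub_nonneg.2 h, map_sub ι b a⟩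
  obtain ⟨P, hP0P, hmax⟩ := zorn_le_nonempty₀ {P : Subsemiring Ω | RCone P} (by
    intro c hc hchain y hy
    have hm : ∀ x, x ∈ sSup c ↔ ∃ s ∈ c, x ∈ s := fun x =>
      Subsemiring.mem_sSup_of_directedOn ⟨y, hy⟩ hchain.directedOn
    refine ⟨sSup c, ⟨?_, ?_, ?_⟩, fun z hz => le_sSup hz⟩
    · intro a ha
      obtain ⟨s, hs, h⟩ := (hm a).1 ha
      exact (hm _).2 ⟨s, hs, (hc hs).inv a h⟩
    · intro h
      obtain ⟨s, hs, h⟩ := (hm _).1 h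
      exact (hc hs).neg1 h
    · intro a ha b hb
      obtain ⟨s, hs, h⟩ := (hm a).1 ha
      obtain ⟨s', hs', h'⟩ := (hm b).1 hb
      obtain ⟨s2, hs2, k1, k2⟩ := hchain.directedOn s hs s' hs'
      rcases (hc hs2).tot a (k1 h) b (k2 h') with h | h
      · exact .inl ((hm _).2 ⟨s2, hs2, h⟩)
      · exact .inr ((hm _).2 ⟨s2, hs2, h⟩)) P0 hP0
  have hP : RCone P := hmax.1
  let R : Subfield Ω := hP.sub
  let QR : Subsemiring R := P.comap R.subtype
  obtain ⟨lo, so, hpos⟩ := field_order QR (by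
    rintro ⟨a, ha⟩
    change a * a ∈ P
    rcases ha with h | h
    · exact P.mul_mem h h
    · rw [← neg_mul_neg]; exact P.mul_mem h h) (by
    intro h
    exact hP.neg1 h)
  have hnn : ∀ x : R, 0 ≤ x → (x : Ω) ∈ P := by
    intro x hx
    rcases x.2 with h | h
    · exact h
    · have h1 : 0 ≤ -x := hpos (-x) h
      have : x = 0 := by
        apply le_antisymm _ hx
        exact neg_nonneg.1 h1
      rw [this]; exact P.zero_mem
  have hιR : ∀ x, ι x ∈ R := by
    intro x
    rcases le_total 0 x with h | h
    · exact .inl (hP0P ⟨x, h, rfl⟩)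
    · exact .inr (hP0P ⟨-x, neg_nonneg.2 h, map_neg ι x⟩)
  refine ⟨R, inferInstance, lo, so, ι.codRestrict R hιR, ?_, ?_⟩
  · intro x hx
    exact hpos _ (hP0P ⟨x, hx, rfl⟩)
  by_contra hcon
  have hex : ∃ n : ℕ, ∃ p : Polynomial R, p.natDegree = n ∧ ∃ u v : R, u < v ∧
      p.eval u * p.eval v < 0 ∧ ∀ w, u < w → w < v → p.eval w ≠ 0 := by
    simp only [PolyIVT] at hcon
    push Not at hcon
    obtain ⟨p, u, v, h1, h2, h3⟩ := hcon
    exact ⟨_, p, rfl, u, v, h1, h2, h3⟩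
  classical
  obtain ⟨p, hpn, u, v, huv, hneg, hno⟩ := Nat.find_spec hex
  have hmin : ∀ q : Polynomial R, q.natDegree < p.natDegree → q.eval u * q.eval v < 0 →
      ∃ w, u < w ∧ w < v ∧ q.eval w = 0 := by
    intro q hq hqn
    rw [hpn] at hq
    by_contra hc
    push Not at hc
    exact Nat.find_min hex hq ⟨q, rfl, u, v, huv, hqn, hc⟩
  have hp0 : p ≠ 0 := by rintro rfl; simp at hneg
  have hpirr : Irreducible p := by
    constructor
    · intro hunit
      obtain ⟨c, hc, rfl⟩ := Polynomial.isUnit_iff.1 hunit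
      simp only [Polynomial.eval_C] at hneg
      exact absurd hneg (not_lt.2 (mul_self_nonneg c))
    · intro a b hab
      by_contra hc
      push Not at hc
      have ha0 : a ≠ 0 := by rintro rfl; simp [hp0] at hab
      have hb0 : b ≠ 0 := by rintro rfl; simp [hp0] at hab
      have hda : 0 < a.natDegree := Nat.pos_of_ne_zero fun h => hc.1 (by
        obtain ⟨c, rfl⟩ := Polynomial.natDegree_eq_zero.1 h
        exact Polynomial.isUnit_C.2 (isUnit_iff_ne_zero.2 (by simpa using ha0)))
      have hdb : 0 < b.natDegree := Nat.pos_of_ne_zero fun h => hc.2 (by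
        obtain ⟨c, rfl⟩ := Polynomial.natDegree_eq_zero.1 h
        exact Polynomial.isUnit_C.2 (isUnit_iff_ne_zero.2 (by simpa using hb0)))
      have hd := Polynomial.natDegree_mul ha0 hb0
      rw [← hab] at hd
      have h1 : (a.eval u * a.eval v) * (b.eval u * b.eval v) < 0 := by
        rw [hab] at hneg
        simp only [Polynomial.eval_mul] at hneg
        calc _ = a.eval u * b.eval u * (a.eval v * b.eval v) := by ring
          _ < 0 := hneg
      rcases mul_neg_iff.1 h1 with h | h
      · obtain ⟨w, w1, w2, w3⟩ := hmin b (by omega) h.2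
        exact hno w w1 w2 (by rw [hab]; simp [w3])
      · obtain ⟨w, w1, w2, w3⟩ := hmin a (by omega) h.1
        exact hno w w1 w2 (by rw [hab]; simp [w3])
  haveI : Fact (Irreducible p) := ⟨hpirr⟩
  obtain ⟨Q, hQsq, hQof, hQ1⟩ := adjoin_not_neg_one p hpirr hneg (fun q h1 h2 => by
    obtain ⟨w, _, _, h⟩ := hmin q h1 h2; exact ⟨w, h⟩)
  obtain ⟨loL, soL, hposL⟩ := field_order Q hQsq hQ1
  obtain ⟨α, hα⟩ := IsAlgClosed.exists_eval₂_eq_zero R.subtype p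
    (Polynomial.degree_pos_of_irreducible hpirr).ne'
  let ψ : AdjoinRoot p →+* Ω := AdjoinRoot.lift R.subtype α hα
  have hψ : Function.Injective ψ := ψ.injective
  let P' : Subsemiring Ω := (Subsemiring.nonneg (AdjoinRoot p)).map ψ
  have hP' : RCone P' := by
    refine ⟨?_, ?_, ?_⟩
    · rintro _ ⟨a, ha, rfl⟩
      exact ⟨a⁻¹, inv_nonneg.2 ha, map_inv₀ ψ a⟩
    · rintro ⟨a, ha, e⟩
      have : a = -1 := hψ (by rw [e]; simp)
      subst this
      have : (0 : AdjoinRoot p) ≤ -1 := ha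
      linarith
    · rintro _ ⟨a, ha, rfl⟩ _ ⟨b, hb, rfl⟩
      rcases le_total b a with h | h
      · exact .inl ⟨a - b, sub_nonneg.2 h, map_sub ψ a b⟩
      · exact .inr ⟨b - a, sub_nonneg.2 h, map_sub ψ b a⟩
  have hPP' : P ≤ P' := by
    intro x hx
    have hxR : x ∈ R := .inl hx
    refine ⟨AdjoinRoot.of p ⟨x, hxR⟩, hposL _ (hQof _ (hpos _ hx)), ?_⟩
    exact AdjoinRoot.lift_of hα
  have hP'P : P' ≤ P := hmax.2 hP' hPP'
  have hαR : α ∈ R := by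
    have hr : ψ (AdjoinRoot.root p) = α := AdjoinRoot.lift_root hα
    rcases le_total 0 (AdjoinRoot.root p) with h | h
    · exact .inl (hP'P ⟨_, h, hr⟩)
    · exact .inr (hP'P ⟨-_, neg_nonneg.2 h, by rw [map_neg, hr]⟩)
  let β : R := ⟨α, hαR⟩
  have hβ : p.eval β = 0 := by
    apply R.subtype.injective
    rw [← Polynomial.eval₂_at_apply, map_zero]
    exact hα
  obtain ⟨q, hq⟩ := (Polynomial.dvd_iff_isRoot (p := p) (a := β)).2 hβ
  have hqu : IsUnit q := (hpirr.isUnit_or_isUnit hq).resolve_left (Polynomial.not_isUnit_X_sub_C β)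
  obtain ⟨c, hc, rfl⟩ := Polynomial.isUnit_iff.1 hqu
  have h1 : (u - β) * (v - β) * (c * c) < 0 := by
    rw [hq] at hneg
    simp only [Polynomial.eval_mul, Polynomial.eval_sub, Polynomial.eval_X, Polynomial.eval_C]
      at hneg
    calc _ = (u - β) * c * ((v - β) * c) := by ring
      _ < 0 := hneg
  have h2 : (u - β) * (v - β) < 0 := by
    rcases mul_neg_iff.1 h1 with h | h
    · exact absurd h.2 (not_lt.2 (mul_self_nonneg c))
    · exact h.1
  rcases mul_neg_iff.1 h2 with h | h
  · have a1 := sub_pos.1 h.1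
    have a2 := sub_neg.1 h.2
    exact absurd huv (not_lt.2 (a2.trans a1).le)
  · exact hno β (sub_neg.1 h.1) (sub_pos.1 h.2) hβ

end
end

section
set_option linter.unusedSectionVars false
set_option linter.style.haveILetI false

theorem polyIVT_real : PolyIVT ℝ := by
  intro p u v huv hneg
  have hc : ContinuousOn (fun x => p.eval x) (Set.Icc u v) := p.continuous.continuousOn
  rcases mul_neg_iff.1 hneg with h | h
  · obtain ⟨w, hw, e⟩ := intermediate_value_Ioo' huv.le hc (show (0 : ℝ) ∈ Set.Ioo _ _ from ⟨h.2, h.1⟩)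
    exact ⟨w, hw.1, hw.2, e⟩
  · obtain ⟨w, hw, e⟩ := intermediate_value_Ioo huv.le hc (show (0 : ℝ) ∈ Set.Ioo _ _ from ⟨h.1, h.2⟩)
    exact ⟨w, hw.1, hw.2, e⟩

theorem real_sign {R : Type} [Field R] [LinearOrder R] [IsStrictOrderedRing R] (i : ℝ →+* R)
    (x : ℝ) : SignType.sign (i x) = SignType.sign x := by
  have key : ∀ y : ℝ, 0 < y → 0 < i y := by
    intro y hy
    have : i y = i (Real.sqrt y) ^ 2 := by rw [← map_pow, Real.sq_sqrt hy.le]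
    rw [this]
    have : i (Real.sqrt y) ≠ 0 := by
      rw [map_ne_zero]; exact (Real.sqrt_pos.2 hy).ne'
    positivity
  rcases lt_trichotomy x 0 with h | h | h
  · have := key (-x) (neg_pos.2 h)
    rw [map_neg] at this
    rw [sign_neg h, sign_neg (neg_pos.1 this)]
  · simp [h]
  · rw [sign_pos h, sign_pos (key x h)]

/-- The subsemiring generated by squares and the family `g`. -/
noncomputable def PO {ι κ : Type} (g : κ → MvPolynomial ι ℝ) : Subsemiring (MvPolynomial ι ℝ) :=
  Subsemiring.closure ({x | ∃ a, x = a * a} ∪ Set.range g)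

theorem PO.sq {ι κ : Type} (g : κ → MvPolynomial ι ℝ) (a : MvPolynomial ι ℝ) : a * a ∈ PO g :=
  Subsemiring.subset_closure (.inl ⟨a, rfl⟩)

theorem PO.gen {ι κ : Type} (g : κ → MvPolynomial ι ℝ) (k : κ) : g k ∈ PO g :=
  Subsemiring.subset_closure (.inr ⟨k, rfl⟩)

theorem cert {ι κ : Type} [Finite ι] [Finite κ] (g : κ → MvPolynomial ι ℝ) (u : MvPolynomial ι ℝ)
    (hu : ∀ x : ι → ℝ, (∀ k, 0 ≤ MvPolynomial.eval x (g k)) → MvPolynomial.eval x u < 0) :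
    ∃ s ∈ PO g, ∃ t ∈ PO g, (-1 : MvPolynomial ι ℝ) = s + u * t := by
  classical
  by_contra hno
  let T : Subsemiring (MvPolynomial ι ℝ) :=
    { carrier := {x | ∃ s ∈ PO g, ∃ t ∈ PO g, x = s + u * t}
      zero_mem' := ⟨0, (PO g).zero_mem, 0, (PO g).zero_mem, by ring⟩
      one_mem' := ⟨1, (PO g).one_mem, 0, (PO g).zero_mem, by ring⟩
      add_mem' := by
        rintro _ _ ⟨s, hs, t, ht, rfl⟩ ⟨s', hs', t', ht', rfl⟩
        exact ⟨s + s', (PO g).add_mem hs hs', t + t', (PO g).add_mem ht ht', by ring⟩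
      mul_mem' := by
        rintro _ _ ⟨s, hs, t, ht, rfl⟩ ⟨s', hs', t', ht', rfl⟩
        exact ⟨s * s' + (u * u) * (t * t'), (PO g).add_mem ((PO g).mul_mem hs hs')
          ((PO g).mul_mem (PO.sq g u) ((PO g).mul_mem ht ht')), s * t' + t * s',
          (PO g).add_mem ((PO g).mul_mem hs ht') ((PO g).mul_mem ht hs'), by ring⟩ }
  obtain ⟨F, _, _, _, φ, hφ⟩ := exists_ordered_field T
    (fun a => ⟨a * a, PO.sq g a, 0, (PO g).zero_mem, by ring⟩) hno
  obtain ⟨R, _, _, _, ρ, hρ, hR⟩ := exists_real_closed F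
  let Φ : MvPolynomial ι ℝ →+* R := ρ.comp φ
  have hΦ : ∀ x ∈ T, 0 ≤ Φ x := fun x hx => hρ _ (hφ x hx)
  cases nonempty_fintype ι
  cases nonempty_fintype κ
  let e := Fintype.equivFin ι
  let i : ℝ →+* R := Φ.comp MvPolynomial.C
  let S : Finset (MvPolynomial (Fin (Fintype.card ι)) ℝ) :=
    (insert u (Finset.univ.image g)).image (MvPolynomial.rename e)
  obtain ⟨c, hc⟩ := transfer_many _ hR polyIVT_real i (RingHom.id ℝ)
    (fun a => real_sign i a) S (fun k => Φ (MvPolynomial.X (e.symm k)))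
  have e1 : ∀ q, MvPolynomial.eval₂Hom i (fun k => Φ (MvPolynomial.X (e.symm k)))
      (MvPolynomial.rename e q) = Φ q := by
    intro q
    rw [MvPolynomial.eval₂Hom_rename]
    congr 1
    apply MvPolynomial.ringHom_ext
    · intro a; simp [i]
    · intro k; simp
  have e2 : ∀ q, MvPolynomial.eval₂Hom (RingHom.id ℝ) c (MvPolynomial.rename e q) =
      MvPolynomial.eval (c ∘ e) q := by
    intro q
    rw [MvPolynomial.eval₂Hom_rename]
    rfl
  have key : ∀ q ∈ insert u (Finset.univ.image g), q ∈ T →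
      0 ≤ MvPolynomial.eval (c ∘ e) q := by
    intro q hq hqT
    have h1 := hc _ (Finset.mem_image_of_mem (MvPolynomial.rename e) hq)
    rw [e1, e2] at h1
    have h2 : 0 ≤ SignType.sign (Φ q) := sign_nonneg_iff.2 (hΦ q hqT)
    rw [h1] at h2
    exact sign_nonneg_iff.1 h2
  have hneg := hu (c ∘ e) (fun k => key _ (by simp)
    ⟨g k, PO.gen g k, 0, (PO g).zero_mem, by ring⟩)
  exact absurd hneg (not_lt.2 (key u (by simp) ⟨0, (PO g).zero_mem, 1, (PO g).one_mem, by ring⟩))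
end

section
set_option linter.unusedSectionVars false
set_option linter.style.haveILetI false

section
variable {ι : Type}

theorem const_mem {T : Subsemiring (MvPolynomial ι ℝ)} (hsq : ∀ a, a * a ∈ T) {r : ℝ} (hr : 0 ≤ r) :
    MvPolynomial.C r ∈ T := by
  have := hsq (MvPolynomial.C (Real.sqrt r))
  rwa [← MvPolynomial.C_mul, Real.mul_self_sqrt hr] at this

theorem bdd_all {T : Subsemiring (MvPolynomial ι ℝ)} (hsq : ∀ a, a * a ∈ T)
    (hX : ∀ k, ∃ r : ℝ, 0 ≤ r ∧ MvPolynomial.C r - MvPolynomial.X k ∈ T ∧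
      MvPolynomial.C r + MvPolynomial.X k ∈ T) (f : MvPolynomial ι ℝ) :
    ∃ r : ℝ, 0 ≤ r ∧ MvPolynomial.C r - f ∈ T ∧ MvPolynomial.C r + f ∈ T := by
  induction f using MvPolynomial.induction_on with
  | C a =>
    refine ⟨|a|, abs_nonneg a, ?_, ?_⟩
    · rw [← MvPolynomial.C_sub]; exact const_mem hsq (sub_nonneg.2 (le_abs_self a))
    · rw [← MvPolynomial.C_add]; exact const_mem hsq (by linarith [neg_abs_le a])
  | add p q hp hq =>
    obtain ⟨r, hr, h1, h2⟩ := hp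
    obtain ⟨r', hr', h1', h2'⟩ := hq
    refine ⟨r + r', by positivity, ?_, ?_⟩
    · have := T.add_mem h1 h1'
      rw [MvPolynomial.C_add]; convert this using 1; ring
    · have := T.add_mem h2 h2'
      rw [MvPolynomial.C_add]; convert this using 1; ring
  | mul_X p k hp =>
    obtain ⟨r, hr, h1, h2⟩ := hp
    obtain ⟨r', hr', h1', h2'⟩ := hX k
    have hh : MvPolynomial.C (1 / 2 : ℝ) ∈ T := const_mem hsq (by norm_num)
    have h12 : (MvPolynomial.C (1 / 2 : ℝ) : MvPolynomial ι ℝ) * 2 = 1 := by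
      have : (2 : MvPolynomial ι ℝ) = MvPolynomial.C (2 : ℝ) := (map_ofNat MvPolynomial.C 2).symm
      rw [this, ← MvPolynomial.C_mul]; norm_num
    refine ⟨r * r', by positivity, ?_, ?_⟩
    · have := T.mul_mem hh (T.add_mem (T.mul_mem h1 h2') (T.mul_mem h2 h1'))
      convert this using 1
      rw [MvPolynomial.C_mul]
      linear_combination (-(MvPolynomial.C r * MvPolynomial.C r') + p * MvPolynomial.X k) * h12
    · have := T.mul_mem hh (T.add_mem (T.mul_mem h1 h1') (T.mul_mem h2 h2'))
      convert this using 1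
      rw [MvPolynomial.C_mul]
      linear_combination (-(MvPolynomial.C r * MvPolynomial.C r') - p * MvPolynomial.X k) * h12

theorem bdd_of_ball [Fintype ι] {T : Subsemiring (MvPolynomial ι ℝ)} (hsq : ∀ a, a * a ∈ T)
    {N : ℝ} (hN : 0 ≤ N)
    (h : MvPolynomial.C N - ∑ k, MvPolynomial.X k * MvPolynomial.X k ∈ T)
    (f : MvPolynomial ι ℝ) :
    ∃ r : ℝ, 0 ≤ r ∧ MvPolynomial.C r - f ∈ T ∧ MvPolynomial.C r + f ∈ T := by
  classical
  refine bdd_all hsq (fun k => ⟨N + 1 / 4, by positivity, ?_⟩) f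
  have e : ∑ k : ι, (MvPolynomial.X k * MvPolynomial.X k : MvPolynomial ι ℝ) =
      MvPolynomial.X k * MvPolynomial.X k +
        ∑ l ∈ Finset.univ.erase k, MvPolynomial.X l * MvPolynomial.X l :=
    (Finset.add_sum_erase _ _ (Finset.mem_univ k)).symm
  rw [e] at h
  have hs : ∑ l ∈ Finset.univ.erase k, (MvPolynomial.X l * MvPolynomial.X l : MvPolynomial ι ℝ) ∈ T :=
    T.sum_mem fun l _ => hsq _
  have h12 : (MvPolynomial.C (1 / 2 : ℝ) : MvPolynomial ι ℝ) * 2 = 1 := by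
    have : (2 : MvPolynomial ι ℝ) = MvPolynomial.C (2 : ℝ) := (map_ofNat MvPolynomial.C 2).symm
    rw [this, ← MvPolynomial.C_mul]; norm_num
  have h14 : (MvPolynomial.C (1 / 4 : ℝ) : MvPolynomial ι ℝ) =
      MvPolynomial.C (1 / 2 : ℝ) * MvPolynomial.C (1 / 2 : ℝ) := by
    rw [← MvPolynomial.C_mul]; norm_num
  constructor
  · have := T.add_mem (T.add_mem h hs) (hsq (MvPolynomial.X k - MvPolynomial.C (1 / 2 : ℝ)))
    convert this using 1
    rw [MvPolynomial.C_add, h14]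
    linear_combination MvPolynomial.X k * h12
  · have := T.add_mem (T.add_mem h hs) (hsq (MvPolynomial.X k + MvPolynomial.C (1 / 2 : ℝ)))
    convert this using 1
    rw [MvPolynomial.C_add, h14]
    linear_combination -MvPolynomial.X k * h12

theorem po_bdd [Fintype ι] {κ : Type} [Finite κ] (g : κ → MvPolynomial ι ℝ) {N : ℝ} (hN : 0 ≤ N)
    (hK : ∀ x : ι → ℝ, (∀ k, 0 ≤ MvPolynomial.eval x (g k)) → ∑ k, x k * x k < N)
    (f : MvPolynomial ι ℝ) :
    ∃ r : ℝ, 0 ≤ r ∧ MvPolynomial.C r - f ∈ PO g ∧ MvPolynomial.C r + f ∈ PO g := by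
  let q : MvPolynomial ι ℝ := ∑ k, MvPolynomial.X k * MvPolynomial.X k
  let p : MvPolynomial ι ℝ := MvPolynomial.C N - q
  have hq : q ∈ PO g := (PO g).sum_mem fun l _ => PO.sq g _
  obtain ⟨s, hs, t, ht, e⟩ := cert g (-p) (by
    intro x hx
    simpa [p, q] using hK x hx)
  have e1 : p * t = 1 + s := by linear_combination e
  let T : Subsemiring (MvPolynomial ι ℝ) :=
    { carrier := {x | ∃ s ∈ PO g, ∃ t ∈ PO g, x = s + p * t}
      zero_mem' := ⟨0, (PO g).zero_mem, 0, (PO g).zero_mem, by ring⟩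
      one_mem' := ⟨1, (PO g).one_mem, 0, (PO g).zero_mem, by ring⟩
      add_mem' := by
        rintro _ _ ⟨s, hs, t, ht, rfl⟩ ⟨s', hs', t', ht', rfl⟩
        exact ⟨s + s', (PO g).add_mem hs hs', t + t', (PO g).add_mem ht ht', by ring⟩
      mul_mem' := by
        rintro _ _ ⟨s, hs, t, ht, rfl⟩ ⟨s', hs', t', ht', rfl⟩
        exact ⟨s * s' + (p * p) * (t * t'), (PO g).add_mem ((PO g).mul_mem hs hs')
          ((PO g).mul_mem (PO.sq g p) ((PO g).mul_mem ht ht')), s * t' + t * s',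
          (PO g).add_mem ((PO g).mul_mem hs ht') ((PO g).mul_mem ht hs'), by ring⟩ }
  have hTsq : ∀ a, a * a ∈ T := fun a => ⟨a * a, PO.sq g a, 0, (PO g).zero_mem, by ring⟩
  have hpT : p ∈ T := ⟨0, (PO g).zero_mem, 1, (PO g).one_mem, by ring⟩
  have h1s : 1 + s ∈ PO g := (PO g).add_mem (PO g).one_mem hs
  have hmul : ∀ x ∈ T, (1 + s) * x ∈ PO g := by
    rintro _ ⟨a, ha, b, hb, rfl⟩
    have : (1 + s) * (a + p * b) = (1 + s) * a + (p * p) * (t * b) := by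
      linear_combination (-p * b) * e1
    rw [this]
    exact (PO g).add_mem ((PO g).mul_mem h1s ha)
      ((PO g).mul_mem (PO.sq g p) ((PO g).mul_mem ht hb))
  obtain ⟨r, hr, hrs, -⟩ := bdd_of_ball hTsq hN hpT s
  have h12 : (MvPolynomial.C (1 / 2 : ℝ) : MvPolynomial ι ℝ) * 2 = 1 := by
    have : (2 : MvPolynomial ι ℝ) = MvPolynomial.C (2 : ℝ) := (map_ofNat MvPolynomial.C 2).symm
    rw [this, ← MvPolynomial.C_mul]; norm_num
  let M : ℝ := r + r * (1 / 2) * (r * (1 / 2))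
  have hM : 0 ≤ M := by positivity
  have hMs : MvPolynomial.C M - s ∈ PO g := by
    have := (PO g).add_mem (hmul _ hrs) (PO.sq g (s - MvPolynomial.C r * MvPolynomial.C (1 / 2)))
    convert this using 1
    simp only [M, MvPolynomial.C_add, MvPolynomial.C_mul]
    linear_combination (MvPolynomial.C r * s) * h12
  have hfin : MvPolynomial.C (N + N * M) - q ∈ PO g := by
    have := (PO g).add_mem ((PO g).add_mem (hmul p hpT) ((PO g).mul_mem hs hq))
      ((PO g).mul_mem (const_mem (PO.sq g) hN) hMs)
    convert this using 1
    simp only [p, MvPolynomial.C_add, MvPolynomial.C_mul]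
    ring
  exact bdd_of_ball (PO.sq g) (by positivity) hfin f

theorem po_pos [Fintype ι] {κ : Type} [Finite κ] (g : κ → MvPolynomial ι ℝ) {N : ℝ} (hN : 0 ≤ N)
    (hK : ∀ x : ι → ℝ, (∀ k, 0 ≤ MvPolynomial.eval x (g k)) → ∑ k, x k * x k < N)
    (f : MvPolynomial ι ℝ)
    (hf : ∀ x : ι → ℝ, (∀ k, 0 ≤ MvPolynomial.eval x (g k)) → 0 < MvPolynomial.eval x f) :
    f ∈ PO g := by
  obtain ⟨s, hs, t, ht, e⟩ := cert g (-f) (by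
    intro x hx
    simpa using hf x hx)
  have e1 : f * t = 1 + s := by linear_combination e
  obtain ⟨k1, hk1, h1, -⟩ := po_bdd g hN hK (t * (1 + s))
  obtain ⟨k2, hk2, h2, -⟩ := po_bdd g hN hK t
  let k : ℝ := k1 + k2 + 1
  have hk : 0 < k := by positivity
  have hkC : (MvPolynomial.C k⁻¹ : MvPolynomial ι ℝ) * MvPolynomial.C k = 1 := by
    rw [← MvPolynomial.C_mul, inv_mul_cancel₀ hk.ne', MvPolynomial.C_1]
  have hc : ∀ {r : ℝ}, 0 ≤ r → MvPolynomial.C r ∈ PO g := fun hr => const_mem (PO.sq g) hr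
  have h1' : MvPolynomial.C k - t * (1 + s) ∈ PO g := by
    have := (PO g).add_mem h1 (hc (show 0 ≤ k2 + 1 by positivity))
    convert this using 1
    simp only [k, MvPolynomial.C_add]; ring
  have h2' : 2 * MvPolynomial.C k - t ∈ PO g := by
    have := (PO g).add_mem h2 (hc (show 0 ≤ k1 + 1 + k by positivity))
    convert this using 1
    simp only [k, MvPolynomial.C_add]; ring
  have step : ∀ r : ℝ, 0 ≤ r → f + MvPolynomial.C r ∈ PO g →
      f + MvPolynomial.C (r - k⁻¹) ∈ PO g := by
    intro r hr hfr
    have a1 := (PO g).mul_mem (PO.sq g (MvPolynomial.C k - t)) hfr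
    have a2 := (PO g).mul_mem (hc hk.le) ((PO g).add_mem hs hs)
    have a3 := (PO g).mul_mem ((PO g).mul_mem ht (hc hr)) h2'
    have a4 := (PO g).add_mem ((PO g).add_mem ((PO g).add_mem a1 a2) h1') a3
    have a5 := (PO g).mul_mem (PO.sq g (MvPolynomial.C k⁻¹)) a4
    convert a5 using 1
    rw [MvPolynomial.C_sub]
    generalize MvPolynomial.C k = k' at *
    generalize MvPolynomial.C k⁻¹ = k'' at *
    have : (k' - t) * (k' - t) * (f + MvPolynomial.C r) + k' * (s + s) + (k' - t * (1 + s)) +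
        t * MvPolynomial.C r * (2 * k' - t) = k' * k' * (f + MvPolynomial.C r) - k' := by
      linear_combination (t - 2 * k') * e1
    rw [this]
    linear_combination (-(f + MvPolynomial.C r) * (k'' * k' + 1) + k'') * hkC
  have iter : ∀ n : ℕ, ∀ r : ℝ, r ≤ n * k⁻¹ → f + MvPolynomial.C r ∈ PO g → f ∈ PO g := by
    intro n
    induction n with
    | zero =>
      intro r hr h
      have := (PO g).add_mem h (hc (show 0 ≤ -r by simp at hr; linarith))
      rw [MvPolynomial.C_neg] at this
      convert this using 1; ring
    | succ n ih =>
      intro r hr h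
      rcases le_total 0 r with h0 | h0
      · refine ih (r - k⁻¹) ?_ (step r h0 h)
        push_cast at hr
        linarith
      · have := (PO g).add_mem h (hc (show 0 ≤ -r by linarith))
        rw [MvPolynomial.C_neg] at this
        convert this using 1; ring
  obtain ⟨r, hr, -, h⟩ := po_bdd g hN hK f
  obtain ⟨n, hn⟩ := exists_nat_ge (r * k)
  refine iter n r ?_ (by rw [add_comm]; exact h)
  rw [← div_eq_mul_inv, le_div_iff₀ hk]
  exact hn

theorem isSOS_iff {q : MvPolynomial ι ℝ} : IsSOS q ↔ IsSumSq q := by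
  constructor
  · rintro ⟨k, s, rfl⟩
    exact IsSumSq.sum fun i _ => by rw [sq]; exact IsSumSq.mul_self _
  · intro h
    induction h with
    | zero => exact ⟨0, Fin.elim0, by simp⟩
    | sq_add a hs ih =>
      obtain ⟨k, s, rfl⟩ := ih
      exact ⟨k + 1, Fin.cons a s, by simp [Fin.sum_univ_succ, sq]⟩

variable {κ : Type} [Fintype κ] [DecidableEq κ]

theorem InPreordering.add {g : κ → MvPolynomial ι ℝ} {a b : MvPolynomial ι ℝ}
    (ha : InPreordering g a) (hb : InPreordering g b) : InPreordering g (a + b) := by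
  obtain ⟨c, hc, rfl⟩ := ha
  obtain ⟨d, hd, rfl⟩ := hb
  refine ⟨fun J => c J + d J, fun J => ?_, ?_⟩
  · exact isSOS_iff.2 ((isSOS_iff.1 (hc J)).add (isSOS_iff.1 (hd J)))
  · rw [← Finset.sum_add_distrib]
    exact Finset.sum_congr rfl fun J _ => by ring

theorem InPreordering.single (g : κ → MvPolynomial ι ℝ) (J : Finset κ) {c : MvPolynomial ι ℝ}
    (hc : IsSumSq c) : InPreordering g (c * ∏ j ∈ J, g j) := by
  refine ⟨fun I => if I = J then c else 0, fun I => ?_, ?_⟩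
  · rw [isSOS_iff]
    dsimp only
    split_ifs
    · exact hc
    · exact IsSumSq.zero
  · simp [Finset.sum_ite_eq', ite_mul]

theorem InPreordering.sum {g : κ → MvPolynomial ι ℝ} {α : Type} (s : Finset α)
    (f : α → MvPolynomial ι ℝ) (h : ∀ a ∈ s, InPreordering g (f a)) :
    InPreordering g (∑ a ∈ s, f a) := by
  classical
  induction s using Finset.induction_on with
  | empty => exact ⟨fun _ => 0, fun _ => isSOS_iff.2 IsSumSq.zero, by simp⟩
  | insert a s ha ih =>
    rw [Finset.sum_insert ha]
    exact (h a (by simp)).add (ih fun b hb => h b (by simp [hb]))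

theorem InPreordering.mul {g : κ → MvPolynomial ι ℝ} {a b : MvPolynomial ι ℝ}
    (ha : InPreordering g a) (hb : InPreordering g b) : InPreordering g (a * b) := by
  obtain ⟨c, hc, rfl⟩ := ha
  obtain ⟨d, hd, rfl⟩ := hb
  rw [Finset.sum_mul_sum]
  refine InPreordering.sum _ _ fun J _ => InPreordering.sum _ _ fun I _ => ?_
  have e : (∏ j ∈ J, g j) * ∏ j ∈ I, g j =
      (∏ j ∈ J ∩ I, g j) * (∏ j ∈ J ∩ I, g j) * ∏ j ∈ symmDiff J I, g j := by
    have h1 : ∏ j ∈ J, g j = (∏ j ∈ J ∩ I, g j) * ∏ j ∈ J \ I, g j :=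
      (Finset.prod_inter_mul_prod_sdiff J I g).symm
    have h2 : ∏ j ∈ I, g j = (∏ j ∈ J ∩ I, g j) * ∏ j ∈ I \ J, g j := by
      rw [Finset.inter_comm]
      exact (Finset.prod_inter_mul_prod_sdiff I J g).symm
    have h3 : ∏ j ∈ symmDiff J I, g j = (∏ j ∈ J \ I, g j) * ∏ j ∈ I \ J, g j := by
      rw [symmDiff_def]
      exact Finset.prod_union disjoint_sdiff_sdiff
    rw [h1, h2, h3]; ring
  have : c J * (∏ j ∈ J, g j) * (d I * ∏ j ∈ I, g j) =
      c J * d I * ((∏ j ∈ J ∩ I, g j) * (∏ j ∈ J ∩ I, g j)) * ∏ j ∈ symmDiff J I, g j := by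
    linear_combination (c J * d I) * e
  rw [this]
  exact InPreordering.single g _ (((isSOS_iff.1 (hc J)).mul (isSOS_iff.1 (hd I))).mul
    (IsSumSq.mul_self _))

theorem PO.inPreordering {g : κ → MvPolynomial ι ℝ} {f : MvPolynomial ι ℝ} (hf : f ∈ PO g) :
    InPreordering g f := by
  induction hf using Subsemiring.closure_induction with
  | mem x hx =>
    rcases hx with ⟨a, rfl⟩ | ⟨k, rfl⟩
    · simpa using InPreordering.single g ∅ (IsSumSq.mul_self a)
    · simpa using InPreordering.single g {k} (IsSumSq.mul_self 1)
  | zero => simpa using InPreordering.single g ∅ IsSumSq.zero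
  | one => simpa using InPreordering.single g ∅ (IsSumSq.mul_self 1)
  | add x y _ _ hx hy => exact hx.add hy
  | mul x y _ _ hx hy => exact hx.mul hy

theorem schmudgen [Fintype ι] (g : κ → MvPolynomial ι ℝ)
    (hK : IsCompact {x : ι → ℝ | ∀ k, 0 ≤ MvPolynomial.eval x (g k)}) (f : MvPolynomial ι ℝ)
    (hf : ∀ x : ι → ℝ, (∀ k, 0 ≤ MvPolynomial.eval x (g k)) → 0 < MvPolynomial.eval x f) :
    InPreordering g f := by
  obtain ⟨B, hB⟩ := hK.bddAbove_image (f := fun x => ∑ k, x k * x k)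
    (by fun_prop : Continuous fun x : ι → ℝ => ∑ k, x k * x k).continuousOn
  refine PO.inPreordering (po_pos g (N := |B| + 1) (by positivity) (fun x hx => ?_) f hf)
  have := hB ⟨x, hx, rfl⟩
  have h2 := le_abs_self B
  dsimp only at this
  linarith

end
end

section
set_option linter.unusedSectionVars false

section
variable {ι κ : Type} [Fintype ι] [Fintype κ]

theorem mv_sw {S : Set (ι → ℝ)} (hS : IsCompact S) {φ : (ι → ℝ) → ℝ} (hφ : ContinuousOn φ S)
    {ε : ℝ} (hε : 0 < ε) : ∃ p : MvPolynomial ι ℝ, ∀ x ∈ S, |MvPolynomial.eval x p - φ x| < ε := by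
  have : CompactSpace S := isCompact_iff_compactSpace.1 hS
  let c : ι → C(S, ℝ) := fun i => ⟨fun x => x.1 i, (continuous_apply i).comp continuous_subtype_val⟩
  let A : Subalgebra ℝ C(S, ℝ) := (MvPolynomial.aeval c).range
  have hA : A.SeparatesPoints := by
    intro x y hxy
    have : ∃ i, x.1 i ≠ y.1 i := by
      by_contra! h
      exact hxy (Subtype.ext (funext h))
    obtain ⟨i, hi⟩ := this
    exact ⟨c i, ⟨c i, ⟨MvPolynomial.X i, by simp⟩, rfl⟩, hi⟩
  obtain ⟨⟨g, p, hp⟩, hg⟩ := ContinuousMap.exists_mem_subalgebra_near_continuous_of_separatesPoints A hA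
    (fun x : S => φ x.1) (continuousOn_iff_continuous_domRestrict.1 hφ) ε hε
  refine ⟨p, fun x hx => ?_⟩
  have h1 := hg ⟨x, hx⟩
  have h2 : g ⟨x, hx⟩ = MvPolynomial.eval x p := by
    rw [← hp]
    have : ∀ p : MvPolynomial ι ℝ, (MvPolynomial.aeval c p) ⟨x, hx⟩ = MvPolynomial.eval x p := by
      intro p
      induction p using MvPolynomial.induction_on with
      | C a => simp [_root_.algebraMap_apply]
      | add p q hp hq => simp [hp, hq]
      | mul_X p i hp => simp [hp, c]
    exact this p
  simpa [h2, Real.norm_eq_abs] using h1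

theorem mv_sw_sq {S : Set (ι → ℝ)} (hS : IsCompact S) {r : (ι → ℝ) → ℝ} (hr : ContinuousOn r S)
    (h0 : ∀ x ∈ S, 0 ≤ r x) {ε : ℝ} (hε : 0 < ε) :
    ∃ p : MvPolynomial ι ℝ, ∀ x ∈ S, |MvPolynomial.eval x p * MvPolynomial.eval x p - r x| ≤ ε := by
  have hc : ContinuousOn (fun x => Real.sqrt (r x)) S := hr.sqrt
  obtain ⟨B, hB⟩ := hS.exists_bound_of_continuousOn hc
  have hδ : 0 < min 1 (ε / (2 * |B| + 1)) := by positivity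
  obtain ⟨p, hp⟩ := mv_sw hS hc hδ
  refine ⟨p, fun x hx => ?_⟩
  have h1 := hp x hx
  have h2 := hB x hx
  have h3 : MvPolynomial.eval x p * MvPolynomial.eval x p - r x =
      (MvPolynomial.eval x p - Real.sqrt (r x)) *
        ((MvPolynomial.eval x p - Real.sqrt (r x)) + 2 * Real.sqrt (r x)) := by
    linear_combination Real.mul_self_sqrt (h0 x hx)
  rw [h3, abs_mul]
  rw [Real.norm_eq_abs] at h2
  set u := MvPolynomial.eval x p - Real.sqrt (r x)
  have h4 : |u + 2 * Real.sqrt (r x)| ≤ 2 * |B| + 1 := by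
    have a1 := abs_add_le u (2 * Real.sqrt (r x))
    rw [abs_mul, abs_two] at a1
    have a2 := (lt_min_iff.1 h1).1
    have a3 := le_abs_self B
    linarith
  have h5 : |u| ≤ ε / (2 * |B| + 1) := (lt_min_iff.1 h1).2.le
  calc |u| * |u + 2 * Real.sqrt (r x)| ≤ ε / (2 * |B| + 1) * (2 * |B| + 1) := by gcongr
    _ = ε := by field_simp

theorem pu_approx {S : Set (ι → ℝ)} (hS : IsCompact S) {E : Type} [NormedAddCommGroup E]
    [NormedSpace ℝ E] {a : (ι → ℝ) → E} (ha : ContinuousOn a S) {ε : ℝ} (hε : 0 < ε) :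
    ∃ (t : Finset (ι → ℝ)) (φ : (ι → ℝ) → MvPolynomial ι ℝ), (∀ k ∈ t, k ∈ S) ∧
      ∀ x ∈ S, ‖a x - ∑ k ∈ t, (MvPolynomial.eval x (φ k) * MvPolynomial.eval x (φ k)) • a k‖ ≤ ε := by
  have huc := hS.uniformContinuousOn_of_continuous ha
  rw [Metric.uniformContinuousOn_iff] at huc
  obtain ⟨δ, hδ, hu⟩ := huc (ε / 2) (by positivity)
  obtain ⟨t, htS, hcov⟩ := hS.elim_nhds_subcover (fun x => Metric.ball x δ)
    (fun x _ => Metric.ball_mem_nhds x hδ)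
  let ρ : (ι → ℝ) → (ι → ℝ) → ℝ := fun k x => max 0 (δ - dist x k)
  have hρ0 : ∀ k x, 0 ≤ ρ k x := fun k x => le_max_left _ _
  have hρc : ∀ k, Continuous (ρ k) := fun k => by fun_prop
  let W : (ι → ℝ) → ℝ := fun x => ∑ k ∈ t, ρ k x
  have hW : ∀ x ∈ S, 0 < W x := by
    intro x hx
    obtain ⟨k, hk, hxk⟩ : ∃ k ∈ t, x ∈ Metric.ball k δ := by simpa using hcov hx
    refine Finset.sum_pos' (fun k _ => hρ0 k x) ⟨k, hk, ?_⟩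
    rw [Metric.mem_ball] at hxk
    exact lt_max_of_lt_right (by linarith)
  have hWc : Continuous W := continuous_finsetSum _ fun k _ => hρc k
  let r : (ι → ℝ) → (ι → ℝ) → ℝ := fun k x => ρ k x / W x
  have hrc : ∀ k, ContinuousOn (r k) S := fun k =>
    (hρc k).continuousOn.div hWc.continuousOn fun x hx => (hW x hx).ne'
  have hr0 : ∀ k, ∀ x ∈ S, 0 ≤ r k x := fun k x hx => div_nonneg (hρ0 k x) (hW x hx).le
  have hr1 : ∀ x ∈ S, ∑ k ∈ t, r k x = 1 := by
    intro x hx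
    simp only [r]
    rw [← Finset.sum_div]
    exact div_self (hW x hx).ne'
  obtain ⟨A, hA⟩ := hS.exists_bound_of_continuousOn ha
  let η : ℝ := ε / (2 * (t.card * |A| + 1))
  have hη : 0 < η := by positivity
  choose φ hφ using fun k => mv_sw_sq hS (hrc k) (hr0 k) hη
  refine ⟨t, φ, htS, fun x hx => ?_⟩
  have e : a x - ∑ k ∈ t, (MvPolynomial.eval x (φ k) * MvPolynomial.eval x (φ k)) • a k =
      ∑ k ∈ t, r k x • (a x - a k) -
      ∑ k ∈ t, (MvPolynomial.eval x (φ k) * MvPolynomial.eval x (φ k) - r k x) • a k := by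
    simp only [smul_sub, sub_smul, Finset.sum_sub_distrib]
    rw [← Finset.sum_smul, hr1 x hx, one_smul]
    abel
  have h1 : ‖∑ k ∈ t, r k x • (a x - a k)‖ ≤ ε / 2 := by
    calc _ ≤ ∑ k ∈ t, r k x * (ε / 2) := by
          refine norm_sum_le_of_le _ fun k hk => ?_
          rw [norm_smul, Real.norm_eq_abs, abs_of_nonneg (hr0 k x hx)]
          rcases lt_or_ge (dist x k) δ with h | h
          · have := hu x hx k (htS k hk) h
            rw [dist_eq_norm] at this
            exact mul_le_mul_of_nonneg_left this.le (hr0 k x hx)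
          · have : r k x = 0 := by
              simp only [r, ρ]
              rw [max_eq_left (by linarith), zero_div]
            simp [this]
      _ = ε / 2 := by rw [← Finset.sum_mul, hr1 x hx, one_mul]
  have h2 : ‖∑ k ∈ t, (MvPolynomial.eval x (φ k) * MvPolynomial.eval x (φ k) - r k x) • a k‖
      ≤ ε / 2 := by
    calc _ ≤ ∑ k ∈ t, η * |A| := by
          refine norm_sum_le_of_le _ fun k hk => ?_
          rw [norm_smul, Real.norm_eq_abs]
          exact mul_le_mul (hφ k x hx) ((hA k (htS k hk)).trans (le_abs_self A)) (norm_nonneg _) hη.le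
      _ = η * (t.card * |A|) := by rw [Finset.sum_const, nsmul_eq_mul]; ring
      _ ≤ η * (t.card * |A| + 1) := by gcongr; linarith
      _ = ε / 2 := by simp only [η]; field_simp
  rw [e]
  exact (norm_sub_le _ _).trans (by linarith)

theorem exists_split (q : MvPolynomial (ι ⊕ κ) ℝ) :
    ∃ (T : Type) (_ : Fintype T) (a : T → MvPolynomial ι ℝ) (b : T → MvPolynomial κ ℝ),
      q = ∑ i, MvPolynomial.rename Sum.inl (a i) * MvPolynomial.rename Sum.inr (b i) := by
  induction q using MvPolynomial.induction_on with
  | C r => exact ⟨Unit, inferInstance, fun _ => MvPolynomial.C r, fun _ => 1, by simp⟩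
  | add p q hp hq =>
    obtain ⟨T, _, a, b, rfl⟩ := hp
    obtain ⟨T', _, a', b', rfl⟩ := hq
    exact ⟨T ⊕ T', inferInstance, Sum.elim a a', Sum.elim b b', by simp⟩
  | mul_X p k hp =>
    obtain ⟨T, hT, a, b, rfl⟩ := hp
    rcases k with k | k
    · refine ⟨T, hT, fun i => a i * MvPolynomial.X k, b, ?_⟩
      rw [Finset.sum_mul]
      exact Finset.sum_congr rfl fun i _ => by simp only [map_mul, MvPolynomial.rename_X]; ring
    · refine ⟨T, hT, a, fun i => b i * MvPolynomial.X k, ?_⟩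
      rw [Finset.sum_mul]
      exact Finset.sum_congr rfl fun i _ => by simp only [map_mul, MvPolynomial.rename_X]; ring

/-- `q = κ + σ + ψ` with a sum of squares `κ` and small losses. -/
def Dec (S : Set (ι → ℝ)) (R : Set (κ → ℝ)) (q : MvPolynomial (ι ⊕ κ) ℝ) (ε : ℝ) : Prop :=
  ∃ (k : MvPolynomial (ι ⊕ κ) ℝ) (σ : MvPolynomial ι ℝ) (ψ : MvPolynomial κ ℝ), IsSumSq k ∧
    (∀ x ∈ S, -ε ≤ MvPolynomial.eval x σ) ∧ (∀ y ∈ R, -ε ≤ MvPolynomial.eval y ψ) ∧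
    q = k + MvPolynomial.rename Sum.inl σ + MvPolynomial.rename Sum.inr ψ

variable {S : Set (ι → ℝ)} {R : Set (κ → ℝ)}

theorem Dec.zero : Dec S R 0 0 := ⟨0, 0, 0, IsSumSq.zero, by simp, by simp, by simp⟩

theorem Dec.mono {q : MvPolynomial (ι ⊕ κ) ℝ} {ε ε' : ℝ} (h : Dec S R q ε) (hε : ε ≤ ε') :
    Dec S R q ε' := by
  obtain ⟨k, σ, ψ, hk, h1, h2, e⟩ := h
  exact ⟨k, σ, ψ, hk, fun x hx => by linarith [h1 x hx], fun x hx => by linarith [h2 x hx], e⟩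

theorem Dec.add {q q' : MvPolynomial (ι ⊕ κ) ℝ} {ε ε' : ℝ} (h : Dec S R q ε)
    (h' : Dec S R q' ε') : Dec S R (q + q') (ε + ε') := by
  obtain ⟨k, σ, ψ, hk, h1, h2, e⟩ := h
  obtain ⟨k', σ', ψ', hk', h1', h2', e'⟩ := h'
  refine ⟨k + k', σ + σ', ψ + ψ', hk.add hk', fun x hx => ?_, fun x hx => ?_, ?_⟩
  · rw [map_add]; linarith [h1 x hx, h1' x hx]
  · rw [map_add]; linarith [h2 x hx, h2' x hx]
  · rw [e, e', map_add, map_add]; ring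

theorem Dec.sum {T : Type*} (s : Finset T) (q : T → MvPolynomial (ι ⊕ κ) ℝ) (ε : ℝ)
    (h : ∀ i ∈ s, Dec S R (q i) ε) : Dec S R (∑ i ∈ s, q i) (s.card * ε) := by
  classical
  induction s using Finset.induction_on with
  | empty => simpa using Dec.zero
  | insert a s ha ih =>
    rw [Finset.sum_insert ha, Finset.card_insert_of_notMem ha]
    refine ((h a (by simp)).add (ih fun b hb => h b (by simp [hb]))).mono ?_
    push_cast; linarith

theorem Dec.mul {a : MvPolynomial ι ℝ} {b : MvPolynomial κ ℝ} {α β : ℝ} (hα : 0 < α) (hβ : 0 < β)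
    (ha : ∀ x ∈ S, |MvPolynomial.eval x a| ≤ α) (hb : ∀ y ∈ R, |MvPolynomial.eval y b| ≤ β) :
    Dec S R (MvPolynomial.rename Sum.inl a * MvPolynomial.rename Sum.inr b) (α * β) := by
  let l : ℝ := Real.sqrt (β / α / 2)
  let l' : ℝ := Real.sqrt (α / β / 2)
  have hl : l * l = β / α / 2 := Real.mul_self_sqrt (by positivity)
  have hl' : l' * l' = α / β / 2 := Real.mul_self_sqrt (by positivity)
  have hll : 2 * (l * l') = 1 := by
    simp only [l, l']
    rw [← Real.sqrt_mul (by positivity)]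
    have : β / α / 2 * (α / β / 2) = (1 / 2) ^ 2 := by field_simp
    rw [this, Real.sqrt_sq (by norm_num)]; norm_num
  have hsq : ∀ {u v : ℝ}, |u| ≤ v → u * u ≤ v * v := fun {u v} h => by
    rw [← abs_mul_abs_self]
    exact mul_self_le_mul_self (abs_nonneg _) h
  refine ⟨(MvPolynomial.C l * MvPolynomial.rename Sum.inl a +
      MvPolynomial.C l' * MvPolynomial.rename Sum.inr b) *
      (MvPolynomial.C l * MvPolynomial.rename Sum.inl a +
      MvPolynomial.C l' * MvPolynomial.rename Sum.inr b),
      -(MvPolynomial.C (l * l) * (a * a)), -(MvPolynomial.C (l' * l') * (b * b)),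
      IsSumSq.mul_self _, fun x hx => ?_, fun y hy => ?_, ?_⟩
  · simp only [map_neg, map_mul, MvPolynomial.eval_C]
    rw [hl]
    have h1 := hsq (ha x hx)
    have : β / α / 2 * (MvPolynomial.eval x a * MvPolynomial.eval x a) ≤ β / α / 2 * (α * α) := by
      gcongr
    have h2 : β / α / 2 * (α * α) = α * β / 2 := by field_simp
    have h3 : 0 < α * β := by positivity
    linarith
  · simp only [map_neg, map_mul, MvPolynomial.eval_C]
    rw [hl']
    have h1 := hsq (hb y hy)
    have : α / β / 2 * (MvPolynomial.eval y b * MvPolynomial.eval y b) ≤ α / β / 2 * (β * β) := by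
      gcongr
    have h2 : α / β / 2 * (β * β) = α * β / 2 := by field_simp
    have h3 : 0 < α * β := by positivity
    linarith
  · have hC : (2 : MvPolynomial (ι ⊕ κ) ℝ) * (MvPolynomial.C l * MvPolynomial.C l') = 1 := by
      have : (2 : MvPolynomial (ι ⊕ κ) ℝ) = MvPolynomial.C (2 : ℝ) :=
        (map_ofNat MvPolynomial.C 2).symm
      rw [this, ← MvPolynomial.C_mul, ← MvPolynomial.C_mul, hll, MvPolynomial.C_1]
    simp only [map_neg, map_mul, MvPolynomial.rename_C]
    linear_combination (-MvPolynomial.rename Sum.inl a * MvPolynomial.rename Sum.inr b) * hC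

theorem mv_bdd {S : Set (ι → ℝ)} (hS : IsCompact S) (a : MvPolynomial ι ℝ) :
    ∃ B : ℝ, 0 < B ∧ ∀ x ∈ S, |MvPolynomial.eval x a| ≤ B := by
  obtain ⟨B, hB⟩ := hS.exists_bound_of_continuousOn (MvPolynomial.continuous_eval a).continuousOn
  exact ⟨|B| + 1, by positivity, fun x hx => (hB x hx).trans (by linarith [le_abs_self B])⟩

theorem Dec.sq_mul (hS : IsCompact S) (hR : IsCompact R) (φ : MvPolynomial ι ℝ)
    (r : MvPolynomial κ ℝ) (hr : ∀ y ∈ R, 0 ≤ MvPolynomial.eval y r) {ε : ℝ} (hε : 0 < ε) :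
    Dec S R (MvPolynomial.rename Sum.inl (φ * φ) * MvPolynomial.rename Sum.inr r) ε := by
  obtain ⟨B, hB, hφ⟩ := mv_bdd hS (φ * φ)
  obtain ⟨s, hs⟩ := mv_sw_sq hR (MvPolynomial.continuous_eval r).continuousOn hr
    (show 0 < ε / B by positivity)
  have h := Dec.mul (S := S) (R := R) (a := φ * φ) (b := r - s * s) hB (show 0 < ε / B by positivity)
    hφ (fun y hy => by
      rw [map_sub, map_mul, abs_sub_comm]; exact hs y hy)
  have h2 : Dec S R ((MvPolynomial.rename Sum.inl φ * MvPolynomial.rename Sum.inr s) *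
      (MvPolynomial.rename Sum.inl φ * MvPolynomial.rename Sum.inr s)) 0 :=
    ⟨_, 0, 0, IsSumSq.mul_self (MvPolynomial.rename Sum.inl φ * MvPolynomial.rename Sum.inr s),
      by simp, by simp, by simp⟩
  have h3 := h.add h2
  have e : B * (ε / B) + 0 = ε := by field_simp; simp
  rw [e] at h3
  convert h3 using 1
  simp only [map_sub, map_mul]
  ring

theorem Dec.of_nonneg (hS : IsCompact S) (hR : IsCompact R) (q : MvPolynomial (ι ⊕ κ) ℝ)
    (hq : ∀ x ∈ S, ∀ y ∈ R, 0 ≤ MvPolynomial.eval (Sum.elim x y) q) {ε : ℝ} (hε : 0 < ε) :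
    Dec S R q ε := by
  obtain ⟨T, _, a, b, rfl⟩ := exists_split q
  choose B hB0 hB using fun i => mv_bdd hR (b i)
  let B' : ℝ := ∑ i, B i + 1
  have hB' : 0 < B' := by
    have : 0 ≤ ∑ i, B i := Finset.sum_nonneg fun i _ => (hB0 i).le
    positivity
  have hBB : ∀ i, B i ≤ B' := fun i => by
    have := Finset.single_le_sum (f := B) (fun i _ => (hB0 i).le) (Finset.mem_univ i)
    simp only [B']; linarith
  let ε₁ : ℝ := ε / 2 / (Fintype.card T + 1) / B'
  have hε₁ : 0 < ε₁ := by positivity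
  obtain ⟨t, φ, htS, hφ⟩ := pu_approx hS
    (a := fun x => (fun i => MvPolynomial.eval x (a i) : T → ℝ))
    (continuous_pi fun i => MvPolynomial.continuous_eval (a i)).continuousOn hε₁
  let r : (ι → ℝ) → MvPolynomial κ ℝ := fun k => ∑ i, MvPolynomial.C (MvPolynomial.eval k (a i)) * b i
  let e : T → MvPolynomial ι ℝ := fun i =>
    a i - ∑ k ∈ t, φ k * φ k * MvPolynomial.C (MvPolynomial.eval k (a i))
  have he : ∀ i, ∀ x ∈ S, |MvPolynomial.eval x (e i)| ≤ ε₁ := by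
    intro i x hx
    have := (norm_le_pi_norm _ i).trans (hφ x hx)
    rw [Real.norm_eq_abs] at this
    simpa [e, Finset.sum_apply] using this
  have d1 := Dec.sum (S := S) (R := R) t
    (fun k => MvPolynomial.rename Sum.inl (φ k * φ k) * MvPolynomial.rename Sum.inr (r k))
    (ε / 2 / (t.card + 1)) (fun k hk => Dec.sq_mul hS hR (φ k) (r k) (fun y hy => by
      have := hq k (htS k hk) y hy
      simpa [r, MvPolynomial.eval_rename, map_sum, Function.comp_def] using this) (by positivity))
  have d2 := Dec.sum (S := S) (R := R) Finset.univ
    (fun i => MvPolynomial.rename Sum.inl (e i) * MvPolynomial.rename Sum.inr (b i))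
    (ε₁ * B') (fun i _ => Dec.mul hε₁ hB' (he i) fun y hy => (hB i y hy).trans (hBB i))
  have d3 := d1.add d2
  have key : ∀ n : ℕ, (n : ℝ) * (ε / 2 / (n + 1)) ≤ ε / 2 := by
    intro n
    have : (0 : ℝ) ≤ n := n.cast_nonneg
    rw [← mul_div_assoc, div_le_iff₀ (by positivity)]
    nlinarith
  have d4 := d3.mono (ε' := ε) (by
    have h1 := key t.card
    have h2 := key (Fintype.card T)
    have h3 : ε₁ * B' = ε / 2 / (Fintype.card T + 1) := by simp only [ε₁]; field_simp
    rw [h3, Finset.card_univ]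
    linarith)
  convert d4 using 1
  simp only [r, e, map_sub, map_sum, map_mul, MvPolynomial.rename_C, sub_mul, Finset.sum_mul,
    Finset.mul_sum, Finset.sum_sub_distrib]
  rw [Finset.sum_comm]
  have : ∀ u v w : MvPolynomial (ι ⊕ κ) ℝ, u = v → w = u + (w - v) := by
    intro u v w h; rw [h]; ring
  apply this
  exact Finset.sum_congr rfl fun i _ => Finset.sum_congr rfl fun k _ => by ring

theorem split_pos (hS : IsCompact S) (hR : IsCompact R) (q : MvPolynomial (ι ⊕ κ) ℝ)
    {c : ℝ} (hc : 0 < c)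
    (hq : ∀ x ∈ S, ∀ y ∈ R, c ≤ MvPolynomial.eval (Sum.elim x y) q) :
    ∃ (k : MvPolynomial (ι ⊕ κ) ℝ) (σ : MvPolynomial ι ℝ) (ψ : MvPolynomial κ ℝ), IsSumSq k ∧
    (∀ x ∈ S, 0 < MvPolynomial.eval x σ) ∧ (∀ y ∈ R, 0 < MvPolynomial.eval y ψ) ∧
    q = k + MvPolynomial.rename Sum.inl σ + MvPolynomial.rename Sum.inr ψ := by
  obtain ⟨k, σ, ψ, hk, h1, h2, e⟩ := Dec.of_nonneg hS hR (q - MvPolynomial.C c)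
    (fun x hx y hy => by
      rw [map_sub, MvPolynomial.eval_C]; linarith [hq x hx y hy]) (show 0 < c / 4 by positivity)
  refine ⟨k, σ + MvPolynomial.C (c / 2), ψ + MvPolynomial.C (c / 2), hk, fun x hx => ?_,
    fun y hy => ?_, ?_⟩
  · rw [map_add, MvPolynomial.eval_C]; linarith [h1 x hx]
  · rw [map_add, MvPolynomial.eval_C]; linarith [h2 y hy]
  · have hcc : (MvPolynomial.C c : MvPolynomial (ι ⊕ κ) ℝ) =
        MvPolynomial.C (c / 2) + MvPolynomial.C (c / 2) := by
      rw [← MvPolynomial.C_add]; congr 1; ring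
    rw [map_add, map_add, MvPolynomial.rename_C, MvPolynomial.rename_C]
    linear_combination e + hcc

end
end

set_option maxHeartbeats 1000000

theorem cartesian_preordering
    (n m p a b : ℕ)
    (g : Fin a → MvPolynomial (Fin n) ℝ)
    (h : Fin b → MvPolynomial (Fin m ⊕ Fin p) ℝ)
    (Kx : Set (Fin n → ℝ))
    (Kyz : Set ((Fin m → ℝ) × (Fin p → ℝ)))
    (K : Set ((Fin n → ℝ) × (Fin m → ℝ) × (Fin p → ℝ)))
    (hKx : Kx = {x | ∀ j, 0 ≤ eval x (g j)})
    (hKyz : Kyz = {w | ∀ k, 0 ≤ eval (Sum.elim w.1 w.2) (h k)})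
    (hK : K = {w | w.1 ∈ Kx ∧ w.2 ∈ Kyz})
    (hKxCompact : IsCompact Kx) (hKyzCompact : IsCompact Kyz)
    (hKint : (interior K).Nonempty)
    (f : MvPolynomial (Fin n ⊕ Fin m ⊕ Fin p) ℝ)
    (f₁ : MvPolynomial (Fin n ⊕ Fin m) ℝ) (f₂ : MvPolynomial (Fin m ⊕ Fin p) ℝ)
    (hf : f = rename (Sum.map id Sum.inl) f₁ + rename Sum.inr f₂)
    (hpos : ∀ w ∈ K, 0 < eval (Sum.elim w.1 (Sum.elim w.2.1 w.2.2)) f) :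
    ∃ (κpol : MvPolynomial (Fin n ⊕ Fin m) ℝ) (σ : MvPolynomial (Fin n) ℝ)
      (ψ : MvPolynomial (Fin m ⊕ Fin p) ℝ),
      IsSOS κpol ∧ InPreordering g σ ∧ InPreordering h ψ ∧
      f = rename (Sum.map id Sum.inl) κpol + rename Sum.inl σ + rename Sum.inr ψ := by
  subst hKx hKyz hK
  obtain ⟨⟨x₀, w₀⟩, hinter⟩ := hKint
  obtain ⟨hx₀, hw₀⟩ := interior_subset hinter
  clear hinter
  dsimp only at hx₀ hw₀
  set Kx : Set (Fin n → ℝ) := {x | ∀ j, 0 ≤ MvPolynomial.eval x (g j)} with hKx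
  set Kyz : Set ((Fin m → ℝ) × (Fin p → ℝ)) :=
    {w | ∀ k, 0 ≤ MvPolynomial.eval (Sum.elim w.1 w.2) (h k)} with hKyz
  have hev : ∀ x y z, MvPolynomial.eval (Sum.elim x (Sum.elim y z)) f =
      MvPolynomial.eval (Sum.elim x y) f₁ + MvPolynomial.eval (Sum.elim y z) f₂ := by
    intro x y z
    rw [hf, map_add, MvPolynomial.eval_rename, MvPolynomial.eval_rename]
    congr 2
    congr 1
    funext i
    rcases i with i | i <;> rfl
  have cse : ∀ {A B : Type}, Continuous fun w : (A → ℝ) × (B → ℝ) => (Sum.elim w.1 w.2 : A ⊕ B → ℝ) := by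
    intro A B
    refine continuous_pi fun i => ?_
    rcases i with i | i
    · exact (continuous_apply i).comp continuous_fst
    · exact (continuous_apply i).comp continuous_snd
  have c1 : Continuous fun w : (Fin n → ℝ) × (Fin m → ℝ) =>
      MvPolynomial.eval (Sum.elim w.1 w.2) f₁ := (MvPolynomial.continuous_eval f₁).comp cse
  have c2 : Continuous fun w : (Fin m → ℝ) × (Fin p → ℝ) =>
      MvPolynomial.eval (Sum.elim w.1 w.2) f₂ := (MvPolynomial.continuous_eval f₂).comp cse
  -- a uniform positive lower bound
  obtain ⟨c, hc, hcf⟩ : ∃ c : ℝ, 0 < c ∧ ∀ x ∈ Kx, ∀ w ∈ Kyz,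
      c ≤ MvPolynomial.eval (Sum.elim x w.1) f₁ + MvPolynomial.eval (Sum.elim w.1 w.2) f₂ := by
    have hcomp : IsCompact (Kx ×ˢ Kyz) := hKxCompact.prod hKyzCompact
    have hcont : Continuous fun v : (Fin n → ℝ) × (Fin m → ℝ) × (Fin p → ℝ) =>
        MvPolynomial.eval (Sum.elim v.1 v.2.1) f₁ + MvPolynomial.eval (Sum.elim v.2.1 v.2.2) f₂ :=
      (c1.comp (continuous_fst.prodMk (continuous_fst.comp continuous_snd))).add
        (c2.comp continuous_snd)
    obtain ⟨v, hv, hmin⟩ := hcomp.exists_isMinOn ⟨(x₀, w₀), hx₀, hw₀⟩ hcont.continuousOn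
    refine ⟨_, ?_, fun x hx w hw => hmin (Set.mk_mem_prod hx hw)⟩
    have := hpos v ⟨hv.1, hv.2⟩
    rwa [hev] at this
  let φ : (Fin m → ℝ) → ℝ := fun y => sInf ((fun x => MvPolynomial.eval (Sum.elim x y) f₁) '' Kx)
  have hφc : Continuous φ :=
    hKxCompact.continuous_sInf (f := fun y x => MvPolynomial.eval (Sum.elim x y) f₁)
      (c1.comp (continuous_snd.prodMk continuous_fst))
  have hc1y : ∀ y : Fin m → ℝ, Continuous fun x => MvPolynomial.eval (Sum.elim x y) f₁ :=
    fun y => c1.comp (continuous_id.prodMk continuous_const)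
  have hφle : ∀ x ∈ Kx, ∀ y, φ y ≤ MvPolynomial.eval (Sum.elim x y) f₁ := fun x hx y =>
    csInf_le (hKxCompact.bddBelow_image (hc1y y).continuousOn) ⟨x, hx, rfl⟩
  have hφge : ∀ w ∈ Kyz, c ≤ φ w.1 + MvPolynomial.eval (Sum.elim w.1 w.2) f₂ := by
    intro w hw
    have : c - MvPolynomial.eval (Sum.elim w.1 w.2) f₂ ≤ φ w.1 := by
      refine le_csInf ⟨_, x₀, hx₀, rfl⟩ ?_
      rintro _ ⟨x, hx, rfl⟩
      have := hcf x hx w hw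
      dsimp only
      linarith
    linarith
  let Ky : Set (Fin m → ℝ) := Prod.fst '' Kyz
  have hKy : IsCompact Ky := hKyzCompact.image continuous_fst
  obtain ⟨u, hu⟩ := mv_sw hKy (φ := fun y => φ y - c / 2)
    (hφc.sub continuous_const).continuousOn (show 0 < c / 4 by positivity)
  obtain ⟨k, σ, ψ, hk, hσ, hψ, e⟩ := split_pos hKxCompact hKy
    (f₁ - MvPolynomial.rename Sum.inr u) (show 0 < c / 4 by positivity) (by
      intro x hx y hy
      rw [map_sub, MvPolynomial.eval_rename, Sum.elim_comp_inr]
      have h1 := (abs_lt.1 (hu y hy)).2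
      have h2 := hφle x hx y
      linarith)
  have hcomp' : IsCompact {v : Fin m ⊕ Fin p → ℝ | ∀ k, 0 ≤ MvPolynomial.eval v (h k)} := by
    have := hKyzCompact.image (cse (A := Fin m) (B := Fin p))
    convert this using 1
    ext v
    constructor
    · intro hv
      have hve : Sum.elim (v ∘ Sum.inl) (v ∘ Sum.inr) = v := Sum.elim_comp_inl_inr v
      refine ⟨(v ∘ Sum.inl, v ∘ Sum.inr), ?_, hve⟩
      intro k
      dsimp only
      rw [hve]
      exact hv k
    · rintro ⟨w, hw, rfl⟩
      exact hw
  refine ⟨k, σ, MvPolynomial.rename Sum.inl (ψ + u) + f₂, isSOS_iff.2 hk,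
    schmudgen g hKxCompact σ hσ, schmudgen h hcomp' _ ?_, ?_⟩
  · intro v hv
    have hve : Sum.elim (v ∘ Sum.inl) (v ∘ Sum.inr) = v := Sum.elim_comp_inl_inr v
    have hw : ((v ∘ Sum.inl, v ∘ Sum.inr) : (Fin m → ℝ) × (Fin p → ℝ)) ∈ Kyz := by
      intro k
      dsimp only
      rw [hve]
      exact hv k
    have hy : v ∘ Sum.inl ∈ Ky := ⟨_, hw, rfl⟩
    have h1 := hφge _ hw
    dsimp only at h1
    rw [hve] at h1
    have h2 := (abs_lt.1 (hu _ hy)).1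
    have h3 := hψ _ hy
    rw [map_add, MvPolynomial.eval_rename, map_add]
    linarith
  · have e1 : f₁ = k + MvPolynomial.rename Sum.inl σ + MvPolynomial.rename Sum.inr ψ +
        MvPolynomial.rename Sum.inr u := by rw [← e]; ring
    rw [hf, e1]
    simp only [map_add, MvPolynomial.rename_rename]
    have r1 : (Sum.map id Sum.inl : Fin n ⊕ Fin m → Fin n ⊕ Fin m ⊕ Fin p) ∘ Sum.inl = Sum.inl := rfl
    have r2 : (Sum.map id Sum.inl : Fin n ⊕ Fin m → Fin n ⊕ Fin m ⊕ Fin p) ∘ Sum.inr =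
      Sum.inr ∘ Sum.inl := rfl
    rw [r1, r2]
    ring
end

section
/- Let K_x ⊂ ℝ^n and K_yz ⊂ ℝ^{m+p} be compact, and assume K = K_x × K_yz ⊂ ℝ^{n+m+p} has nonempty interior. Suppose there exist scalars N, N' ∈ ℝ such that N − ‖X‖² ∈ Q(g) and N' − ‖(Y,Z)‖² ∈ Q(h). If f ∈ ℝ[X,Y] + ℝ[Y,Z] and f(x,y,z) > 0 for all (x,y,z) ∈ K, then f ∈ Σ²_xy + Q(g) + Q(h), i.e. f = κ + σ + ψ for some sum of squares κ ∈ Σ²_xy, some σ ∈ Q(g) and some ψ ∈ Q(h). -/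
open MvPolynomial

lemma aux_mv_approx {ι : Type*} {K : Set (ι → ℝ)} (hK : IsCompact K)
    {φ : (ι → ℝ) → ℝ} (hφ : Continuous φ) {ε : ℝ} (hε : 0 < ε) :
    ∃ p : MvPolynomial ι ℝ, ∀ x ∈ K, |eval x p - φ x| < ε := by
  let Φ : MvPolynomial ι ℝ →ₐ[ℝ] C(ι → ℝ, ℝ) :=
    aeval (fun i => (⟨fun x => x i, continuous_apply i⟩ : C(ι → ℝ, ℝ)))
  have hΦ : ∀ p x, Φ p x = eval x p := by
    intro p x
    induction p using MvPolynomial.induction_on with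
    | C a => simp [Φ]
    | add p q hp hq => simp [hp, hq]
    | mul_X p i hp => simp only [map_mul, ContinuousMap.mul_apply, hp]; simp [Φ]
  have hsep : Φ.range.SeparatesPoints := by
    intro x y hxy
    obtain ⟨i, hi⟩ := Function.ne_iff.mp hxy
    refine ⟨_, ⟨Φ (X i), ⟨X i, rfl⟩, rfl⟩, ?_⟩
    simpa [hΦ] using hi
  obtain ⟨g, ⟨p, rfl⟩, hp⟩ :=
    ContinuousMap.exists_mem_subalgebra_near_continuous_of_isCompact_of_separatesPoints hsep
      ⟨φ, hφ⟩ hK hε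
  refine ⟨p, fun x hx => ?_⟩
  have := hp x hx
  rw [Real.norm_eq_abs] at this
  erw [hΦ] at this
  exact this

lemma aux_mv_sq_approx {ι : Type*} {K : Set (ι → ℝ)} (hK : IsCompact K)
    {φ : (ι → ℝ) → ℝ} (hφ : Continuous φ) (h0 : ∀ x ∈ K, 0 ≤ φ x) {ε : ℝ} (hε : 0 < ε) :
    ∃ p : MvPolynomial ι ℝ, ∀ x ∈ K, |φ x - eval x p ^ 2| < ε := by
  obtain ⟨S, hS⟩ := hK.exists_bound_of_continuousOn (hφ.sqrt.continuousOn)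
  set T := max S 0 with hT
  have hT0 : 0 ≤ T := le_max_right _ _
  obtain ⟨δ, hδ, hδ1, hδ2⟩ : ∃ δ : ℝ, 0 < δ ∧ δ ≤ 1 ∧ δ * (2 * T + 1) ≤ ε := by
    refine ⟨min 1 (ε / (2 * T + 1)), by positivity, min_le_left _ _, ?_⟩
    calc _ ≤ (ε / (2 * T + 1)) * (2 * T + 1) := by gcongr; exact min_le_right _ _
      _ = ε := by field_simp
  obtain ⟨p, hp⟩ := aux_mv_approx hK hφ.sqrt hδ
  refine ⟨p, fun x hx => ?_⟩
  have h1 := hp x hx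
  have h2 : √(φ x) ≤ T := by
    have := hS x hx
    rw [Real.norm_eq_abs] at this
    exact (le_abs_self _).trans (this.trans (le_max_left _ _))
  have h3 := Real.sqrt_nonneg (φ x)
  have h4 : φ x = √(φ x) ^ 2 := (Real.sq_sqrt (h0 x hx)).symm
  set s := √(φ x)
  rw [h4]
  have h5 : s ^ 2 - eval x p ^ 2 = -((eval x p - s) * (eval x p + s)) := by ring
  rw [h5, abs_neg, abs_mul]
  have h6 : |eval x p + s| ≤ 2 * T + 1 := by
    rw [abs_lt] at h1; rw [abs_le]; constructor <;> linarith
  calc _ ≤ |eval x p - s| * (2 * T + 1) := by gcongr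
    _ < δ * (2 * T + 1) := by gcongr
    _ ≤ ε := hδ2

lemma aux_uni_sq_approx (c : ℝ) (p : Polynomial ℝ)
    (h0 : ∀ t, |t| ≤ c → 0 ≤ p.eval t) {ε : ℝ} (hε : 0 < ε) :
    ∃ u : Polynomial ℝ, ∀ t, |t| ≤ c → |p.eval t - u.eval t ^ 2| < ε := by
  have hK : IsCompact (Set.univ.pi fun _ : Unit => Set.Icc (-c) c) :=
    isCompact_univ_pi fun _ => isCompact_Icc
  obtain ⟨q, hq⟩ := aux_mv_sq_approx hK (φ := fun x => p.eval (x ())) (by fun_prop)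
    (fun x hx => h0 _ (abs_le.mpr (hx () trivial))) hε
  refine ⟨aeval (fun _ => Polynomial.X) q, fun t ht => ?_⟩
  have := hq (fun _ => t) (fun _ _ => abs_le.mp ht)
  convert this using 4
  clear this hq
  induction q using MvPolynomial.induction_on with
  | C a => simp
  | add p q hp hq => simp [hp, hq]
  | mul_X p i hp => simp [hp]

lemma aux_sumsq_C {A : Type*} [CommRing A] [Algebra ℝ A] {r : ℝ} (hr : 0 ≤ r) :
    IsSumSq (algebraMap ℝ A r) := by
  have : algebraMap ℝ A r = algebraMap ℝ A (√r) * algebraMap ℝ A (√r) := by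
    rw [← map_mul, Real.mul_self_sqrt hr]
  rw [this]; exact IsSumSq.mul_self _

lemma aux_sumsq_sq {A : Type*} [CommRing A] (x : A) : IsSumSq (x ^ 2) := by
  rw [sq]; exact IsSumSq.mul_self _

lemma aux_sumsq_map {A B : Type*} [CommRing A] [CommRing B] (φ : A →+* B) {x : A}
    (hx : IsSumSq x) : IsSumSq (φ x) := by
  induction hx with
  | zero => simp
  | sq_add a hs ih => rw [map_add, map_mul]; exact IsSumSq.sq_add _ ih

/-- truncated preordering of the interval -/
def AuxT (c : ℝ) (p : Polynomial ℝ) : Prop :=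
  ∃ s t : Polynomial ℝ, IsSumSq s ∧ IsSumSq t ∧
    p = s + t * (Polynomial.C (c ^ 2) - Polynomial.X ^ 2)

lemma AuxT.mul {c : ℝ} {p q : Polynomial ℝ} (hp : AuxT c p) (hq : AuxT c q) :
    AuxT c (p * q) := by
  obtain ⟨s, t, hs, ht, rfl⟩ := hp
  obtain ⟨s', t', hs', ht', rfl⟩ := hq
  refine ⟨s * s' + t * t' * (Polynomial.C (c ^ 2) - Polynomial.X ^ 2) ^ 2, s * t' + t * s',
    (hs.mul hs').add ((ht.mul ht').mul (aux_sumsq_sq _)), (hs.mul ht').add (ht.mul hs'), by ring⟩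

lemma AuxT.const {c r : ℝ} (hr : 0 ≤ r) : AuxT c (Polynomial.C r) :=
  ⟨Polynomial.C r, 0, aux_sumsq_C hr, IsSumSq.zero, by simp⟩

lemma AuxT.lin {c a b : ℝ} (hc : 0 < c) (h1 : 0 < a * c + b) (h2 : 0 < a * (-c) + b) :
    AuxT c (Polynomial.C a * Polynomial.X + Polynomial.C b) := by
  have key : ∀ e : ℝ, (e = 1 ∨ e = -1) → 0 ≤ e * a →
      AuxT c (Polynomial.C a * Polynomial.X + Polynomial.C b) := by
    intro e he hea
    have hb : 0 ≤ b - e * a * c := by rcases he with rfl | rfl <;> linarith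
    have he2 : e * e = 1 := by rcases he with rfl | rfl <;> norm_num
    refine ⟨Polynomial.C (b - e * a * c) +
      Polynomial.C (e * a / (2 * c)) * (Polynomial.X + Polynomial.C (e * c)) ^ 2,
      Polynomial.C (e * a / (2 * c)), (aux_sumsq_C hb).add
        ((aux_sumsq_C (by positivity)).mul (aux_sumsq_sq _)), aux_sumsq_C (by positivity), ?_⟩
    apply Polynomial.funext
    intro t
    simp
    have : e ^ 2 = 1 := by rw [sq, he2]
    field_simp
    ring_nf
    have e3 : e ^ 3 = e := by rw [pow_succ, this, one_mul]
    simp only [this, e3]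
    ring
  rcases le_total 0 a with ha | ha
  · exact key 1 (Or.inl rfl) (by linarith)
  · exact key (-1) (Or.inr rfl) (by linarith)

lemma aux_const_sign {c : ℝ} {p : Polynomial ℝ} (hp : ∀ t, |t| ≤ c → p.eval t ≠ 0) :
    (∀ t, |t| ≤ c → 0 < p.eval t) ∨ (∀ t, |t| ≤ c → p.eval t < 0) := by
  by_contra! hcon
  obtain ⟨⟨s, hs, hs'⟩, ⟨t, ht, ht'⟩⟩ := hcon
  have hconn : IsPreconnected (Set.Icc (-c) c) := isPreconnected_Icc
  obtain ⟨r, hr, hr'⟩ := hconn.intermediate_value (abs_le.mp hs) (abs_le.mp ht)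
    (f := fun t => p.eval t) p.continuous.continuousOn (show (0:ℝ) ∈ _ from ⟨hs', ht'⟩)
  exact hp r (abs_le.mpr hr) hr'

lemma AuxT.small {c : ℝ} (hc : 0 < c) {q : Polynomial ℝ} (hq : q.degree ≤ 2)
    (hirr : Irreducible q) (hpos : ∀ t, |t| ≤ c → 0 < q.eval t) : AuxT c q := by
  have hcc : |c| ≤ c := (abs_of_pos hc).le
  have hcn : |-c| ≤ c := by rw [abs_neg]; exact hcc
  by_cases h2 : q.degree = 2
  ·
    have hroot : ∀ t, q.eval t ≠ 0 := by
      intro t ht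
      have := Polynomial.degree_eq_one_of_irreducible_of_root hirr ht
      rw [h2] at this; exact absurd this (by decide)
    obtain ⟨a, b, d, ha, rfl⟩ : ∃ a b d : ℝ, a ≠ 0 ∧
        q = Polynomial.C a * Polynomial.X ^ 2 + Polynomial.C b * Polynomial.X + Polynomial.C d := by
      refine ⟨q.coeff 2, q.coeff 1, q.coeff 0, ?_, Polynomial.eq_quadratic_of_degree_le_two hq⟩
      have : q.natDegree = 2 := Polynomial.natDegree_eq_of_degree_eq_some h2
      rw [← this]
      exact Polynomial.leadingCoeff_ne_zero.mpr hirr.ne_zero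
    simp at hroot hpos
    have hd : 0 < d := by simpa using hpos 0 (by simpa using hc.le)
    have hdisc : b ^ 2 - 4 * a * d < 0 := by
      by_contra! hge
      refine hroot ((-b + √(b ^ 2 - 4 * a * d)) / (2 * a)) ?_
      have := Real.sq_sqrt hge
      generalize √(b ^ 2 - 4 * a * d) = s at this
      field_simp
      linear_combination this
    have ha' : 0 < a := by nlinarith [sq_nonneg b]
    refine ⟨Polynomial.C a * (Polynomial.X + Polynomial.C (b / (2 * a))) ^ 2 +
      Polynomial.C (d - b ^ 2 / (4 * a)), 0, ?_, IsSumSq.zero, ?_⟩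
    · refine ((aux_sumsq_C ha'.le).mul (aux_sumsq_sq _)).add (aux_sumsq_C ?_)
      rw [sub_nonneg, div_le_iff₀ (by positivity)]; linarith
    · apply Polynomial.funext
      intro t
      simp
      field_simp
      ring
  · have h1 : q.degree ≤ 1 := by
      have h3 : q.degree < 2 := lt_of_le_of_ne hq h2
      rw [Polynomial.degree_eq_natDegree hirr.ne_zero] at h3 ⊢
      norm_cast at h3 ⊢
      omega
    rw [Polynomial.eq_X_add_C_of_degree_le_one h1] at hpos ⊢
    simp at hpos
    exact AuxT.lin hc (hpos c hcc) (by simpa using hpos (-c) hcn)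

lemma aux_uni_pos {c : ℝ} (hc : 0 < c) (p : Polynomial ℝ)
    (hpos : ∀ t, |t| ≤ c → 0 < p.eval t) : AuxT c p := by
  have h0c : |(0:ℝ)| ≤ c := by simpa using hc.le
  induction hn : p.natDegree using Nat.strong_induction_on generalizing p with
  | _ n ih =>
  have hp0 : p ≠ 0 := by rintro rfl; simpa using hpos 0 h0c
  by_cases hu : IsUnit p
  · obtain ⟨r, hr, rfl⟩ := Polynomial.isUnit_iff.mp hu
    exact AuxT.const (by simpa using (hpos 0 h0c).le)
  · obtain ⟨q, hq, r, rfl⟩ := WfDvdMonoid.exists_irreducible_factor hu hp0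
    have hr0 : r ≠ 0 := right_ne_zero_of_mul hp0
    have hqd : 0 < q.natDegree := by
      rw [Nat.pos_iff_ne_zero]; intro h
      apply hq.not_isUnit
      rw [Polynomial.eq_C_of_natDegree_eq_zero h] at hq ⊢
      rw [Polynomial.isUnit_C]
      exact isUnit_iff_ne_zero.mpr fun h => hq.ne_zero (by rw [h]; simp)
    have hdeg : r.natDegree < n := by
      rw [← hn, Polynomial.natDegree_mul hq.ne_zero hr0]; omega
    simp only [Polynomial.eval_mul] at hpos
    have hqz : ∀ t, |t| ≤ c → q.eval t ≠ 0 := fun t ht h => by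
      have := hpos t ht; rw [h] at this; simp at this
    have hq2 := hq.degree_le_two
    rcases aux_const_sign hqz with h | h
    · exact (AuxT.small hc hq2 hq h).mul
        (ih _ hdeg r (fun t ht => (pos_iff_pos_of_mul_pos (hpos t ht)).mp (h t ht)) rfl)
    · rw [← neg_mul_neg]
      refine (AuxT.small hc (by rwa [Polynomial.degree_neg]) ((Associated.refl q).neg_right.irreducible hq) (fun t ht => by
        simpa using h t ht)).mul
        (ih _ (by rwa [Polynomial.natDegree_neg]) (-r) (fun t ht => ?_) rfl)
      simp only [Polynomial.eval_neg]
      nlinarith [hpos t ht, h t ht]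

def AuxBox (c : ℝ) (ι : Type*) : Set (ι → ℝ) := {x | ∀ i, |x i| ≤ c}

lemma aux_box_compact (c : ℝ) (ι : Type*) : IsCompact (AuxBox c ι) := by
  have : AuxBox c ι = Set.univ.pi fun _ => Set.Icc (-c) c := by
    ext x; simp only [AuxBox, Set.mem_ofPred_eq, Set.mem_univ_pi, Set.mem_Icc, abs_le]
  rw [this]
  exact isCompact_univ_pi fun _ => isCompact_Icc

lemma aux_mv_cont {ι : Type*} (p : MvPolynomial ι ℝ) : Continuous fun x => eval x p :=
  MvPolynomial.continuous_eval p

lemma aux_mv_bound {ι : Type*} (c : ℝ) (p : MvPolynomial ι ℝ) :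
    ∃ M : ℝ, 0 < M ∧ ∀ x ∈ AuxBox c ι, |eval x p| ≤ M := by
  obtain ⟨S, hS⟩ := (aux_box_compact c ι).exists_bound_of_continuousOn (aux_mv_cont p).continuousOn
  exact ⟨max S 1, by positivity, fun x hx => (hS x hx).trans (le_max_left _ _)⟩

lemma aux_uni_bound (c : ℝ) (p : Polynomial ℝ) :
    ∃ M : ℝ, 0 < M ∧ ∀ t, |t| ≤ c → |p.eval t| ≤ M := by
  obtain ⟨S, hS⟩ := (isCompact_Icc (a := -c) (b := c)).exists_bound_of_continuousOn
    p.continuous.continuousOn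
  exact ⟨max S 1, by positivity, fun x hx => (hS x (abs_le.mp hx)).trans (le_max_left _ _)⟩

lemma aux_bernstein (c : ℝ) (hc : 0 < c) (L : ℕ) {ε : ℝ} (hε : 0 < ε) :
    ∃ (n : ℕ) (p : Fin (n + 1) → Polynomial ℝ) (t : Fin (n + 1) → ℝ), (∀ k, |t k| ≤ c) ∧
      (∀ k τ, |τ| ≤ c → 0 ≤ (p k).eval τ) ∧
      ∀ a ∈ Finset.range L, ∀ τ, |τ| ≤ c → |τ ^ a - ∑ k, t k ^ a * (p k).eval τ| ≤ ε := by
  let φ : ℕ → C(unitInterval, ℝ) := fun a => ⟨fun τ => (2 * c * τ - c) ^ a, by fun_prop⟩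
  have hev : ∀ᶠ n : ℕ in Filter.atTop, ∀ a ∈ Finset.range L,
      ‖bernsteinApproximation n (φ a) - φ a‖ < ε := by
    rw [Finset.eventually_all]
    intro a _
    have := bernsteinApproximation_uniform (φ a)
    rw [Metric.tendsto_nhds] at this
    simpa [dist_eq_norm] using this ε hε
  obtain ⟨n, hn⟩ := hev.exists
  have hmem : ∀ τ, |τ| ≤ c → (τ + c) / (2 * c) ∈ unitInterval := by
    intro τ hτ
    rw [abs_le] at hτ
    constructor
    · apply div_nonneg <;> linarith
    · rw [div_le_one (by positivity)]; linarith
  have hB : ∀ (k : Fin (n + 1)) τ (hτ : |τ| ≤ c), ((bernsteinPolynomial ℝ n k).comp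
      (Polynomial.C (1 / (2 * c)) * (Polynomial.X + Polynomial.C c))).eval τ
      = bernstein n k ⟨_, hmem τ hτ⟩ := by
    intro k τ hτ
    simp only [bernstein, Polynomial.eval_comp, Polynomial.toContinuousMapOn_apply,
      Polynomial.toContinuousMap_apply]
    congr 1
    simp
    field_simp
  refine ⟨n, fun k => (bernsteinPolynomial ℝ n k).comp
      (Polynomial.C (1 / (2 * c)) * (Polynomial.X + Polynomial.C c)),
      fun k => 2 * c * (bernstein.z k : ℝ) - c, ?_, ?_, ?_⟩
  · intro k
    have h1 := (bernstein.z k).2.1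
    have h2 := (bernstein.z k).2.2
    rw [abs_le]; constructor <;> nlinarith
  · intro k τ hτ
    rw [hB k τ hτ]
    exact bernstein_nonneg
  · intro a ha τ hτ
    have h1 := hn a ha
    have h2 := ContinuousMap.norm_coe_le_norm (bernsteinApproximation n (φ a) - φ a)
      ⟨_, hmem τ hτ⟩
    have h3 := h2.trans h1.le
    rw [Real.norm_eq_abs] at h3
    rw [abs_sub_comm]
    refine le_trans (le_of_eq ?_) h3
    rw [ContinuousMap.sub_apply]
    congr 2
    · simp only [bernsteinApproximation, ContinuousMap.sum_apply]
      refine Finset.sum_congr rfl fun k _ => ?_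
      rw [hB k τ hτ]
      simp [φ, mul_comm]
    · simp only [φ, ContinuousMap.coe_mk]
      congr 1
      field_simp
      ring

section block
variable {σ : Type*} {c : ℝ}

def AuxD (c : ℝ) (G : MvPolynomial (Option σ) ℝ) : Prop :=
  ∃ (s : MvPolynomial (Option σ) ℝ) (a : Polynomial ℝ) (b : MvPolynomial σ ℝ),
    IsSumSq s ∧ (∀ t, |t| ≤ c → 0 < a.eval t) ∧ (∀ y ∈ AuxBox c σ, 0 < eval y b) ∧
    G = s + Polynomial.aeval (X none) a + rename some b

lemma AuxD.add {G H : MvPolynomial (Option σ) ℝ} (hG : AuxD c G) (hH : AuxD c H) :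
    AuxD c (G + H) := by
  obtain ⟨s, a, b, hs, ha, hb, rfl⟩ := hG
  obtain ⟨s', a', b', hs', ha', hb', rfl⟩ := hH
  refine ⟨s + s', a + a', b + b', hs.add hs', fun t ht => ?_, fun y hy => ?_, ?_⟩
  · simpa using add_pos (ha t ht) (ha' t ht)
  · simpa using add_pos (hb y hy) (hb' y hy)
  · simp only [map_add]; ring

lemma AuxD.add_sos {s G : MvPolynomial (Option σ) ℝ} (h : IsSumSq s) (hG : AuxD c G) :
    AuxD c (s + G) := by
  obtain ⟨s', a, b, hs, ha, hb, rfl⟩ := hG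
  exact ⟨s + s', a, b, h.add hs, ha, hb, by ring⟩

lemma AuxD.const {η : ℝ} (hη : 0 < η) : AuxD c (C η : MvPolynomial (Option σ) ℝ) := by
  refine ⟨0, Polynomial.C (η / 2), C (η / 2), IsSumSq.zero, ?_, ?_, ?_⟩
  · intro t _; simpa using hη
  · intro t _; simpa using hη
  · rw [Polynomial.aeval_C, rename_C, algebraMap_eq, zero_add, ← C_add]; congr 1; ring

lemma AuxD.sum {β : Type*} (S : Finset β) {G : β → MvPolynomial (Option σ) ℝ} {η : ℝ} (hη : 0 < η)
    (h : ∀ k ∈ S, AuxD c (G k + C (η / (S.card + 1)))) :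
    AuxD c (∑ k ∈ S, G k + C η) := by
  have key : ∀ (δ : ℝ), 0 < δ → (∀ k ∈ S, AuxD c (G k + C δ)) →
      AuxD c (∑ k ∈ S, G k + C ((S.card + 1) * δ)) := by
    clear h
    classical
    intro δ hδ h
    induction S using Finset.induction_on with
    | empty => simpa using AuxD.const hδ
    | insert k S hk ih =>
      have h1 := ih (fun j hj => h j (Finset.mem_insert_of_mem hj))
      have h2 := h k (Finset.mem_insert_self _ _)
      convert h2.add h1 using 1
      rw [Finset.sum_insert hk, Finset.card_insert_of_notMem hk]
      push_cast
      simp only [C_mul, C_add, C_1]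
      ring
  have h1 := key _ (by positivity) h
  convert h1 using 3
  field_simp

lemma AuxD.small {s : Polynomial ℝ} {r : MvPolynomial σ ℝ} {ε M η : ℝ} (hε : 0 < ε) (hM : 0 < M)
    (hη : ε * M < η) (hs : ∀ t, |t| ≤ c → |s.eval t| ≤ ε)
    (hr : ∀ y ∈ AuxBox c σ, |eval y r| ≤ M) :
    AuxD c (Polynomial.aeval (X none) s * rename some r + C η : MvPolynomial (Option σ) ℝ) := by
  set l := √(M / ε) with hl
  have hl0 : 0 < l := Real.sqrt_pos.mpr (by positivity)
  have hl2 : l ^ 2 = M / ε := Real.sq_sqrt (by positivity)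
  refine ⟨C (1 / 2) * (C l * Polynomial.aeval (X none) s + C l⁻¹ * rename some r) ^ 2,
    Polynomial.C (η / 2) - Polynomial.C (1 / 2) * (Polynomial.C l * s) ^ 2,
    C (η / 2) - C (1 / 2) * (C l⁻¹ * r) ^ 2, ?_, ?_, ?_, ?_⟩
  · exact (aux_sumsq_C (by norm_num)).mul (aux_sumsq_sq _)
  · intro t ht
    simp only [Polynomial.eval_sub, Polynomial.eval_C, Polynomial.eval_mul, Polynomial.eval_pow]
    have h1 : s.eval t ^ 2 ≤ ε ^ 2 := sq_le_sq' (abs_le.mp (hs t ht)).1 (abs_le.mp (hs t ht)).2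
    have h2 : (l * s.eval t) ^ 2 ≤ ε * M := by
      rw [mul_pow, hl2]
      calc M / ε * s.eval t ^ 2 ≤ M / ε * ε ^ 2 := by gcongr
        _ = _ := by field_simp
    linarith
  · intro y hy
    simp only [map_sub, eval_C, map_mul, map_pow]
    have h1 : eval y r ^ 2 ≤ M ^ 2 := sq_le_sq' (abs_le.mp (hr y hy)).1 (abs_le.mp (hr y hy)).2
    have h2 : (l⁻¹ * eval y r) ^ 2 ≤ ε * M := by
      rw [mul_pow, inv_pow, hl2]
      calc (M / ε)⁻¹ * eval y r ^ 2 ≤ (M / ε)⁻¹ * M ^ 2 := by gcongr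
        _ = _ := by field_simp
    linarith
  · simp only [map_sub, map_mul, map_pow, Polynomial.aeval_C, rename_C, algebraMap_eq]
    have h1 : (C l * C l⁻¹ : MvPolynomial (Option σ) ℝ) = 1 := by
      rw [← C_mul, mul_inv_cancel₀ hl0.ne', C_1]
    have h2 : (C (1 / 2) * 2 : MvPolynomial (Option σ) ℝ) = 1 := by
      rw [show (2 : MvPolynomial (Option σ) ℝ) = C 2 from rfl, ← C_mul, ← C_1]
      norm_num
    have h3 : (C η : MvPolynomial (Option σ) ℝ) = C (η / 2) + C (η / 2) := by
      rw [← C_add]; congr 1; ring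
    have h4 : (C (1 / 2) * 2 * (C l * C l⁻¹) : MvPolynomial (Option σ) ℝ) = 1 := by
      rw [h1, h2, one_mul]
    rw [h3]
    linear_combination (-(Polynomial.aeval (X none) s * rename some r)) * h4

lemma AuxD.prod {p : Polynomial ℝ} {r : MvPolynomial σ ℝ} (hp : ∀ t, |t| ≤ c → 0 ≤ p.eval t)
    (hr : ∀ y ∈ AuxBox c σ, 0 ≤ eval y r) {η : ℝ} (hη : 0 < η) :
    AuxD c (Polynomial.aeval (X none) p * rename some r + C η : MvPolynomial (Option σ) ℝ) := by
  obtain ⟨M, hM, hM'⟩ := aux_mv_bound c r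
  obtain ⟨u, hu⟩ := aux_uni_sq_approx c p hp (ε := η / (4 * M)) (by positivity)
  obtain ⟨U, hU, hU'⟩ := aux_uni_bound c (u ^ 2)
  obtain ⟨v, hv⟩ := aux_mv_sq_approx (aux_box_compact c σ) (aux_mv_cont r) hr
    (ε := η / (4 * U)) (by positivity)
  have h1 : AuxD c (Polynomial.aeval (X none) (p - u ^ 2) * rename some r + C (η / 2) :
      MvPolynomial (Option σ) ℝ) := by
    refine AuxD.small (ε := η / (4 * M)) (M := M) (by positivity) hM ?_ ?_ hM'
    · field_simp; linarith
    · intro t ht; simpa using (hu t ht).le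
  have h2 : AuxD c (Polynomial.aeval (X none) (u ^ 2) * rename some (r - v ^ 2) + C (η / 2) :
      MvPolynomial (Option σ) ℝ) := by
    refine AuxD.small (ε := U) (M := η / (4 * U)) hU (by positivity) ?_ hU' ?_
    · field_simp; linarith
    · intro t ht; simpa using (hv t ht).le
  convert AuxD.add_sos (aux_sumsq_sq (Polynomial.aeval (X none) u * rename some v :
    MvPolynomial (Option σ) ℝ)) (h1.add h2) using 1
  have h3 : (C η : MvPolynomial (Option σ) ℝ) = C (η / 2) + C (η / 2) := by
    rw [← C_add]; congr 1; ring
  rw [h3]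
  simp only [map_sub, map_pow]
  ring

lemma aux_decomp (F : MvPolynomial (Option σ) ℝ) :
    ∃ (L : ℕ) (Fa : ℕ → MvPolynomial σ ℝ),
      F = ∑ a ∈ Finset.range L, X none ^ a * rename some (Fa a) := by
  have hC : ∀ q : MvPolynomial σ ℝ,
      (optionEquivLeft ℝ σ).symm (Polynomial.C q) = rename some q := by
    intro q
    rw [AlgEquiv.symm_apply_eq]
    induction q using MvPolynomial.induction_on with
    | C a => simp [optionEquivLeft_C]
    | add p q hp hq => simp [hp, hq]
    | mul_X p i hp => simp [hp]
  refine ⟨(optionEquivLeft ℝ σ F).natDegree + 1, fun a => (optionEquivLeft ℝ σ F).coeff a, ?_⟩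
  conv_lhs => rw [← (optionEquivLeft ℝ σ).symm_apply_apply F,
    Polynomial.as_sum_range_C_mul_X_pow (optionEquivLeft ℝ σ F)]
  rw [map_sum]
  refine Finset.sum_congr rfl fun a _ => ?_
  rw [map_mul, map_pow, hC, optionEquivLeft_symm_X, mul_comm]

lemma aux_two_block (hc : 0 < c) (F : MvPolynomial (Option σ) ℝ)
    (hF : ∀ x ∈ AuxBox c (Option σ), 0 < eval x F) : AuxD c F := by
  have h0 : (fun _ => 0 : Option σ → ℝ) ∈ AuxBox c (Option σ) := fun _ => by simpa using hc.le
  obtain ⟨x₀, hx₀, hmin⟩ := (aux_box_compact c (Option σ)).exists_isMinOn ⟨_, h0⟩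
    (aux_mv_cont F).continuousOn
  set η := eval x₀ F / 2 with hη
  have hη0 : 0 < η := half_pos (hF x₀ hx₀)
  obtain ⟨L, Fa, hFa⟩ := aux_decomp (F - C (2 * η))
  have hbd : ∃ M : ℝ, 0 < M ∧ ∀ a ∈ Finset.range L, ∀ y ∈ AuxBox c σ, |eval y (Fa a)| ≤ M := by
    choose M hM hM' using fun a => aux_mv_bound c (Fa a)
    refine ⟨1 + ∑ a ∈ Finset.range L, M a, ?_, fun a ha y hy => ?_⟩
    · have := Finset.sum_nonneg (s := Finset.range L) (fun a _ => (hM a).le)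
      linarith
    · have := Finset.single_le_sum (f := M) (fun a _ => (hM a).le) ha
      linarith [hM' a y hy]
  obtain ⟨M, hM, hMb⟩ := hbd
  obtain ⟨n, p, t, ht, hp, happ⟩ := aux_bernstein c hc L
    (ε := η / (2 * (L + 1) * M)) (by positivity)
  have hslice : ∀ k, ∀ y ∈ AuxBox c σ,
      0 ≤ eval y (∑ a ∈ Finset.range L, C (t k ^ a) * Fa a) := by
    intro k y hy
    have hx : (fun o : Option σ => o.elim (t k) y) ∈ AuxBox c (Option σ) := by
      rintro (_ | i)
      · exact ht k
      · exact hy i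
    have h1 := hmin hx
    have h2 := congrArg (eval fun o : Option σ => o.elim (t k) y) hFa
    simp only [map_sub, eval_C, map_sum, map_mul, map_pow, eval_X, eval_rename, Option.elim,
      Function.comp_def] at h2
    simp only [map_sum, map_mul, eval_C]
    have h3 : eval x₀ F ≤ eval (fun o : Option σ => o.elim (t k) y) F := h1
    simp only [Option.elim] at h3
    rw [← h2]
    linarith
  have hG1 : AuxD c (∑ k, Polynomial.aeval (X none) (p k) *
      rename some (∑ a ∈ Finset.range L, C (t k ^ a) * Fa a) + C η :
      MvPolynomial (Option σ) ℝ) :=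
    AuxD.sum Finset.univ hη0 fun k _ => AuxD.prod (hp k) (hslice k) (by positivity)
  have hG2 : AuxD c (∑ a ∈ Finset.range L, Polynomial.aeval (X none)
      (Polynomial.X ^ a - ∑ k, Polynomial.C (t k ^ a) * p k) * rename some (Fa a) + C η :
      MvPolynomial (Option σ) ℝ) := by
    refine AuxD.sum _ hη0 fun a ha => AuxD.small (ε := η / (2 * (L + 1) * M)) (by positivity) hM
      ?_ ?_ (hMb a ha)
    · rw [Finset.card_range]; field_simp; linarith
    · intro τ hτ
      simpa [Polynomial.eval_finsetSum] using happ a ha τ hτ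
  convert hG1.add hG2 using 1
  rw [show F = (F - C (2 * η)) + C (2 * η) by ring, hFa,
    show (C (2 * η) : MvPolynomial (Option σ) ℝ) = C η + C η by rw [← C_add]; congr 1; ring]
  simp only [map_sum, map_mul, map_sub, map_pow, Polynomial.aeval_X, Polynomial.aeval_C, rename_C,
    algebraMap_eq, sub_mul, Finset.sum_sub_distrib, Finset.sum_mul, Finset.mul_sum]
  rw [Finset.sum_comm (s := Finset.univ)]
  have : ∀ (k : Fin (n + 1)) (a : ℕ), (Polynomial.aeval (X none) (p k) *
      (C (t k) ^ a * rename some (Fa a)) : MvPolynomial (Option σ) ℝ) =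
      C (t k) ^ a * Polynomial.aeval (X none) (p k) * rename some (Fa a) := by
    intro k a; ring
  simp only [this]
  ring

end block

lemma aux_box {c : ℝ} (hc : 0 < c) (ι : Type) [Fintype ι] (F : MvPolynomial ι ℝ)
    (hF : ∀ x ∈ AuxBox c ι, 0 < eval x F) :
    ∃ (s : MvPolynomial ι ℝ) (a : ι → Polynomial ℝ), IsSumSq s ∧ (∀ i, AuxT c (a i)) ∧
      F = s + ∑ i, Polynomial.aeval (X i) (a i) := by
  revert F
  have : ∀ [Fintype ι], ∀ F : MvPolynomial ι ℝ, (∀ x ∈ AuxBox c ι, 0 < eval x F) →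
    ∃ (s : MvPolynomial ι ℝ) (a : ι → Polynomial ℝ), IsSumSq s ∧ (∀ i, AuxT c (a i)) ∧
      F = s + ∑ i, Polynomial.aeval (X i) (a i) := by
    induction ι using Finite.induction_empty_option with
    | of_equiv e ih =>
      rename_i α β
      intro _ F hF
      have : Fintype α := Fintype.ofEquiv β e.symm
      obtain ⟨s, a, hs, ha, h⟩ := ih (rename e.symm F) (fun x hx => by
        rw [eval_rename]; exact hF _ fun i => hx _)
      refine ⟨rename e s, fun i => a (e.symm i), aux_sumsq_map (rename e).toRingHom hs,
        fun i => ha _, ?_⟩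
      have h2 := congrArg (rename e) h
      rw [rename_rename] at h2
      simp only [Equiv.self_comp_symm, rename_id, AlgHom.id_apply] at h2
      rw [h2, map_add, map_sum]
      congr 1
      rw [← e.sum_comp]
      refine Finset.sum_congr rfl fun i _ => ?_
      rw [← Polynomial.aeval_algHom_apply, rename_X]
      simp only [e.symm_apply_apply]
    | h_empty =>
      intro _ F hF
      refine ⟨F, fun i => i.elim, ?_, fun i => i.elim, by simp⟩
      have h1 := hF (fun i => i.elim) (fun i => i.elim)
      rw [eq_C_of_isEmpty F] at h1 ⊢
      rw [eval_C] at h1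
      exact aux_sumsq_C h1.le
    | h_option ih =>
      rename_i α _
      intro _ F hF
      obtain ⟨s, a, b, hs, ha, hb, rfl⟩ := aux_two_block hc F hF
      obtain ⟨s', a', hs', ha', rfl⟩ := ih b hb
      refine ⟨s + rename some s', fun o => o.elim a a',
        hs.add (aux_sumsq_map (rename some).toRingHom hs'), ?_, ?_⟩
      · rintro (_ | i)
        · exact aux_uni_pos hc a ha
        · exact ha' i
      · have : ∀ G : Option α → MvPolynomial (Option α) ℝ,
            ∑ o, G o = G none + ∑ i, G (some i) := by
          intro G
          convert Fintype.sum_option G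
        rw [this, map_add, map_sum]
        simp only [Option.elim]
        simp only [← Polynomial.aeval_algHom_apply, rename_X]
        ring
  exact this

lemma aux_sos_of {ι : Type*} {q : MvPolynomial ι ℝ} (h : IsSumSq q) : IsSOS q := by
  induction h with
  | zero => exact ⟨0, fun i => i.elim0, by simp⟩
  | sq_add a hs ih =>
    obtain ⟨k, s, rfl⟩ := ih
    exact ⟨k + 1, Fin.cons a s, by simp [Fin.sum_univ_succ, sq]⟩

lemma aux_of_sos {ι : Type*} {q : MvPolynomial ι ℝ} (h : IsSOS q) : IsSumSq q := by
  obtain ⟨k, s, rfl⟩ := h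
  exact IsSumSq.sum_sq _ _

section qm
variable {ι κ : Type*} [Fintype κ] {g : κ → MvPolynomial ι ℝ}

lemma aux_qm_add {σ τ : MvPolynomial ι ℝ} (hσ : InQuadraticModule g σ)
    (hτ : InQuadraticModule g τ) : InQuadraticModule g (σ + τ) := by
  obtain ⟨c₀, c, h₀, h, rfl⟩ := hσ
  obtain ⟨d₀, d, k₀, k, rfl⟩ := hτ
  refine ⟨c₀ + d₀, fun j => c j + d j, aux_sos_of ((aux_of_sos h₀).add (aux_of_sos k₀)),
    fun j => aux_sos_of ((aux_of_sos (h j)).add (aux_of_sos (k j))), ?_⟩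
  simp only [add_mul, Finset.sum_add_distrib]; ring

lemma aux_qm_sos {σ : MvPolynomial ι ℝ} (hσ : IsSumSq σ) : InQuadraticModule g σ :=
  ⟨σ, fun _ => 0, aux_sos_of hσ, fun _ => aux_sos_of IsSumSq.zero, by simp⟩

lemma aux_qm_mul {t σ : MvPolynomial ι ℝ} (ht : IsSumSq t) (hσ : InQuadraticModule g σ) :
    InQuadraticModule g (t * σ) := by
  obtain ⟨c₀, c, h₀, h, rfl⟩ := hσ
  refine ⟨t * c₀, fun j => t * c j, aux_sos_of (ht.mul (aux_of_sos h₀)),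
    fun j => aux_sos_of (ht.mul (aux_of_sos (h j))), ?_⟩
  simp only [mul_add, Finset.mul_sum, mul_assoc]

lemma aux_qm_sum {β : Type*} (S : Finset β) {σ : β → MvPolynomial ι ℝ}
    (h : ∀ i, InQuadraticModule g (σ i)) : InQuadraticModule g (∑ i ∈ S, σ i) := by
  classical
  induction S using Finset.induction_on with
  | empty => simpa using aux_qm_sos IsSumSq.zero
  | insert i S hi ih => rw [Finset.sum_insert hi]; exact aux_qm_add (h i) ih

lemma aux_qm_coord [Fintype ι] {N c : ℝ} (hN : InQuadraticModule g (C N - ∑ i : ι, X i ^ 2))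
    (hc : N ≤ c ^ 2) (i : ι) : InQuadraticModule g (C (c ^ 2) - X i ^ 2) := by
  classical
  have h1 : IsSumSq (C (c ^ 2 - N) + ∑ j ∈ Finset.univ.erase i, (X j : MvPolynomial ι ℝ) ^ 2) :=
    IsSumSq.add (aux_sumsq_C (A := MvPolynomial ι ℝ) (sub_nonneg.mpr hc)) (IsSumSq.sum_sq _ _)
  convert aux_qm_add hN (aux_qm_sos h1) using 1
  rw [← Finset.add_sum_erase _ _ (Finset.mem_univ i), C_sub]
  ring

lemma aux_qm_uni [Fintype ι] {N c : ℝ} (hN : InQuadraticModule g (C N - ∑ i : ι, X i ^ 2))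
    (hc : N ≤ c ^ 2) {a : Polynomial ℝ} (ha : AuxT c a) (i : ι) :
    InQuadraticModule g (Polynomial.aeval (X i) a) := by
  obtain ⟨s, t, hs, ht, rfl⟩ := ha
  have h1 := aux_sumsq_map (Polynomial.aeval (X i : MvPolynomial ι ℝ)).toRingHom hs
  have h2 := aux_sumsq_map (Polynomial.aeval (X i : MvPolynomial ι ℝ)).toRingHom ht
  convert aux_qm_add (aux_qm_sos h1) (aux_qm_mul h2 (aux_qm_coord hN hc i)) using 1
  simp [algebraMap_eq]

end qm

lemma aux_penalty {W : Type*} [TopologicalSpace W] {K : Set W} (hK : IsCompact K)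
    {F P : W → ℝ} (hF : Continuous F) (hP : Continuous P) (hP0 : ∀ x, 0 ≤ P x)
    (h : ∀ x ∈ K, P x = 0 → 0 < F x) : ∃ M : ℝ, 0 ≤ M ∧ ∀ x ∈ K, 0 < F x + M * P x := by
  have hK' : IsCompact (K ∩ {x | F x ≤ 0}) := hK.inter_right (isClosed_le hF continuous_const)
  rcases (K ∩ {x | F x ≤ 0}).eq_empty_or_nonempty with he | hne
  · refine ⟨0, le_rfl, fun x hx => ?_⟩
    by_contra hcon
    have : x ∈ K ∩ {x | F x ≤ 0} := ⟨hx, by simpa using hcon⟩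
    rw [he] at this; exact this
  · obtain ⟨x₀, hx₀, hmin⟩ := hK'.exists_isMinOn hne hP.continuousOn
    obtain ⟨x₁, hx₁, hmin'⟩ := hK'.exists_isMinOn hne hF.continuousOn
    have hδ : 0 < P x₀ := lt_of_le_of_ne (hP0 _) fun h0 =>
      absurd (h x₀ hx₀.1 h0.symm) (not_lt.mpr hx₀.2)
    have hA : F x₁ ≤ 0 := hx₁.2
    refine ⟨(1 - F x₁) / P x₀, div_nonneg (by linarith) hδ.le, fun x hx => ?_⟩
    by_cases hx' : F x ≤ 0
    · have h1 : P x₀ ≤ P x := hmin ⟨hx, hx'⟩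
      have h2 : F x₁ ≤ F x := hmin' ⟨hx, hx'⟩
      have h3 : 1 - F x₁ ≤ (1 - F x₁) / P x₀ * P x := by
        calc 1 - F x₁ = (1 - F x₁) / P x₀ * P x₀ := by field_simp
          _ ≤ _ := mul_le_mul_of_nonneg_left h1 (div_nonneg (by linarith) hδ.le)
      linarith
    · have : 0 ≤ (1 - F x₁) / P x₀ * P x :=
        mul_nonneg (div_nonneg (by linarith) hδ.le) (hP0 x)
      push Not at hx'
      linarith

lemma aux_pen_poly {ι : Type*} (c : ℝ) (g : MvPolynomial ι ℝ) {M ε : ℝ} (hM : 0 ≤ M)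
    (hε : 0 < ε) : ∃ p : MvPolynomial ι ℝ, ∀ x ∈ AuxBox c ι,
      eval x (p ^ 2 * g) ≤ -(M * min 0 (eval x g) ^ 2) + ε := by
  obtain ⟨B, hB, hB'⟩ := aux_mv_bound c g
  obtain ⟨p, hp⟩ := aux_mv_sq_approx (aux_box_compact c ι)
    (φ := fun x => M * max 0 (-eval x g))
    (continuous_const.mul (continuous_const.max (aux_mv_cont g).neg))
    (fun x _ => mul_nonneg hM (le_max_left _ _)) (ε := ε / B) (by positivity)
  refine ⟨p, fun x hx => ?_⟩
  have h1 := (hp x hx).le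
  have h2 := hB' x hx
  rw [map_mul, map_pow]
  have h3 : |(M * max 0 (-eval x g) - eval x p ^ 2) * eval x g| ≤ ε := by
    rw [abs_mul]
    calc _ ≤ ε / B * B := mul_le_mul h1 h2 (abs_nonneg _) (by positivity)
      _ = ε := by field_simp
  have h4 : M * max 0 (-eval x g) * eval x g = -(M * min 0 (eval x g) ^ 2) := by
    rcases le_total 0 (eval x g) with h | h
    · rw [max_eq_left (by linarith), min_eq_left h]; ring
    · rw [max_eq_right (by linarith), min_eq_right h]; ring
  have h5 := (abs_le.mp h3).1
  rw [sub_mul, h4] at h5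
  linarith

lemma aux_pen_sum {ι κ : Type*} [Fintype κ] (c : ℝ) (g : κ → MvPolynomial ι ℝ) {M ε : ℝ}
    (hM : 0 ≤ M) (hε : 0 < ε) : ∃ p : κ → MvPolynomial ι ℝ, ∀ x ∈ AuxBox c ι,
      eval x (∑ j, p j ^ 2 * g j) ≤ -(M * ∑ j, min 0 (eval x (g j)) ^ 2) + ε := by
  choose p hp using fun j => aux_pen_poly c (g j) hM
    (show 0 < ε / (Fintype.card κ + 1) by positivity)
  refine ⟨p, fun x hx => ?_⟩
  rw [map_sum]
  have h1 := Finset.sum_le_sum fun j (_ : j ∈ Finset.univ) => hp j x hx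
  rw [Finset.sum_add_distrib, Finset.sum_const, Finset.card_univ, nsmul_eq_mul,
    Finset.sum_neg_distrib, ← Finset.mul_sum] at h1
  have h2 : (Fintype.card κ : ℝ) * (ε / (Fintype.card κ + 1)) ≤ ε := by
    rw [← mul_div_assoc, div_le_iff₀ (by positivity)]; nlinarith
  linarith

theorem cartesian_putinar_both
    (n m p a b : ℕ)
    (g : Fin a → MvPolynomial (Fin n) ℝ)
    (h : Fin b → MvPolynomial (Fin m ⊕ Fin p) ℝ)
    (Kx : Set (Fin n → ℝ))
    (Kyz : Set ((Fin m → ℝ) × (Fin p → ℝ)))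
    (K : Set ((Fin n → ℝ) × (Fin m → ℝ) × (Fin p → ℝ)))
    (hKx : Kx = {x | ∀ j, 0 ≤ eval x (g j)})
    (hKyz : Kyz = {w | ∀ k, 0 ≤ eval (Sum.elim w.1 w.2) (h k)})
    (hK : K = {w | w.1 ∈ Kx ∧ w.2 ∈ Kyz})
    (hKxCompact : IsCompact Kx) (hKyzCompact : IsCompact Kyz)
    (hKint : (interior K).Nonempty)
    (N N' : ℝ)
    (hN : InQuadraticModule g (C N - ∑ i : Fin n, X i ^ 2))
    (hN' : InQuadraticModule h (C N' - ∑ v : Fin m ⊕ Fin p, X v ^ 2))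
    (f : MvPolynomial (Fin n ⊕ Fin m ⊕ Fin p) ℝ)
    (f₁ : MvPolynomial (Fin n ⊕ Fin m) ℝ) (f₂ : MvPolynomial (Fin m ⊕ Fin p) ℝ)
    (hf : f = rename (Sum.map id Sum.inl) f₁ + rename Sum.inr f₂)
    (hpos : ∀ w ∈ K, 0 < eval (Sum.elim w.1 (Sum.elim w.2.1 w.2.2)) f) :
    ∃ (κpol : MvPolynomial (Fin n ⊕ Fin m) ℝ) (σ : MvPolynomial (Fin n) ℝ)
      (ψ : MvPolynomial (Fin m ⊕ Fin p) ℝ),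
      IsSOS κpol ∧ InQuadraticModule g σ ∧ InQuadraticModule h ψ ∧
      f = rename (Sum.map id Sum.inl) κpol + rename Sum.inl σ + rename Sum.inr ψ := by
  classical
  obtain ⟨c, hc, hcN, hcN'⟩ : ∃ c : ℝ, 0 < c ∧ N ≤ c ^ 2 ∧ N' ≤ c ^ 2 := by
    refine ⟨|N| + |N'| + 1, by positivity, ?_, ?_⟩ <;>
      nlinarith [abs_nonneg N, abs_nonneg N', le_abs_self N, le_abs_self N']
  have hcomp1 : Continuous fun w : (Fin n ⊕ Fin m ⊕ Fin p) → ℝ => (fun i => w (Sum.inl i)) :=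
    continuous_pi fun i => continuous_apply _
  have hcomp2 : Continuous fun w : (Fin n ⊕ Fin m ⊕ Fin p) → ℝ => (fun i => w (Sum.inr i)) :=
    continuous_pi fun i => continuous_apply _
  let P : ((Fin n ⊕ Fin m ⊕ Fin p) → ℝ) → ℝ := fun w =>
    ∑ j, min 0 (eval (fun i => w (Sum.inl i)) (g j)) ^ 2 +
      ∑ k, min 0 (eval (fun i => w (Sum.inr i)) (h k)) ^ 2
  have hPc : Continuous P := by
    refine Continuous.add ?_ ?_
    · exact continuous_finsetSum _ fun j _ =>
        (continuous_const.min ((aux_mv_cont (g j)).comp hcomp1)).pow 2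
    · exact continuous_finsetSum _ fun j _ =>
        (continuous_const.min ((aux_mv_cont (h j)).comp hcomp2)).pow 2
  have hmin0 : ∀ r : ℝ, min 0 r ^ 2 = 0 → 0 ≤ r := by
    intro r hr
    have := pow_eq_zero_iff (two_ne_zero) |>.mp hr
    rw [← this]; exact min_le_right _ _
  obtain ⟨M, hM, hMpos⟩ := aux_penalty (aux_box_compact c (Fin n ⊕ Fin m ⊕ Fin p))
    (aux_mv_cont f) hPc (fun w => by positivity) (by
      intro w _ hw
      have h1 : ∑ j, min 0 (eval (fun i => w (Sum.inl i)) (g j)) ^ 2 = 0 ∧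
          ∑ k, min 0 (eval (fun i => w (Sum.inr i)) (h k)) ^ 2 = 0 :=
        (add_eq_zero_iff_of_nonneg (by positivity) (by positivity)).mp hw
      rw [Finset.sum_eq_zero_iff_of_nonneg (fun _ _ => sq_nonneg _),
        Finset.sum_eq_zero_iff_of_nonneg (fun _ _ => sq_nonneg _)] at h1
      have h2 := hpos (fun i => w (Sum.inl i), fun i => w (Sum.inr (Sum.inl i)),
        fun i => w (Sum.inr (Sum.inr i))) (by
          subst hK hKx hKyz
          refine ⟨fun j => hmin0 _ (h1.1 j (Finset.mem_univ _)), fun k => ?_⟩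
          have h3 := hmin0 _ (h1.2 k (Finset.mem_univ _))
          convert h3 using 3
          funext i
          rcases i with i | i <;> rfl)
      convert h2 using 3
      funext i
      rcases i with i | i | i <;> rfl)
  have hGc : Continuous fun w => eval w f + M * P w :=
    (aux_mv_cont f).add (continuous_const.mul hPc)
  obtain ⟨w₀, hw₀, hmin⟩ := (aux_box_compact c (Fin n ⊕ Fin m ⊕ Fin p)).exists_isMinOn
    ⟨fun _ => 0, fun _ => by simpa using hc.le⟩ hGc.continuousOn
  set η := eval w₀ f + M * P w₀ with hη
  have hη0 : 0 < η := hMpos w₀ hw₀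
  obtain ⟨u, hu⟩ := aux_pen_sum c g hM (show 0 < η / 4 by positivity)
  obtain ⟨v, hv⟩ := aux_pen_sum c h hM (show 0 < η / 4 by positivity)
  set A := ∑ j, u j ^ 2 * g j with hA
  set B := ∑ k, v k ^ 2 * h k with hB
  set F₁ := f₁ - rename Sum.inl A with hF₁
  set F₂ := f₂ - B with hF₂
  have hF : ∀ x ∈ AuxBox c (Fin n), ∀ y ∈ AuxBox c (Fin m), ∀ z ∈ AuxBox c (Fin p),
      η / 2 ≤ eval (Sum.elim x y) F₁ + eval (Sum.elim y z) F₂ := by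
    intro x hx y hy z hz
    have hyz : Sum.elim y z ∈ AuxBox c (Fin m ⊕ Fin p) := by
      rintro (i | i)
      · exact hy i
      · exact hz i
    have h1 : η ≤ eval (Sum.elim x (Sum.elim y z)) f + M * P (Sum.elim x (Sum.elim y z)) := by
      refine hmin (show Sum.elim x (Sum.elim y z) ∈ _ from ?_)
      rintro (i | i)
      · exact hx i
      · exact hyz i
    have h2 := hu x hx
    have h3 := hv _ hyz
    have h4 : P (Sum.elim x (Sum.elim y z)) = ∑ j, min 0 (eval x (g j)) ^ 2 +
      ∑ k, min 0 (eval (Sum.elim y z) (h k)) ^ 2 := rfl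
    have e1 : Sum.elim x (Sum.elim y z) ∘ Sum.map id Sum.inl = Sum.elim x y := by
      funext i; rcases i with i | i <;> rfl
    have e2 : Sum.elim x (Sum.elim y z) ∘ Sum.inr = Sum.elim y z := rfl
    have e3 : Sum.elim x y ∘ Sum.inl = x := rfl
    rw [h4, hf, map_add, eval_rename, eval_rename, e1, e2] at h1
    rw [hF₁, hF₂, map_sub, map_sub, eval_rename, e3]
    linarith
  let φ : (Fin m → ℝ) → ℝ := fun y =>
    sInf ((fun x => eval (Sum.elim x y) F₁) '' AuxBox c (Fin n))
  have hcx : ∀ y : Fin m → ℝ, Continuous fun x : Fin n → ℝ => eval (Sum.elim x y) F₁ := by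
    intro y
    refine (aux_mv_cont F₁).comp (continuous_pi ?_)
    rintro (i | i)
    · exact continuous_apply i
    · exact continuous_const
  have hφ : Continuous φ := by
    refine IsCompact.continuous_sInf (f := fun (y : Fin m → ℝ) (x : Fin n → ℝ) =>
      eval (Sum.elim x y) F₁) (aux_box_compact c (Fin n)) ?_
    refine (aux_mv_cont F₁).comp
      (f := fun w : (Fin m → ℝ) × (Fin n → ℝ) => Sum.elim w.2 w.1) (continuous_pi ?_)
    rintro (i | i)
    · exact (continuous_apply i).comp continuous_snd
    · exact (continuous_apply i).comp continuous_fst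
  obtain ⟨q, hq⟩ := aux_mv_approx (aux_box_compact c (Fin m)) (φ := fun y => φ y - η / 8)
    (hφ.sub continuous_const) (show 0 < η / 8 by positivity)
  have hpos1 : ∀ w ∈ AuxBox c (Fin n ⊕ Fin m), 0 < eval w (F₁ - rename Sum.inr q) := by
    intro w hw
    have h1 := hq (w ∘ Sum.inr) (fun i => hw _)
    have h2 : φ (w ∘ Sum.inr) ≤ eval w F₁ := by
      refine csInf_le ((aux_box_compact c (Fin n)).image (hcx _)).bddBelow
        ⟨w ∘ Sum.inl, fun i => hw _, ?_⟩
      simp only [Sum.elim_comp_inl_inr]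
    rw [map_sub, eval_rename]
    rw [abs_lt] at h1
    linarith
  have hpos2 : ∀ w ∈ AuxBox c (Fin m ⊕ Fin p), 0 < eval w (F₂ + rename Sum.inl q) := by
    intro w hw
    have h1 := hq (w ∘ Sum.inl) (fun i => hw _)
    have h2 : η / 2 - eval w F₂ ≤ φ (w ∘ Sum.inl) := by
      refine le_csInf (Set.Nonempty.image _ ⟨fun _ => 0, fun _ => by simpa using hc.le⟩) ?_
      rintro _ ⟨x, hx, rfl⟩
      have h3 := hF x hx (w ∘ Sum.inl) (fun i => hw _) (w ∘ Sum.inr) (fun i => hw _)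
      rw [Sum.elim_comp_inl_inr] at h3
      simp only
      linarith
    rw [map_add, eval_rename]
    rw [abs_lt] at h1
    linarith
  obtain ⟨s₁, a₁, hs₁, ha₁, h₁⟩ := aux_box hc _ _ hpos1
  obtain ⟨s₂, a₂, hs₂, ha₂, h₂⟩ := aux_box hc _ _ hpos2
  refine ⟨s₁, A + ∑ i, Polynomial.aeval (X i) (a₁ (Sum.inl i)),
    B + s₂ + ∑ i, Polynomial.aeval (X i) (a₂ i) +
      ∑ i, Polynomial.aeval (X (Sum.inl i)) (a₁ (Sum.inr i)),
    aux_sos_of hs₁, ?_, ?_, ?_⟩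
  · exact aux_qm_add ⟨0, fun j => u j ^ 2, aux_sos_of IsSumSq.zero,
      fun j => aux_sos_of (aux_sumsq_sq _), by rw [zero_add]⟩
      (aux_qm_sum _ fun i => aux_qm_uni hN hcN (ha₁ _) i)
  · refine aux_qm_add (aux_qm_add (aux_qm_add ⟨0, fun j => v j ^ 2, aux_sos_of IsSumSq.zero,
      fun j => aux_sos_of (aux_sumsq_sq _), by rw [zero_add]⟩ (aux_qm_sos hs₂))
      (aux_qm_sum _ fun i => aux_qm_uni hN' hcN' (ha₂ _) i))
      (aux_qm_sum _ fun i => aux_qm_uni hN' hcN' (ha₁ _) _)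
  · have e1 : f₁ = s₁ + ∑ i, Polynomial.aeval (X i) (a₁ i) + rename Sum.inl A +
        rename Sum.inr q := by rw [← h₁, hF₁]; ring
    have e2 : f₂ = s₂ + ∑ i, Polynomial.aeval (X i) (a₂ i) + B - rename Sum.inl q := by
      rw [← h₂, hF₂]; ring
    rw [hf, e1, e2]
    simp only [map_add, map_sub, map_sum, rename_rename, ← Polynomial.aeval_algHom_apply,
      rename_X, Fintype.sum_sum_type, Sum.map_inl, Sum.map_inr, id]
    have e3 : (Sum.map id Sum.inl ∘ Sum.inl : Fin n → Fin n ⊕ Fin m ⊕ Fin p) = Sum.inl := rfl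
    have e4 : (Sum.map id Sum.inl ∘ Sum.inr : Fin m → Fin n ⊕ Fin m ⊕ Fin p) =
      Sum.inr ∘ Sum.inl := rfl
    rw [e3, e4]
    ring
end
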